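/- arXiv:1406.0576 — 3 statements merged into one kernel-verified Lean document; each statement's English description precedes it below -/
import Mathlib

section
/- There exists an absolute constant c > 0 such that every combinatorial market admits a competitive bundling equilibrium whose welfare is at least c · OPT / (m^{2/3} · (log(m) + 2)²). -/
open Finset

/-- A combinatorial market with `n` consumers and `m` items. Each consumer has a
normalized (`v i ∅ = 0`) and monotone valuation over subsets of items. -/
structure Market (n m : ℕ) where
  v : Fin n → Finset (Fin m) → ℝ
  v_empty : ∀ i, v i ∅ = 0
  v_mono : ∀ i, ∀ S T : Finset (Fin m), S ⊆ T → v i S ≤ v i T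

/-- An allocation assigns pairwise disjoint sets of items to consumers. -/
def IsAllocation {n m : ℕ} (S : Fin n → Finset (Fin m)) : Prop :=
  ∀ i j : Fin n, i ≠ j → Disjoint (S i) (S j)

/-- The welfare of an allocation. -/
def allocWelfare {n m : ℕ} (Mk : Market n m) (S : Fin n → Finset (Fin m)) : ℝ :=
  ∑ i, Mk.v i (S i)

/-- The optimal welfare over all allocations. -/
noncomputable def OPT {n m : ℕ} (Mk : Market n m) : ℝ :=
  sSup {w : ℝ | ∃ S : Fin n → Finset (Fin m), IsAllocation S ∧ allocWelfare Mk S = w}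

/-- A competitive bundling equilibrium: a partition of the items into nonempty bundles,
nonnegative bundle prices, and an assignment of every bundle to a consumer (market
clearance), such that every consumer's assigned set of bundles maximizes his profit
over all sets of bundles. -/
structure CBE {n m : ℕ} (Mk : Market n m) where
  bundles : Finset (Finset (Fin m))
  price : Finset (Fin m) → ℝ
  assign : Finset (Fin m) → Fin n
  bundles_nonempty : ∀ b ∈ bundles, b.Nonempty
  bundles_disjoint : ∀ b ∈ bundles, ∀ b' ∈ bundles, b ≠ b' → Disjoint b b'
  bundles_cover : bundles.biUnion id = Finset.univ
  price_nonneg : ∀ b ∈ bundles, 0 ≤ price b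
  profit_max : ∀ i : Fin n, ∀ T : Finset (Finset (Fin m)), T ⊆ bundles →
    Mk.v i ((bundles.filter fun b => assign b = i).biUnion id)
        - ∑ b ∈ bundles.filter fun b => assign b = i, price b
      ≥ Mk.v i (T.biUnion id) - ∑ b ∈ T, price b

/-- The welfare of a competitive bundling equilibrium. -/
def CBE.welfare {n m : ℕ} {Mk : Market n m} (E : CBE Mk) : ℝ :=
  ∑ i, Mk.v i ((E.bundles.filter fun b => E.assign b = i).biUnion id)

/-- The revenue of a competitive bundling equilibrium. -/
def CBE.revenue {n m : ℕ} {Mk : Market n m} (E : CBE Mk) : ℝ :=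
  ∑ b ∈ E.bundles, E.price b

/-- A market is multi-unit if valuations depend only on the number of items. -/
def MultiUnit {n m : ℕ} (Mk : Market n m) : Prop :=
  ∀ i, ∀ S T : Finset (Fin m), S.card = T.card → Mk.v i S = Mk.v i T


section AL
variable {ι β : Type*} [Fintype ι] [DecidableEq ι] [Fintype β] [DecidableEq β]

def alVal (f : ι → Finset β → ℝ) (r : β → ℝ) (A : ι → Finset β) (q : ι → ℝ)
    (i : ι) (D : Finset ι) (T : Finset β) : ℝ :=
  f i (D.biUnion A ∪ T) - ∑ j ∈ D, q j - ∑ b ∈ T, r b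

def alSat (f : ι → Finset β → ℝ) (r : β → ℝ) (ε : ℝ) (G : Finset β)
    (A : ι → Finset β) (q : ι → ℝ) (i : ι) : Prop :=
  ∀ D : Finset ι, ∀ T : Finset β, T ⊆ G → (∀ j, Disjoint T (A j)) →
    alVal f r A q i D T ≤ f i (A i) - q i + ε

structure AlInv (f : ι → Finset β → ℝ) (r : β → ℝ) (ε : ℝ) (G : Finset β)
    (A : ι → Finset β) (q : ι → ℝ) : Prop where
  sub : ∀ i, A i ⊆ G
  disj : ∀ i j, i ≠ j → Disjoint (A i) (A j)
  emp : ∀ i, A i = ∅ → q i = 0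
  ge : ∀ i, ∑ b ∈ A i, r b ≤ q i
  sat : ∀ i, A i ≠ ∅ → alSat f r ε G A q i

def alRev (r : β → ℝ) (G : Finset β) (A : ι → Finset β) (q : ι → ℝ) : ℝ :=
  ∑ i, q i + ∑ b ∈ G \ Finset.univ.biUnion A, r b

theorem al_step (f : ι → Finset β → ℝ) (r : β → ℝ) (ε : ℝ) (G : Finset β)
    (A : ι → Finset β) (q : ι → ℝ) (hf : ∀ i, f i ∅ = 0) (hε : 0 < ε)
    (h : AlInv f r ε G A q) (i : ι) (hi : ¬ alSat f r ε G A q i) :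
    ∃ A' q', AlInv f r ε G A' q' ∧ (∀ b, (∃ j, b ∈ A j) → ∃ j, b ∈ A' j) ∧
      alRev r G A' q' = alRev r G A q + ε := by
  have hAi : A i = ∅ := by
    by_contra hne; exact hi (h.sat i hne)
  have hqi : q i = 0 := h.emp i hAi
  -- choose a maximiser
  obtain ⟨⟨D, T⟩, hDT, hmax⟩ := Finset.exists_max_image
    ((Finset.univ : Finset (Finset ι × Finset β)).filter
      (fun x => x.2 ⊆ G ∧ ∀ j, Disjoint x.2 (A j)))
    (fun x => alVal f r A q i x.1 x.2) ⟨(∅, ∅), by simp⟩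
  simp only [Finset.mem_filter, Finset.mem_univ, true_and] at hDT hmax
  obtain ⟨hTG, hTA⟩ := hDT
  have hmax' : ∀ D' T', T' ⊆ G → (∀ j, Disjoint T' (A j)) →
      alVal f r A q i D' T' ≤ alVal f r A q i D T := fun D' T' h1 h2 => hmax (D', T') ⟨h1, h2⟩
  have hbig : ε < alVal f r A q i D T := by
    by_contra hle
    apply hi
    intro D' T' h1 h2
    rw [hAi, hf, hqi]
    have := hmax' D' T' h1 h2
    linarith
  set Z := D.biUnion A ∪ T with hZ
  have hZne : Z ≠ ∅ := by
    intro hZe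
    have hT : T = ∅ := by
      apply Finset.subset_empty.1; rw [← hZe]; exact Finset.subset_union_right
    have hD : ∀ j ∈ D, q j = 0 := by
      intro j hj
      apply h.emp
      apply Finset.subset_empty.1; rw [← hZe]
      exact (Finset.subset_biUnion_of_mem A hj).trans Finset.subset_union_left
    have : alVal f r A q i D T = 0 := by
      unfold alVal
      rw [← hZ, hZe, hf, Finset.sum_eq_zero hD, hT]; simp
    linarith
  let A' : ι → Finset β := fun j => if j = i then Z else if j ∈ D then ∅ else A j
  let q' : ι → ℝ := fun j => if j = i then ∑ j ∈ D, q j + ∑ b ∈ T, r b + ε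
    else if j ∈ D then 0 else q j
  have hA'i : A' i = Z := by simp [A']
  have hq'i : q' i = ∑ j ∈ D, q j + ∑ b ∈ T, r b + ε := by simp [q']
  have hA'D : ∀ j, j ≠ i → j ∈ D → A' j = ∅ := fun j h1 h2 => by simp [A', h1, h2]
  have hq'D : ∀ j, j ≠ i → j ∈ D → q' j = 0 := fun j h1 h2 => by simp [q', h1, h2]
  have hA'N : ∀ j, j ≠ i → j ∉ D → A' j = A j := fun j h1 h2 => by simp [A', h1, h2]
  have hq'N : ∀ j, j ≠ i → j ∉ D → q' j = q j := fun j h1 h2 => by simp [q', h1, h2]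
  -- comparison of values
  have hkey : ∀ D' T', T' ⊆ G → (∀ j, Disjoint T' (A' j)) →
      ∃ D'' T'', T'' ⊆ G ∧ (∀ j, Disjoint T'' (A j)) ∧
        ∀ k, alVal f r A' q' k D' T' ≤ alVal f r A q k D'' T'' := by
    intro D' T' hT'G hT'A
    have hT'old : ∀ j, Disjoint T' (A j) := by
      intro j
      by_cases hji : j = i
      · subst hji; rw [hAi]; exact Finset.disjoint_empty_right _
      by_cases hjD : j ∈ D
      · have := hT'A i
        rw [hA'i] at this
        exact this.mono_right
          ((Finset.subset_biUnion_of_mem A hjD).trans Finset.subset_union_left)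
      · have := hT'A j
        rwa [hA'N j hji hjD] at this
    by_cases hiD : i ∈ D'
    · refine ⟨D' ∪ D, T' ∪ T, Finset.union_subset hT'G hTG, fun j =>
        Finset.disjoint_union_left.2 ⟨hT'old j, hTA j⟩, fun k => ?_⟩
      have e1 : D'.biUnion A' ∪ T' = (D' ∪ D).biUnion A ∪ (T' ∪ T) := by
        ext b
        simp only [Finset.mem_union, Finset.mem_biUnion]
        constructor
        · rintro (⟨j, hj, hb⟩ | hb)
          · by_cases hji : j = i
            · subst hji
              rw [hA'i, hZ] at hb
              simp only [Finset.mem_union, Finset.mem_biUnion] at hb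
              rcases hb with ⟨a, ha, hb⟩ | hb
              · exact Or.inl ⟨a, Or.inr ha, hb⟩
              · exact Or.inr (Or.inr hb)
            · by_cases hjD : j ∈ D
              · rw [hA'D j hji hjD] at hb; simp at hb
              · rw [hA'N j hji hjD] at hb; exact Or.inl ⟨j, Or.inl hj, hb⟩
          · exact Or.inr (Or.inl hb)
        · rintro (⟨j, hj, hb⟩ | hb | hb)
          · by_cases hjD : j ∈ D
            · left; refine ⟨i, hiD, ?_⟩
              rw [hA'i, hZ]
              exact Finset.mem_union_left _ (Finset.mem_biUnion.2 ⟨j, hjD, hb⟩)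
            · have hji : j ≠ i := by rintro rfl; rw [hAi] at hb; simp at hb
              left; refine ⟨j, by tauto, ?_⟩
              rw [hA'N j hji hjD]; exact hb
          · exact Or.inr hb
          · left; refine ⟨i, hiD, ?_⟩
            rw [hA'i, hZ]; exact Finset.mem_union_right _ hb
      have hTT : Disjoint T' T := by
        have := hT'A i
        rw [hA'i] at this
        exact this.mono_right Finset.subset_union_right
      have e2 : ∑ j ∈ D', q' j = ∑ j ∈ D' ∪ D, q j + ∑ b ∈ T, r b + ε := by
        have e3 : ∑ j ∈ D'.erase i, q' j = ∑ j ∈ D' \ D, q j := by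
          rw [← Finset.sum_filter_add_sum_filter_not (D'.erase i) (fun j => j ∈ D)]
          rw [Finset.sum_eq_zero (s := (D'.erase i).filter (fun j => j ∈ D)), zero_add]
          · have : ∑ j ∈ (D'.erase i).filter (fun j => j ∉ D), q' j
                = ∑ j ∈ (D'.erase i).filter (fun j => j ∉ D), q j := by
              apply Finset.sum_congr rfl
              intro j hj
              simp only [Finset.mem_filter, Finset.mem_erase] at hj
              exact hq'N j hj.1.1 hj.2
            rw [this]
            apply Finset.sum_subset
            · intro j hj
              simp only [Finset.mem_filter, Finset.mem_erase] at hj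
              simp [hj.1.2, hj.2]
            · intro j hj hj'
              simp only [Finset.mem_filter, Finset.mem_erase, Finset.mem_sdiff] at hj hj'
              have : j = i := by tauto
              rw [this, hqi]
          · intro j hj
            simp only [Finset.mem_filter, Finset.mem_erase] at hj
            exact hq'D j hj.1.1 hj.2
        rw [← Finset.add_sum_erase D' q' hiD, e3, hq'i]
        have : ∑ j ∈ D' ∪ D, q j = ∑ j ∈ D' \ D, q j + ∑ j ∈ D, q j := by
          rw [← Finset.sum_union Finset.sdiff_disjoint, Finset.sdiff_union_self_eq_union]
        rw [this]; ring
      unfold alVal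
      rw [e1, e2, Finset.sum_union hTT]
      linarith
    · refine ⟨D' \ D, T', hT'G, hT'old, fun k => ?_⟩
      have e1 : D'.biUnion A' = (D' \ D).biUnion A := by
        ext b
        simp only [Finset.mem_biUnion, Finset.mem_sdiff]
        constructor
        · rintro ⟨j, hj, hb⟩
          have hji : j ≠ i := by rintro rfl; exact hiD hj
          by_cases hjD : j ∈ D
          · rw [hA'D j hji hjD] at hb; simp at hb
          · rw [hA'N j hji hjD] at hb; exact ⟨j, ⟨hj, hjD⟩, hb⟩
        · rintro ⟨j, ⟨hj, hjD⟩, hb⟩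
          have hji : j ≠ i := by rintro rfl; exact hiD hj
          exact ⟨j, hj, by rwa [hA'N j hji hjD]⟩
      have e2 : ∑ j ∈ D', q' j = ∑ j ∈ D' \ D, q j := by
        symm
        apply Finset.sum_subset_zero_on_sdiff Finset.sdiff_subset
        · intro j hj
          simp only [Finset.mem_sdiff, not_and, not_not] at hj
          exact hq'D j (by rintro rfl; exact hiD hj.1) (hj.2 hj.1)
        · intro j hj
          simp only [Finset.mem_sdiff] at hj
          exact (hq'N j (by rintro rfl; exact hiD hj.1) hj.2).symm
      unfold alVal
      rw [e1, e2]
  have hcov : Finset.univ.biUnion A' = Finset.univ.biUnion A ∪ T := by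
    ext b
    simp only [Finset.mem_union, Finset.mem_biUnion, Finset.mem_univ, true_and]
    constructor
    · rintro ⟨j, hb⟩
      by_cases hji : j = i
      · subst hji
        rw [hA'i, hZ] at hb
        simp only [Finset.mem_union, Finset.mem_biUnion] at hb
        rcases hb with ⟨a, ha, hb⟩ | hb
        · exact Or.inl ⟨a, hb⟩
        · exact Or.inr hb
      · by_cases hjD : j ∈ D
        · rw [hA'D j hji hjD] at hb; simp at hb
        · rw [hA'N j hji hjD] at hb; exact Or.inl ⟨j, hb⟩
    · rintro (⟨j, hb⟩ | hb)
      · by_cases hjD : j ∈ D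
        · exact ⟨i, by rw [hA'i, hZ]; exact Finset.mem_union_left _ (Finset.mem_biUnion.2 ⟨j, hjD, hb⟩)⟩
        · have hji : j ≠ i := by rintro rfl; rw [hAi] at hb; simp at hb
          exact ⟨j, by rwa [hA'N j hji hjD]⟩
      · exact ⟨i, by rw [hA'i, hZ]; exact Finset.mem_union_right _ hb⟩
  refine ⟨A', q', ⟨?_, ?_, ?_, ?_, ?_⟩, ?_, ?_⟩
  · intro j
    by_cases hji : j = i
    · subst hji; rw [hA'i]
      exact Finset.union_subset (Finset.biUnion_subset.2 fun a _ => h.sub a) hTG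
    by_cases hjD : j ∈ D
    · rw [hA'D j hji hjD]; simp
    · rw [hA'N j hji hjD]; exact h.sub j
  · have hdi : ∀ j, j ≠ i → Disjoint Z (A' j) := by
      intro j hji
      by_cases hjD : j ∈ D
      · rw [hA'D j hji hjD]; simp
      · rw [hA'N j hji hjD, hZ, Finset.disjoint_union_left]
        refine ⟨?_, hTA j⟩
        rw [Finset.disjoint_biUnion_left]
        intro a ha
        exact h.disj a j (by rintro rfl; exact hjD ha)
    intro j k hjk
    by_cases hji : j = i
    · subst hji; rw [hA'i]; exact hdi k hjk.symm
    by_cases hki : k = i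
    · subst hki; rw [hA'i]; exact (hdi j hji).symm
    by_cases hjD : j ∈ D
    · rw [hA'D j hji hjD]; simp
    by_cases hkD : k ∈ D
    · rw [hA'D k hki hkD]; simp
    rw [hA'N j hji hjD, hA'N k hki hkD]; exact h.disj j k hjk
  · intro j hj
    by_cases hji : j = i
    · subst hji; rw [hA'i] at hj; exact absurd hj hZne
    by_cases hjD : j ∈ D
    · exact hq'D j hji hjD
    · rw [hA'N j hji hjD] at hj; rw [hq'N j hji hjD]; exact h.emp j hj
  · intro j
    by_cases hji : j = i
    · subst hji
      rw [hA'i, hq'i, hZ, Finset.sum_union, Finset.sum_biUnion]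
      · have : ∑ x ∈ D, ∑ b ∈ A x, r b ≤ ∑ x ∈ D, q x := Finset.sum_le_sum fun x _ => h.ge x
        linarith
      · intro a _ b _ hab; exact h.disj a b hab
      · rw [Finset.disjoint_biUnion_left]; intro a _; exact (hTA a).symm
    by_cases hjD : j ∈ D
    · rw [hA'D j hji hjD, hq'D j hji hjD]; simp
    · rw [hA'N j hji hjD, hq'N j hji hjD]; exact h.ge j
  · intro j hj D' T' h1 h2
    obtain ⟨D'', T'', h3, h4, h5⟩ := hkey D' T' h1 h2
    by_cases hji : j = i
    · subst hji
      rw [hA'i, hq'i]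
      have h6 := (h5 j).trans (hmax' D'' T'' h3 h4)
      have : alVal f r A q j D T = f j Z - ∑ j ∈ D, q j - ∑ b ∈ T, r b := rfl
      linarith
    by_cases hjD : j ∈ D
    · exact absurd (hA'D j hji hjD) hj
    · rw [hA'N j hji hjD] at hj
      rw [hA'N j hji hjD, hq'N j hji hjD]
      exact (h5 j).trans (h.sat j hj D'' T'' h3 h4)
  · rintro b ⟨j, hb⟩
    have : b ∈ Finset.univ.biUnion A' := by
      rw [hcov]; exact Finset.mem_union_left _ (Finset.mem_biUnion.2 ⟨j, Finset.mem_univ _, hb⟩)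
    obtain ⟨k, _, hk⟩ := Finset.mem_biUnion.1 this
    exact ⟨k, hk⟩
  · unfold alRev
    have e1 : ∑ j, q' j = ∑ j, q j + ∑ b ∈ T, r b + ε := by
      have e3 : ∑ j, (q' j - q j + (if j ∈ D then q j else 0)) = ∑ j, if j = i then q' i else 0 := by
        apply Finset.sum_congr rfl
        intro j _
        by_cases hji : j = i
        · subst hji; simp [hqi]
        by_cases hjD : j ∈ D
        · simp [hq'D j hji hjD, hji, hjD]
        · simp [hq'N j hji hjD, hji, hjD]
      rw [Finset.sum_add_distrib, Finset.sum_sub_distrib] at e3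
      simp only [Finset.sum_ite_mem, Finset.univ_inter, Finset.sum_ite_eq', Finset.mem_univ, if_true, hq'i] at e3
      linarith
    have e2 : ∑ b ∈ G \ Finset.univ.biUnion A, r b
        = ∑ b ∈ G \ Finset.univ.biUnion A', r b + ∑ b ∈ T, r b := by
      have hsub : T ⊆ G \ Finset.univ.biUnion A := by
        intro b hb
        simp only [Finset.mem_sdiff, Finset.mem_biUnion, Finset.mem_univ, true_and, not_exists]
        exact ⟨hTG hb, fun j hj => Finset.disjoint_left.1 (hTA j) hb hj⟩
      rw [← Finset.sum_sdiff hsub, hcov, sdiff_sdiff_left]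
      rfl
    rw [e1, e2]; ring

theorem al_main (f : ι → Finset β → ℝ) (r : β → ℝ) (ε : ℝ) (G : Finset β)
    (A₀ : ι → Finset β) (q₀ : ι → ℝ) (hf : ∀ i, f i ∅ = 0) (hε : 0 < ε)
    (h : AlInv f r ε G A₀ q₀) :
    ∃ A q, AlInv f r ε G A q ∧ (∀ i, alSat f r ε G A q i) ∧
      (∀ b, (∃ j, b ∈ A₀ j) → ∃ j, b ∈ A j) := by
  let R : Set ℝ := {ρ | ∃ A q, AlInv f r ε G A q ∧
      (∀ b, (∃ j, b ∈ A₀ j) → ∃ j, b ∈ A j) ∧ ρ = alRev r G A q}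
  have hne : R.Nonempty := ⟨_, A₀, q₀, h, fun b hb => hb, rfl⟩
  have hbdd : BddAbove R := by
    refine ⟨∑ i, (∑ T : Finset β, |f i T| + ε) + ∑ b, |r b|, ?_⟩
    rintro ρ ⟨A, q, hI, -, rfl⟩
    unfold alRev
    apply add_le_add
    · apply Finset.sum_le_sum
      intro i _
      have h1 : f i (A i) ≤ ∑ T : Finset β, |f i T| :=
        (le_abs_self _).trans (Finset.single_le_sum (f := fun T => |f i T|)
          (fun T _ => abs_nonneg _) (Finset.mem_univ (A i)))
      have h0 : (0:ℝ) ≤ ∑ T : Finset β, |f i T| := Finset.sum_nonneg fun T _ => abs_nonneg _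
      by_cases hA : A i = ∅
      · rw [hI.emp i hA]; linarith
      · have := hI.sat i hA ∅ ∅ (by simp) (by simp)
        simp [alVal, hf] at this
        linarith
    · calc ∑ b ∈ G \ Finset.univ.biUnion A, r b ≤ ∑ b ∈ G \ Finset.univ.biUnion A, |r b| :=
            Finset.sum_le_sum fun b _ => le_abs_self _
        _ ≤ ∑ b, |r b| := Finset.sum_le_sum_of_subset_of_nonneg (Finset.subset_univ _)
            fun b _ _ => abs_nonneg _
  obtain ⟨ρ, ⟨A, q, hI, hc, rfl⟩, hlt⟩ := exists_lt_of_lt_csSup hne (sub_lt_self (sSup R) hε)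
  refine ⟨A, q, hI, ?_, hc⟩
  intro i
  by_contra hi
  obtain ⟨A', q', hI', hc', hr⟩ := al_step f r ε G A q hf hε hI i hi
  have : alRev r G A' q' ≤ sSup R := le_csSup hbdd ⟨A', q', hI', fun b hb => hc' b (hc b hb), rfl⟩
  linarith

end AL

structure ItemEq {n m : ℕ} (v : Fin n → Finset (Fin m) → ℝ) (ε : ℝ)
    (A : Fin n → Finset (Fin m)) (q : Fin n → ℝ) : Prop where
  disj : ∀ i j, i ≠ j → Disjoint (A i) (A j)
  cov : Finset.univ.biUnion A = Finset.univ
  nn : ∀ i, 0 ≤ q i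
  sat : ∀ i, ∀ D : Finset (Fin n),
    v i (D.biUnion A) - ∑ j ∈ D, q j ≤ v i (A i) - q i + ε

theorem itemEq_limit {n m : ℕ} (v : Fin n → Finset (Fin m) → ℝ) (hv : ∀ i, v i ∅ = 0) (ρ : ℝ)
    (h : ∀ ε : ℝ, 0 < ε → ∃ A q, ItemEq v ε A q ∧ ρ ≤ ∑ i, q i) :
    ∃ A q, ItemEq v 0 A q ∧ ρ ≤ ∑ i, q i := by
  have h1 : ∃ A, ∀ ε : ℝ, 0 < ε → ∃ q, ItemEq v ε A q ∧ ρ ≤ ∑ i, q i := by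
    by_contra hcon
    push Not at hcon
    choose e he hno using hcon
    obtain ⟨A0, -, hA0⟩ := Finset.exists_min_image
      (Finset.univ : Finset (Fin n → Finset (Fin m))) e ⟨fun _ => ∅, Finset.mem_univ _⟩
    obtain ⟨A, q, hq, hr⟩ := h (e A0) (he A0)
    have := hno A q ⟨hq.disj, hq.cov, hq.nn, fun i D => (hq.sat i D).trans (by
      have := hA0 A (Finset.mem_univ _); linarith)⟩
    linarith
  obtain ⟨A, hA⟩ := h1
  have hpos : ∀ k : ℕ, (0:ℝ) < 1 / ((k:ℝ) + 1) := fun k => by positivity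
  choose q hq hr using fun k : ℕ => hA (1 / ((k:ℝ) + 1)) (hpos k)
  have hcpt : IsCompact (Set.pi Set.univ (fun i : Fin n => Set.Icc (0:ℝ) (v i (A i) + 1))) :=
    isCompact_univ_pi fun i => isCompact_Icc
  have hmem : ∀ k, q k ∈ Set.pi Set.univ (fun i : Fin n => Set.Icc (0:ℝ) (v i (A i) + 1)) := by
    intro k i _
    refine ⟨(hq k).nn i, ?_⟩
    have := (hq k).sat i ∅
    simp only [Finset.biUnion_empty, hv, Finset.sum_empty] at this
    have h2 : 1 / ((k:ℝ) + 1) ≤ 1 := by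
      rw [div_le_one (by positivity)]; have : (0:ℝ) ≤ k := Nat.cast_nonneg k
      linarith
    linarith
  obtain ⟨q', -, φ, hφ, hlim⟩ := hcpt.tendsto_subseq hmem
  have hl : ∀ i, Filter.Tendsto (fun k => q (φ k) i) Filter.atTop (nhds (q' i)) :=
    fun i => (tendsto_pi_nhds.1 hlim) i
  have hε : Filter.Tendsto (fun k => 1 / ((φ k : ℝ) + 1)) Filter.atTop (nhds 0) :=
    tendsto_one_div_add_atTop_nhds_zero_nat.comp hφ.tendsto_atTop
  have hs : ∀ D : Finset (Fin n), Filter.Tendsto (fun k => ∑ i ∈ D, q (φ k) i) Filter.atTop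
      (nhds (∑ i ∈ D, q' i)) := fun D => tendsto_finsetSum D fun i _ => hl i
  refine ⟨A, q', ⟨(hq 0).disj, (hq 0).cov, ?_, ?_⟩, ?_⟩
  · intro i
    exact ge_of_tendsto' (hl i) fun k => (hq (φ k)).nn i
  · intro i D
    exact le_of_tendsto_of_tendsto' (tendsto_const_nhds.sub (hs D))
      ((tendsto_const_nhds.sub (hl i)).add hε) fun k => (hq (φ k)).sat i D
  · exact ge_of_tendsto' (hs Finset.univ) fun k => hr (φ k)

theorem itemEq_cbe {n m : ℕ} (hn : 1 ≤ n) (Mk : Market n m) (A : Fin n → Finset (Fin m))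
    (q : Fin n → ℝ) (h : ItemEq Mk.v 0 A q) :
    ∃ E : CBE Mk, E.welfare = ∑ i, Mk.v i (A i) := by
  classical
  have hq0 : ∀ i, A i = ∅ → q i = 0 := by
    intro i hi
    have := h.sat i ∅
    simp only [Finset.biUnion_empty, Mk.v_empty, Finset.sum_empty, hi] at this
    have := h.nn i
    linarith
  have huniq : ∀ i j, (A i).Nonempty → A i = A j → i = j := by
    intro i j hi hij
    by_contra hne
    have := h.disj i j hne
    rw [← hij, Finset.disjoint_self_iff_empty] at this
    exact hi.ne_empty this
  let asg : Finset (Fin m) → Fin n := fun b =>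
    if hb : ∃ i, A i = b then hb.choose else ⟨0, hn⟩
  have hasg : ∀ i, (A i).Nonempty → asg (A i) = i := by
    intro i hi
    have hex : ∃ j, A j = A i := ⟨i, rfl⟩
    have : asg (A i) = hex.choose := dif_pos hex
    rw [this]
    exact (huniq i _ hi hex.choose_spec.symm).symm
  let P : Finset (Finset (Fin m)) := (Finset.univ.image A).filter (fun b => b.Nonempty)
  have hP : ∀ b, b ∈ P ↔ b.Nonempty ∧ ∃ i, A i = b := by
    intro b; simp [P, and_comm]
  have hfil : ∀ i, (P.filter fun b => asg b = i) = if (A i).Nonempty then {A i} else ∅ := by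
    intro i
    ext b
    rw [Finset.mem_filter, hP]
    constructor
    · rintro ⟨⟨hb, j, rfl⟩, hj⟩
      rw [hasg j hb] at hj
      subst hj
      simp [hb]
    · intro hb
      split_ifs at hb with hi
      · rw [Finset.mem_singleton] at hb
        subst hb
        exact ⟨⟨hi, i, rfl⟩, hasg i hi⟩
      · simp at hb
  have hU : ∀ i, (P.filter fun b => asg b = i).biUnion id = A i := by
    intro i
    rw [hfil]
    split_ifs with hi
    · simp
    · rw [Finset.not_nonempty_iff_eq_empty.1 hi]; simp
  have hS : ∀ i, ∑ b ∈ P.filter (fun b => asg b = i), q (asg b) = q i := by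
    intro i
    rw [hfil]
    split_ifs with hi
    · simp [hasg i hi]
    · rw [hq0 i (Finset.not_nonempty_iff_eq_empty.1 hi)]; simp
  refine ⟨⟨P, fun b => q (asg b), asg, ?_, ?_, ?_, ?_, ?_⟩, ?_⟩
  · intro b hb; exact ((hP b).1 hb).1
  · intro b hb b' hb' hne
    obtain ⟨_, i, rfl⟩ := (hP b).1 hb
    obtain ⟨_, j, rfl⟩ := (hP b').1 hb'
    exact h.disj i j (by rintro rfl; exact hne rfl)
  · rw [← h.cov]
    ext x
    simp only [Finset.mem_biUnion, id, hP, Finset.mem_univ, true_and]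
    constructor
    · rintro ⟨b, ⟨_, i, rfl⟩, hx⟩; exact ⟨i, hx⟩
    · rintro ⟨i, hx⟩; exact ⟨A i, ⟨⟨x, hx⟩, i, rfl⟩, hx⟩
  · intro b _; exact h.nn _
  · intro i T hT
    rw [hU, hS]
    have h1 := h.sat i (T.image asg)
    have hA : ∀ b ∈ T, A (asg b) = b := by
      intro b hb
      obtain ⟨hne, j, rfl⟩ := (hP b).1 (hT hb)
      rw [hasg j hne]
    have h2 : (T.image asg).biUnion A = T.biUnion id := by
      rw [Finset.image_biUnion]
      exact Finset.biUnion_congr rfl fun b hb => hA b hb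
    have h3 : ∑ j ∈ T.image asg, q j = ∑ b ∈ T, q (asg b) := by
      apply Finset.sum_image
      intro b hb b' hb' he
      rw [← hA b hb, ← hA b' hb', he]
    rw [h2, h3] at h1
    linarith
  · unfold CBE.welfare
    exact Finset.sum_congr rfl fun i _ => by rw [hU]

theorem phase1 {n m : ℕ} (v : Fin n → Finset (Fin m) → ℝ)
    (hmono : ∀ i S T, S ⊆ T → v i S ≤ v i T)
    (K : Finset (Fin n)) (S : Fin n → Finset (Fin m))
    (hS : ∀ i j, i ≠ j → Disjoint (S i) (S j)) (h16 : ∀ i ∈ K, 16 ≤ v i (S i))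
    (V : ℝ) (hV : ∀ i, v i Finset.univ ≤ V) (hV16 : 16 ≤ V) (e : ℝ) (he : 0 < e) (he1 : e ≤ 1) :
    ∃ (I : Finset (Fin n)) (B : Fin n → Finset (Fin m)) (p u : Fin n → ℝ),
      (∀ i j, i ≠ j → Disjoint (B i) (B j)) ∧ (∀ i ∈ I, 8 ≤ p i) ∧
      (∀ i ∈ I, v i (B i) = p i + u i) ∧ (∀ i, 1 ≤ u i) ∧
      (∀ i, ∀ D ⊆ I, D.Nonempty →
        v i (D.biUnion B) - ∑ j ∈ D, p j ≤ u i + e - 4 * ((D.card : ℝ) - 1)) ∧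
      2 * (K.card : ℝ) ≤ I.card * V := by
  classical
  let f : Fin n → Finset (Fin n) → ℝ := fun i T => if T = ∅ then 0 else v i (T.biUnion S) - 6
  have hf0 : ∀ i, f i ∅ = 0 := fun i => by simp [f]
  have hf1 : ∀ i T, T ≠ ∅ → f i T = v i (T.biUnion S) - 6 := fun i T h => by simp [f, h]
  obtain ⟨A, q, hinv, hsat, -⟩ := al_main f (fun _ => (4:ℝ)) e K (fun _ => ∅) (fun _ => 0) hf0 he
    ⟨by simp, by simp, by simp, by simp, by simp⟩
  have hutil : ∀ i, -e ≤ f i (A i) - q i := by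
    intro i
    have := hsat i ∅ ∅ (by simp) (by simp)
    simp only [alVal, Finset.biUnion_empty, Finset.empty_union, hf0, Finset.sum_empty] at this
    linarith
  let I : Finset (Fin n) := Finset.univ.filter fun i => A i ≠ ∅
  have hI : ∀ i, i ∈ I ↔ A i ≠ ∅ := fun i => by simp [I]
  have hq4 : ∀ i, 4 * ((A i).card : ℝ) ≤ q i := by
    intro i
    have := hinv.ge i
    simp only [Finset.sum_const, nsmul_eq_mul] at this
    linarith
  have hcard1 : ∀ i ∈ I, (1:ℝ) ≤ (A i).card := by
    intro i hi
    have : 0 < (A i).card := Finset.card_pos.2 (Finset.nonempty_iff_ne_empty.2 ((hI i).1 hi))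
    exact_mod_cast this
  refine ⟨I, fun i => (A i).biUnion S, fun i => q i + 4, fun i => f i (A i) - q i + 2,
    ?_, ?_, ?_, ?_, ?_, ?_⟩
  · intro i j hij
    rw [Finset.disjoint_biUnion_left]
    intro a ha
    rw [Finset.disjoint_biUnion_right]
    intro b hb
    apply hS
    rintro rfl
    exact Finset.disjoint_left.1 (hinv.disj i j hij) ha hb
  · intro i hi
    have := hq4 i
    have := hcard1 i hi
    linarith
  · intro i hi
    have := hf1 i (A i) ((hI i).1 hi)
    simp only
    linarith
  · intro i
    have := hutil i
    simp only
    linarith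
  · intro i D hD hne
    have := hsat i D ∅ (by simp) (by simp)
    have hne' : D.biUnion A ≠ ∅ := by
      obtain ⟨j, hj⟩ := hne
      obtain ⟨x, hx⟩ := Finset.nonempty_iff_ne_empty.2 ((hI j).1 (hD hj))
      exact Finset.ne_empty_of_mem (Finset.mem_biUnion.2 ⟨j, hj, hx⟩)
    simp only [alVal, Finset.union_empty, Finset.sum_empty] at this
    rw [hf1 i _ hne', Finset.biUnion_biUnion] at this
    simp only [Finset.sum_add_distrib, Finset.sum_const, nsmul_eq_mul]
    linarith
  · have hsub : K ⊆ I ∪ I.biUnion A := by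
      intro b hb
      by_contra hcon
      rw [Finset.mem_union, not_or] at hcon
      obtain ⟨h1, h2⟩ := hcon
      have hun : ∀ j, b ∉ A j := by
        intro j hj
        exact h2 (Finset.mem_biUnion.2 ⟨j, (hI j).2 (Finset.ne_empty_of_mem hj), hj⟩)
      have hAb : A b = ∅ := by
        by_contra hne; exact h1 ((hI b).2 hne)
      have := hsat b ∅ {b} (by simpa using hb) (fun j => by simpa using hun j)
      simp only [alVal, Finset.biUnion_empty, Finset.empty_union, Finset.sum_empty,
        Finset.sum_singleton, hAb, hf0, hinv.emp b hAb] at this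
      rw [hf1 b _ (by simp), Finset.singleton_biUnion] at this
      have := h16 b hb
      linarith
    have h1 : (K.card : ℝ) ≤ I.card + ∑ i ∈ I, ((A i).card : ℝ) := by
      have := (Finset.card_le_card hsub).trans ((Finset.card_union_le _ _).trans
        (Nat.add_le_add_left Finset.card_biUnion_le _))
      exact_mod_cast this
    have h2 : ∑ i ∈ I, ((A i).card : ℝ) ≤ ∑ i ∈ I, V / 4 := by
      apply Finset.sum_le_sum
      intro i hi
      have a := hq4 i
      have b := hutil i
      rw [hf1 i _ ((hI i).1 hi)] at b
      have c := (hmono i _ _ (Finset.subset_univ ((A i).biUnion S))).trans (hV i)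
      linarith
    rw [Finset.sum_const, nsmul_eq_mul] at h2
    have : (0:ℝ) ≤ I.card := Nat.cast_nonneg _
    nlinarith

section UD
variable {ι β : Type*} [Fintype ι] [DecidableEq ι] [Fintype β] [DecidableEq β]

/-- Approximate unit-demand auction with reserve prices. -/
theorem ud_main (f : ι → Finset β → ℝ) (r : β → ℝ) (ε : ℝ) (G : Finset β)
    (hf : ∀ i, f i ∅ = 0) (hf2 : ∀ i T, 2 ≤ T.card → f i T = -10) (hr : ∀ b, 0 ≤ r b)
    (hε : 0 < ε) (hε1 : ε ≤ 1) :
    ∃ (A : ι → Finset β) (π : β → ℝ), (∀ i, A i ⊆ G) ∧ (∀ i j, i ≠ j → Disjoint (A i) (A j)) ∧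
      (∀ i, (A i).card ≤ 1) ∧ (∀ b, r b ≤ π b) ∧
      (∀ i, -ε ≤ f i (A i) - ∑ b ∈ A i, π b) ∧
      (∀ i, ∀ b ∈ G, f i {b} - π b ≤ f i (A i) - ∑ b ∈ A i, π b + ε) ∧
      (∀ M : ι → Finset β, (∀ i, M i ⊆ G) → (∀ i j, i ≠ j → Disjoint (M i) (M j)) →
        ∑ i, f i (M i) ≤ ∑ i, f i (A i) + ∑ b ∈ G \ Finset.univ.biUnion A, r b
          + Fintype.card ι * ε) := by
  classical
  obtain ⟨A, q, hinv, hsat, -⟩ := al_main f r ε G (fun _ => ∅) (fun _ => 0) hf hε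
    ⟨by simp, by simp, by simp, by simp, by simp⟩
  have hutil : ∀ i, -ε ≤ f i (A i) - q i := by
    intro i
    have := hsat i ∅ ∅ (by simp) (by simp)
    simp only [alVal, Finset.biUnion_empty, Finset.empty_union, hf, Finset.sum_empty] at this
    linarith
  have hq0 : ∀ i, 0 ≤ q i := fun i =>
    (Finset.sum_nonneg fun b _ => hr b).trans (hinv.ge i)
  have hcard : ∀ i, (A i).card ≤ 1 := by
    intro i
    by_contra hcon
    have h1 := hf2 i (A i) (by omega)
    have h2 := hutil i
    have h3 := hq0 i
    linarith
  let π : β → ℝ := fun b => if h : ∃ j, b ∈ A j then q h.choose else r b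
  have hπ1 : ∀ j, ∀ b ∈ A j, π b = q j := by
    intro j b hb
    have hex : ∃ j, b ∈ A j := ⟨j, hb⟩
    have h1 : π b = q hex.choose := dif_pos hex
    have h2 : hex.choose = j := by
      by_contra hne
      exact Finset.disjoint_left.1 (hinv.disj _ _ hne) hex.choose_spec hb
    rw [h1, h2]
  have hπ2 : ∀ b, (∀ j, b ∉ A j) → π b = r b := by
    intro b hb
    exact dif_neg (by push Not; exact hb)
  have hsing : ∀ i, ∀ b ∈ A i, A i = {b} := by
    intro i b hb
    exact Finset.eq_singleton_iff_unique_mem.2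
      ⟨hb, fun x hx => Finset.card_le_one.1 (hcard i) x hx b hb⟩
  have hsum : ∀ i, ∑ b ∈ A i, π b = q i := by
    intro i
    by_cases h : A i = ∅
    · rw [h, hinv.emp i h]; simp
    · obtain ⟨b, hb⟩ := Finset.nonempty_iff_ne_empty.2 h
      rw [hsing i b hb, Finset.sum_singleton, hπ1 i b hb]
  have hrπ : ∀ b, r b ≤ π b := by
    intro b
    by_cases h : ∃ j, b ∈ A j
    · obtain ⟨j, hj⟩ := h
      rw [hπ1 j b hj]
      have := hinv.ge j
      rw [hsing j b hj, Finset.sum_singleton] at this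
      exact this
    · push Not at h
      rw [hπ2 b h]
  have hone : ∀ i, ∀ b ∈ G, f i {b} - π b ≤ f i (A i) - q i + ε := by
    intro i b hb
    by_cases h : ∃ j, b ∈ A j
    · obtain ⟨j, hj⟩ := h
      rw [hπ1 j b hj]
      have := hsat i {j} ∅ (by simp) (by simp)
      simp only [alVal, Finset.singleton_biUnion, Finset.union_empty, Finset.sum_singleton,
        Finset.sum_empty, hsing j b hj] at this
      linarith
    · push Not at h
      rw [hπ2 b h]
      have := hsat i ∅ {b} (by simpa using hb) (fun j => by simpa using h j)
      simp only [alVal, Finset.biUnion_empty, Finset.empty_union, Finset.sum_singleton,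
        Finset.sum_empty] at this
      linarith
  refine ⟨A, π, hinv.sub, hinv.disj, hcard, hrπ, ?_, ?_, ?_⟩
  · intro i; rw [hsum]; exact hutil i
  · intro i b hb; rw [hsum]; exact hone i b hb
  · intro M hMG hMd
    have hπ0 : ∀ b, 0 ≤ π b := fun b => (hr b).trans (hrπ b)
    have h1 : ∀ i, f i (M i) ≤ f i (A i) - q i + ε + ∑ b ∈ M i, π b := by
      intro i
      have hu := hutil i
      by_cases h0 : M i = ∅
      · rw [h0, hf]; simp; linarith
      by_cases h2 : 2 ≤ (M i).card
      · rw [hf2 i _ h2]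
        have := Finset.sum_nonneg fun b (_ : b ∈ M i) => hπ0 b
        linarith
      · have hc : (M i).card = 1 := by
          have := Finset.card_pos.2 (Finset.nonempty_iff_ne_empty.2 h0)
          omega
        obtain ⟨b, hb⟩ := Finset.card_eq_one.1 hc
        have hbG : b ∈ G := hMG i (by rw [hb]; simp)
        rw [hb, Finset.sum_singleton]
        have := hone i b hbG
        linarith
    have h2 : ∑ i, ∑ b ∈ M i, π b ≤ ∑ b ∈ G, π b := by
      rw [← Finset.sum_biUnion (fun i _ j _ hij => hMd i j hij)]
      apply Finset.sum_le_sum_of_subset_of_nonneg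
      · intro b hb
        obtain ⟨i, -, hi⟩ := Finset.mem_biUnion.1 hb
        exact hMG i hi
      · intro b _ _; exact hπ0 b
    have h3 : ∑ b ∈ G, π b = ∑ i, q i + ∑ b ∈ G \ Finset.univ.biUnion A, r b := by
      have hsub : Finset.univ.biUnion A ⊆ G := by
        intro b hb
        obtain ⟨i, -, hi⟩ := Finset.mem_biUnion.1 hb
        exact hinv.sub i hi
      rw [← Finset.sum_sdiff hsub, Finset.sum_biUnion (fun i _ j _ hij => hinv.disj i j hij)]
      rw [Finset.sum_congr rfl (fun i _ => hsum i), add_comm]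
      congr 1
      apply Finset.sum_congr rfl
      intro b hb
      apply hπ2
      intro j hj
      exact (Finset.mem_sdiff.1 hb).2 (Finset.mem_biUnion.2 ⟨j, Finset.mem_univ _, hj⟩)
    calc ∑ i, f i (M i) ≤ ∑ i, (f i (A i) - q i + ε + ∑ b ∈ M i, π b) :=
          Finset.sum_le_sum fun i _ => h1 i
      _ = ∑ i, f i (A i) - ∑ i, q i + Fintype.card ι * ε + ∑ i, ∑ b ∈ M i, π b := by
          rw [Finset.sum_add_distrib, Finset.sum_add_distrib, Finset.sum_sub_distrib]
          simp
      _ ≤ _ := by linarith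
end UD

section Ph2
variable {n m : ℕ}

/-- The bundle attached to an abstract item: `none` is the leftover bundle. -/
def bun (B : Fin n → Finset (Fin m)) (X : Finset (Fin n)) : Option (Fin n) → Finset (Fin m)
  | none => Finset.univ \ X.biUnion B
  | some b => B b

noncomputable def wt (v : Fin n → Finset (Fin m) → ℝ) (B : Fin n → Finset (Fin m))
    (p u : Fin n → ℝ) (X : Finset (Fin n)) (i : Fin n) : Option (Fin n) → ℝ
  | none => v i (bun B X none) - u i + 1
  | some b => v i (B b) - p b - u i + 2

noncomputable def fv (v : Fin n → Finset (Fin m) → ℝ) (B : Fin n → Finset (Fin m))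
    (p u : Fin n → ℝ) (X : Finset (Fin n)) (i : Fin n) (T : Finset (Option (Fin n))) : ℝ :=
  if T.card ≤ 1 then ∑ b ∈ T, wt v B p u X i b else -10

theorem fv_singleton (v : Fin n → Finset (Fin m) → ℝ) (B : Fin n → Finset (Fin m))
    (p u : Fin n → ℝ) (X : Finset (Fin n)) (i : Fin n) (b : Option (Fin n)) :
    fv v B p u X i {b} = wt v B p u X i b := by simp [fv]

theorem fv_empty (v : Fin n → Finset (Fin m) → ℝ) (B : Fin n → Finset (Fin m))
    (p u : Fin n → ℝ) (X : Finset (Fin n)) (i : Fin n) :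
    fv v B p u X i ∅ = 0 := by simp [fv]

theorem bun_none_mono (B : Fin n → Finset (Fin m)) {X Y : Finset (Fin n)} (h : X ⊆ Y) :
    bun B Y none ⊆ bun B X none :=
  Finset.sdiff_subset_sdiff (Finset.Subset.refl _) (Finset.biUnion_subset_biUnion_of_subset_left _ h)

theorem fv_mono (v : Fin n → Finset (Fin m) → ℝ) (hmono : ∀ i S T, S ⊆ T → v i S ≤ v i T)
    (B : Fin n → Finset (Fin m))
    (p u : Fin n → ℝ) {X Y : Finset (Fin n)} (h : X ⊆ Y) (i : Fin n) (T) :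
    fv v B p u Y i T ≤ fv v B p u X i T := by
  unfold fv
  split_ifs
  · apply Finset.sum_le_sum
    rintro (_ | b) -
    · have := hmono i _ _ (bun_none_mono B h)
      simp only [wt]; linarith
    · exact le_rfl
  · exact le_rfl

/-- Total abstract weight. -/
noncomputable def totW (v : Fin n → Finset (Fin m) → ℝ) (B : Fin n → Finset (Fin m))
    (p u : Fin n → ℝ) (X : Finset (Fin n)) (M : Fin n → Finset (Option (Fin n))) : ℝ :=
  ∑ i, fv v B p u X i (M i)

theorem phase2 (v : Fin n → Finset (Fin m) → ℝ)
    (hv0 : ∀ i, v i ∅ = 0)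
    (hmono : ∀ i S T, S ⊆ T → v i S ≤ v i T)
    (V : ℝ) (hV : ∀ i, v i Finset.univ ≤ V) (hV0 : 0 ≤ V) (e : ℝ) (he : 0 < e)
    (hen : n * e ≤ 1) (he1 : e ≤ 1)
    (I : Finset (Fin n)) (B : Fin n → Finset (Fin m)) (p u : Fin n → ℝ)
    (hB : ∀ i j, i ≠ j → Disjoint (B i) (B j)) (hp : ∀ i ∈ I, 8 ≤ p i)
    (hown : ∀ i ∈ I, v i (B i) = p i + u i) (hu : ∀ i, 1 ≤ u i)
    (hR4 : ∀ i, ∀ D ⊆ I, D.Nonempty →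
        v i (D.biUnion B) - ∑ j ∈ D, p j ≤ u i + e - 4 * ((D.card : ℝ) - 1))
    (hIbig : V + 1 < I.card) (ε : ℝ) (hε : 0 < ε) (hε1 : ε ≤ 1) (hεn : n * ε < 1) :
    ∃ (X : Finset (Fin n)) (A : Fin n → Finset (Option (Fin n))) (p' : Option (Fin n) → ℝ),
      (∀ i, A i ⊆ Finset.insertNone X) ∧ (∀ i j, i ≠ j → Disjoint (A i) (A j)) ∧
      (∀ b ∈ Finset.insertNone X, ∃ i, b ∈ A i) ∧
      (∀ b ∈ Finset.insertNone X, 0 ≤ p' b) ∧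
      7 * (I.card - V - 1) ≤ ∑ b ∈ Finset.insertNone X, p' b ∧
      (∀ i, A i ≠ ∅ → ∀ Y ⊆ Finset.insertNone X,
        v i (Y.biUnion (bun B X)) - ∑ b ∈ Y, p' b ≤
          v i ((A i).biUnion (bun B X)) - ∑ b ∈ A i, p' b + ε) := by
  classical
  let f := fv v B p u
  let W := totW v B p u
  -- maximiser
  obtain ⟨⟨X, M⟩, hXM, hmax'⟩ := Finset.exists_max_image
    ((Finset.univ : Finset (Finset (Fin n) × (Fin n → Finset (Option (Fin n))))).filter
      (fun x => x.1 ⊆ I ∧ (∀ i, x.2 i ⊆ Finset.insertNone x.1) ∧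
        ∀ i j, i ≠ j → Disjoint (x.2 i) (x.2 j)))
    (fun x => W x.1 x.2 - (x.1.card : ℝ)) ⟨(∅, fun _ => ∅), by simp⟩
  simp only [Finset.mem_filter, Finset.mem_univ, true_and] at hXM hmax'
  obtain ⟨hXI, hMG, hMd⟩ := hXM
  have hmax : ∀ Y N, Y ⊆ I → (∀ i, N i ⊆ Finset.insertNone Y) →
      (∀ i j, i ≠ j → Disjoint (N i) (N j)) → W Y N - (Y.card : ℝ) ≤ W X M - (X.card : ℝ) :=
    fun Y N h1 h2 h3 => hmax' (Y, N) ⟨h1, h2, h3⟩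
  clear hmax'
  have hexX : e * X.card ≤ 1 := by
    have h1 : (X.card : ℝ) ≤ n := by
      have := Finset.card_le_univ X
      rw [Fintype.card_fin] at this
      exact_mod_cast this
    nlinarith
  -- caps
  have hcapsome : ∀ Y i b, b ∈ I → wt v B p u Y i (some b) ≤ 2 + e := by
    intro Y i b hb
    have := hR4 i {b} (by simpa using hb) (by simp)
    simp at this
    simp only [wt]; linarith
  have hcapnone : ∀ Y i, wt v B p u Y i none ≤ V := by
    intro Y i
    have h1 := (hmono i _ _ (Finset.subset_univ (bun B Y none))).trans (hV i)
    have := hu i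
    simp only [wt]; linarith
  have hbound : ∀ (N : Fin n → Finset (Option (Fin n))) (Z : Finset (Option (Fin n))),
      (∀ i, N i ⊆ Z) → Z ⊆ Finset.insertNone X → (∀ i j, i ≠ j → Disjoint (N i) (N j)) →
      W X N ≤ ∑ b ∈ Z, Option.elim b V (fun _ => 2 + e) := by
    intro N Z hNZ hZ hd
    have hnn : ∀ b : Option (Fin n), 0 ≤ Option.elim b V (fun _ => 2 + e) := by
      rintro (_ | b)
      · exact hV0
      · simp only [Option.elim]; linarith
    have h1 : ∀ i, fv v B p u X i (N i) ≤ ∑ b ∈ N i, Option.elim b V (fun _ => 2 + e) := by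
      intro i
      unfold fv
      split_ifs
      · apply Finset.sum_le_sum
        rintro (_ | b) hb
        · exact hcapnone X i
        · have := hZ (hNZ i hb)
          rw [Finset.some_mem_insertNone] at this
          exact hcapsome X i b (hXI this)
      · have := Finset.sum_nonneg fun b (_ : b ∈ N i) => hnn b
        linarith
    calc W X N ≤ ∑ i, ∑ b ∈ N i, Option.elim b V (fun _ => 2 + e) :=
          Finset.sum_le_sum fun i _ => h1 i
      _ = ∑ b ∈ Finset.univ.biUnion N, Option.elim b V (fun _ => 2 + e) :=
          (Finset.sum_biUnion (fun i _ j _ hij => hd i j hij)).symm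
      _ ≤ _ := by
          apply Finset.sum_le_sum_of_subset_of_nonneg
          · intro b hb
            obtain ⟨i, -, hi⟩ := Finset.mem_biUnion.1 hb
            exact hNZ i hi
          · intro b _ _; exact hnn b
  -- own values
  have hownw : ∀ Y i, i ∈ I → wt v B p u Y i (some i) = 2 := by
    intro Y i hi
    have := hown i hi
    simp only [wt]; linarith
  -- lower bound: own matching
  have hlow1 : (I.card : ℝ) ≤ W X M - X.card := by
    have := hmax I (fun i => if i ∈ I then {some i} else ∅) (Finset.Subset.refl _) ?_ ?_
    · have h2 : W I (fun i => if i ∈ I then {some i} else ∅) = 2 * (I.card : ℝ) := by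
        have : ∀ i, fv v B p u I i (if i ∈ I then {some i} else ∅) = if i ∈ I then (2:ℝ) else 0 := by
          intro i
          split_ifs with h
          · rw [fv_singleton, hownw I i h]
          · rw [fv_empty]
        show ∑ i, fv v B p u I i _ = _
        rw [Finset.sum_congr rfl fun i _ => this i, Finset.sum_ite_mem]
        simp [mul_comm]
      linarith
    · intro i
      split_ifs with h
      · simpa using h
      · simp
    · intro i j hij
      split_ifs <;> simp [hij]
  have hlow2 : ∀ Y ⊆ I, ∀ i, wt v B p u Y i none + 2 * ((Y.erase i).card : ℝ) - Y.card
      ≤ W X M - X.card := by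
    intro Y hY i
    have := hmax Y (fun j => if j = i then {none} else if j ∈ Y then {some j} else ∅) hY ?_ ?_
    · have h2 : W Y (fun j => if j = i then {none} else if j ∈ Y then {some j} else ∅)
          = wt v B p u Y i none + 2 * ((Y.erase i).card : ℝ) := by
        have : ∀ j, fv v B p u Y j (if j = i then {none} else if j ∈ Y then {some j} else ∅)
            = (if j = i then wt v B p u Y i none else 0) + if j ∈ Y.erase i then (2:ℝ) else 0 := by
          intro j
          by_cases hji : j = i
          · subst hji
            simp [fv_singleton]
          · by_cases hjY : j ∈ Y
            · simp [hji, hjY, fv_singleton, hownw Y j (hY hjY)]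
            · simp [hji, hjY, fv_empty]
        show ∑ i, fv v B p u Y i _ = _
        rw [Finset.sum_congr rfl fun i _ => this i, Finset.sum_add_distrib, Finset.sum_ite_mem]
        simp [mul_comm]
      linarith
    · intro j
      split_ifs with h1 h2
      · simp
      · simpa using h2
      · simp
    · intro j k hjk
      split_ifs with h1 h2 h3 h4 <;> simp_all
  have hup : W X M ≤ V + (2 + e) * X.card := by
    have := hbound M _ hMG (Finset.Subset.refl _) hMd
    rw [Finset.sum_insertNone] at this
    simp only [Option.elim, Finset.sum_const, nsmul_eq_mul] at this
    linarith
  have hXcard : (I.card : ℝ) - V - 1 ≤ X.card := by linarith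
  have hXne : X.Nonempty := by
    rw [← Finset.card_pos]
    have : (0:ℝ) < X.card := by linarith
    exact_mod_cast this
  obtain ⟨Q, hQ⟩ : ∃ Q, Q = W X M - (2 + e) * X.card := ⟨_, rfl⟩
  have hQ7 : 7 ≤ Q := by
    obtain ⟨i, hi⟩ := hXne
    have h1 := hlow2 (X.erase i) ((Finset.erase_subset _ _).trans hXI) i
    have hc : ((X.erase i).card : ℝ) = X.card - 1 := by
      rw [Finset.card_erase_of_mem hi, Nat.cast_sub (Finset.card_pos.2 ⟨i, hi⟩)]; simp
    rw [Finset.erase_idem, hc] at h1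
    have hsub : B i ⊆ bun B (X.erase i) none := by
      intro x hx
      simp only [bun, Finset.mem_sdiff, Finset.mem_univ, true_and, Finset.mem_biUnion]
      rintro ⟨j, hj, hxj⟩
      exact Finset.disjoint_left.1 (hB j i (Finset.ne_of_mem_erase hj)) hxj hx
    have h2 := hmono i _ _ hsub
    have h3 := hown i (hXI hi)
    have h4 := hp i (hXI hi)
    simp only [wt] at h1
    linarith
  -- the auction
  let r : Option (Fin n) → ℝ := fun b => Option.elim b (Q - 1) (fun _ => 0)
  have hr0 : ∀ b, 0 ≤ r b := by
    rintro (_ | b)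
    · show 0 ≤ Q - 1; linarith
    · exact le_rfl
  obtain ⟨A, π, hAG, hAd, hA1, hrπ, hAu, hAs, hdual⟩ := ud_main (f X) r ε (Finset.insertNone X)
    (fun i => fv_empty v B p u X i)
    (fun i T hT => by simp only [f, fv]; rw [if_neg (by omega)]) hr0 hε hε1
  have hD := hdual M hMG hMd
  rw [Fintype.card_fin] at hD
  have hD' : W X M ≤ W X A + ∑ b ∈ Finset.insertNone X \ Finset.univ.biUnion A, r b + n * ε := hD
  have hnone : ∃ i, none ∈ A i := by
    by_contra hcon
    push Not at hcon
    have h1 := hbound A (X.map Function.Embedding.some) (fun i b hb => by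
      rcases b with _ | b
      · exact absurd hb (hcon i)
      · have := hAG i hb
        rw [Finset.some_mem_insertNone] at this
        simpa using this) (by
      intro b hb
      rw [Finset.mem_map] at hb
      obtain ⟨a, ha, rfl⟩ := hb
      exact Finset.some_mem_insertNone.2 ha) hAd
    rw [Finset.sum_map] at h1
    simp only [Function.Embedding.some_apply, Option.elim, Finset.sum_const, nsmul_eq_mul] at h1
    have h2 : ∑ b ∈ Finset.insertNone X \ Finset.univ.biUnion A, r b ≤
        ∑ b ∈ Finset.insertNone X, r b :=
      Finset.sum_le_sum_of_subset_of_nonneg Finset.sdiff_subset fun b _ _ => hr0 b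
    have h3 : ∑ b ∈ Finset.insertNone X, r b = Q - 1 := by
      rw [Finset.sum_insertNone]; simp [r]
    linarith
  have hD2 : W X M ≤ W X A + n * ε := by
    have : ∑ b ∈ Finset.insertNone X \ Finset.univ.biUnion A, r b = 0 := by
      apply Finset.sum_eq_zero
      rintro (_ | b) hb
      · obtain ⟨i, hi⟩ := hnone
        exact absurd (Finset.mem_biUnion.2 ⟨i, Finset.mem_univ _, hi⟩) (Finset.mem_sdiff.1 hb).2
      · rfl
    linarith
  have hsome : ∀ b ∈ X, ∃ i, some b ∈ A i := by
    intro b hb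
    by_contra hcon
    push Not at hcon
    have h1 := hmax (X.erase b) A ((Finset.erase_subset _ _).trans hXI) (fun i c hc => by
      rcases c with _ | c
      · simp
      · have := hAG i hc
        rw [Finset.some_mem_insertNone] at this ⊢
        refine Finset.mem_erase.2 ⟨?_, this⟩
        rintro rfl
        exact hcon i hc) hAd
    have h2 : W X A ≤ W (X.erase b) A :=
      Finset.sum_le_sum fun i _ => fv_mono v hmono B p u (Finset.erase_subset _ _) i _
    have hc : ((X.erase b).card : ℝ) = X.card - 1 := by
      rw [Finset.card_erase_of_mem hb, Nat.cast_sub (Finset.card_pos.2 ⟨b, hb⟩)]; simp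
    rw [hc] at h1
    linarith
  -- prices
  let p' : Option (Fin n) → ℝ := fun b => Option.elim b (π none) (fun b => π (some b) + p b - 1)
  have hp'none : Q - 1 ≤ p' none := hrπ none
  have hp'some : ∀ b ∈ X, p b - 1 ≤ p' (some b) := by
    intro b _
    have : (0:ℝ) ≤ π (some b) := hrπ (some b)
    show p b - 1 ≤ π (some b) + p b - 1
    linarith
  have hp'7 : ∀ b ∈ X, 7 ≤ p' (some b) := by
    intro b hb
    have := hp'some b hb
    have := hp b (hXI hb)
    linarith
  have hconv : ∀ i b, v i (bun B X b) - p' b = wt v B p u X i b - π b + u i - 1 := by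
    rintro i (_ | b)
    · simp only [wt, p', Option.elim]; ring
    · simp only [wt, p', Option.elim, bun]; ring
  refine ⟨X, A, p', hAG, hAd, ?_, ?_, ?_, ?_⟩
  · rintro (_ | b) hb
    · exact hnone
    · exact hsome b (Finset.some_mem_insertNone.1 hb)
  · rintro (_ | b) hb
    · linarith
    · have := hp'7 b (Finset.some_mem_insertNone.1 hb)
      linarith
  · rw [Finset.sum_insertNone]
    have : ∑ b ∈ X, (7:ℝ) ≤ ∑ b ∈ X, p' (some b) := Finset.sum_le_sum fun b hb => hp'7 b hb
    rw [Finset.sum_const, nsmul_eq_mul] at this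
    linarith
  · intro i hAi Y hY
    obtain ⟨a, ha⟩ : ∃ a, A i = {a} := by
      apply Finset.card_eq_one.1
      have := Finset.card_pos.2 (Finset.nonempty_iff_ne_empty.2 hAi)
      have := hA1 i
      omega
    have hui := hAu i
    have hsi := hAs i
    simp only [f] at hui hsi
    rw [ha, Finset.sum_singleton, fv_singleton] at hui hsi
    rw [ha, Finset.singleton_biUnion, Finset.sum_singleton, hconv i a]
    have hu1 := hu i
    by_cases hn : none ∈ Y
    · obtain ⟨T, hT⟩ : ∃ T, T = Finset.eraseNone Y := ⟨_, rfl⟩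
      have hYT : Y = Finset.insertNone T := by
        rw [hT, Finset.insertNone_eraseNone, Finset.insert_eq_of_mem hn]
      have hTX : T ⊆ X := by
        intro b hb
        rw [hT, Finset.mem_eraseNone] at hb
        exact Finset.some_mem_insertNone.1 (hY hb)
      rcases Finset.eq_empty_or_nonempty T with hT0 | hTne
      · have : Y = {none} := by rw [hYT, hT0]; rfl
        rw [this, Finset.singleton_biUnion, Finset.sum_singleton, hconv i none]
        have := hsi none (by simp)
        rw [fv_singleton] at this
        linarith
      · by_contra hcon
        push Not at hcon
        have hsub : Y.biUnion (bun B X) ⊆ bun B (X \ T) none := by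
          intro x hx
          obtain ⟨b, hb, hxb⟩ := Finset.mem_biUnion.1 hx
          simp only [bun, Finset.mem_sdiff, Finset.mem_univ, true_and, Finset.mem_biUnion]
          rintro ⟨j, ⟨hjX, hjT⟩, hxj⟩
          rcases b with _ | b
          · simp only [bun, Finset.mem_sdiff, Finset.mem_univ, true_and, Finset.mem_biUnion] at hxb
            exact hxb ⟨j, hjX, hxj⟩
          · rw [hYT, Finset.some_mem_insertNone] at hb
            refine Finset.disjoint_left.1 (hB j b ?_) hxj hxb
            rintro rfl
            exact hjT hb
        have h1 := hmono i _ _ hsub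
        have h2 : ∑ b ∈ Y, p' b ≥ Q - 1 + 7 * T.card := by
          rw [hYT, Finset.sum_insertNone]
          have : ∑ b ∈ T, (7:ℝ) ≤ ∑ b ∈ T, p' (some b) :=
            Finset.sum_le_sum fun b hb => hp'7 b (hTX hb)
          rw [Finset.sum_const, nsmul_eq_mul] at this
          linarith
        have h3 := hlow2 (X \ T) (Finset.sdiff_subset.trans hXI) i
        have h4 : ((X \ T).card : ℝ) = X.card - T.card := by
          rw [Finset.card_sdiff_of_subset hTX, Nat.cast_sub (Finset.card_le_card hTX)]
        have h5 : ((X \ T).card : ℝ) - 1 ≤ ((X \ T).erase i).card := by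
          have := Finset.pred_card_le_card_erase (s := X \ T) (a := i)
          have h6 : (X \ T).card ≤ ((X \ T).erase i).card + 1 := by omega
          have h7 : ((X \ T).card : ℝ) ≤ ((X \ T).erase i).card + 1 := by exact_mod_cast h6
          linarith
        have h8 : (1:ℝ) ≤ T.card := by exact_mod_cast Finset.card_pos.2 hTne
        simp only [wt] at h3
        linarith
    · obtain ⟨T, hT⟩ : ∃ T, T = Finset.eraseNone Y := ⟨_, rfl⟩
      have hYT : Y = T.map Function.Embedding.some := by
        rw [hT, Finset.map_some_eraseNone, Finset.erase_eq_of_notMem hn]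
      have hTX : T ⊆ X := by
        intro b hb
        rw [hT, Finset.mem_eraseNone] at hb
        exact Finset.some_mem_insertNone.1 (hY hb)
      rcases Finset.eq_empty_or_nonempty T with hT0 | hTne
      · rw [hYT, hT0]
        simp [hv0]
        linarith
      · by_cases hc : T.card ≤ 1
        · obtain ⟨b, hb⟩ : ∃ b, T = {b} := by
            apply Finset.card_eq_one.1
            have := Finset.card_pos.2 hTne
            omega
          have : Y = {some b} := by rw [hYT, hb]; rfl
          rw [this, Finset.singleton_biUnion, Finset.sum_singleton, hconv i (some b)]
          have := hsi (some b) (hY (by rw [this]; simp))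
          rw [fv_singleton] at this
          linarith
        · have hb : Y.biUnion (bun B X) = T.biUnion B := by
            rw [hYT]
            ext x
            simp [bun]
          have h1 := hR4 i T (hTX.trans hXI) hTne
          have h2 : ∑ b ∈ T, p b - T.card ≤ ∑ b ∈ Y, p' b := by
            rw [hYT, Finset.sum_map]
            have : ∑ b ∈ T, (p b - 1) ≤ ∑ b ∈ T, p' (some b) :=
              Finset.sum_le_sum fun b hb => hp'some b (hTX hb)
            rw [Finset.sum_sub_distrib] at this
            simpa using this
          have h3 : (2:ℝ) ≤ T.card := by
            have : 2 ≤ T.card := by omega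
            exact_mod_cast this
          rw [hb]
          linarith
end Ph2

section Ph3
variable {n m : ℕ}

theorem bun_disj (B : Fin n → Finset (Fin m)) (hB : ∀ i j, i ≠ j → Disjoint (B i) (B j))
    (X : Finset (Fin n)) (a b : Option (Fin n)) (ha : a ∈ Finset.insertNone X)
    (hb : b ∈ Finset.insertNone X) (hab : a ≠ b) : Disjoint (bun B X a) (bun B X b) := by
  have key : ∀ c ∈ X, Disjoint (bun B X none) (B c) := by
    intro c hc
    exact Finset.sdiff_disjoint.mono_right (Finset.subset_biUnion_of_mem B hc)
  rcases a with _ | a <;> rcases b with _ | b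
  · exact absurd rfl hab
  · exact key b (Finset.some_mem_insertNone.1 hb)
  · exact (key a (Finset.some_mem_insertNone.1 ha)).symm
  · exact hB a b (by rintro rfl; exact hab rfl)

theorem phase3 (v : Fin n → Finset (Fin m) → ℝ) (hv0 : ∀ i, v i ∅ = 0)
    (ε : ℝ) (hε : 0 < ε) (B : Fin n → Finset (Fin m))
    (hB : ∀ i j, i ≠ j → Disjoint (B i) (B j)) (ρ : ℝ)
    (X : Finset (Fin n)) (A₀ : Fin n → Finset (Option (Fin n))) (p' : Option (Fin n) → ℝ)
    (h1 : ∀ i, A₀ i ⊆ Finset.insertNone X) (h2 : ∀ i j, i ≠ j → Disjoint (A₀ i) (A₀ j))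
    (h3 : ∀ b ∈ Finset.insertNone X, ∃ i, b ∈ A₀ i)
    (h4 : ∀ b ∈ Finset.insertNone X, 0 ≤ p' b)
    (h5 : ρ ≤ ∑ b ∈ Finset.insertNone X, p' b)
    (h6 : ∀ i, A₀ i ≠ ∅ → ∀ Y ⊆ Finset.insertNone X,
        v i (Y.biUnion (bun B X)) - ∑ b ∈ Y, p' b ≤
          v i ((A₀ i).biUnion (bun B X)) - ∑ b ∈ A₀ i, p' b + ε) :
    ∃ A q, ItemEq v ε A q ∧ ρ ≤ ∑ i, q i := by
  classical
  obtain ⟨A, q, hinv, hsat, hheld⟩ := al_main (fun i T => v i (T.biUnion (bun B X))) p' ε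
    (Finset.insertNone X) A₀ (fun i => ∑ b ∈ A₀ i, p' b) (by simp [hv0]) hε (by
      refine ⟨h1, h2, fun i hi => by simp [hi], fun i => le_rfl, ?_⟩
      intro i hi D T hT hTd
      have hT0 : T = ∅ := by
        apply Finset.eq_empty_of_forall_notMem
        intro b hb
        obtain ⟨j, hj⟩ := h3 b (hT hb)
        exact Finset.disjoint_left.1 (hTd j) hb hj
      subst hT0
      have := h6 i hi (D.biUnion A₀) (by
        intro b hb
        obtain ⟨j, -, hj⟩ := Finset.mem_biUnion.1 hb
        exact h1 j hj)
      rw [Finset.sum_biUnion (fun i _ j _ hij => h2 i j hij)] at this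
      simpa [alVal] using this)
  have hcovA : Finset.univ.biUnion A = Finset.insertNone X := by
    apply Finset.Subset.antisymm
    · intro b hb
      obtain ⟨j, -, hj⟩ := Finset.mem_biUnion.1 hb
      exact hinv.sub j hj
    · intro b hb
      obtain ⟨j, hj⟩ := hheld b (h3 b hb)
      exact Finset.mem_biUnion.2 ⟨j, Finset.mem_univ _, hj⟩
  refine ⟨fun i => (A i).biUnion (bun B X), q, ⟨?_, ?_, ?_, ?_⟩, ?_⟩
  · intro i j hij
    rw [Finset.disjoint_biUnion_left]
    intro a ha
    rw [Finset.disjoint_biUnion_right]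
    intro b hb
    apply bun_disj B hB X a b (hinv.sub i ha) (hinv.sub j hb)
    rintro rfl
    exact Finset.disjoint_left.1 (hinv.disj i j hij) ha hb
  · rw [← Finset.biUnion_biUnion, hcovA]
    apply Finset.eq_univ_of_forall
    intro x
    by_cases hx : ∃ b ∈ X, x ∈ B b
    · obtain ⟨b, hb, hxb⟩ := hx
      exact Finset.mem_biUnion.2 ⟨some b, Finset.some_mem_insertNone.2 hb, hxb⟩
    · refine Finset.mem_biUnion.2 ⟨none, by simp, ?_⟩
      simpa [bun] using hx
  · intro i
    exact (Finset.sum_nonneg fun b hb => h4 b (hinv.sub i hb)).trans (hinv.ge i)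
  · intro i D
    have := hsat i D ∅ (by simp) (by simp)
    simp only [alVal, Finset.union_empty, Finset.sum_empty, sub_zero,
      Finset.biUnion_biUnion] at this
    exact this
  · calc ρ ≤ ∑ b ∈ Finset.insertNone X, p' b := h5
      _ = ∑ i, ∑ b ∈ A i, p' b := by
          rw [← hcovA, Finset.sum_biUnion (fun i _ j _ hij => hinv.disj i j hij)]
      _ ≤ _ := Finset.sum_le_sum fun i _ => hinv.ge i

theorem core (v : Fin n → Finset (Fin m) → ℝ) (hv0 : ∀ i, v i ∅ = 0)
    (hmono : ∀ i S T, S ⊆ T → v i S ≤ v i T)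
    (K : Finset (Fin n)) (S : Fin n → Finset (Fin m))
    (hS : ∀ i j, i ≠ j → Disjoint (S i) (S j)) (h16 : ∀ i ∈ K, 16 ≤ v i (S i))
    (V : ℝ) (hV : ∀ i, v i Finset.univ ≤ V) (hV16 : 16 ≤ V) (hK : V ^ 2 ≤ K.card) :
    ∃ A q, ItemEq v 0 A q ∧ (K.card : ℝ) / V ≤ ∑ i, q i := by
  have hVpos : 0 < V := by linarith
  have hn1 : (0:ℝ) < (n:ℝ) + 1 := by positivity
  have hd1 : 0 < 1 / ((n:ℝ) + 1) := by positivity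
  have hd2 : 1 / ((n:ℝ) + 1) ≤ 1 := by
    rw [div_le_one hn1]; have : (0:ℝ) ≤ n := Nat.cast_nonneg n
    linarith
  have hd3 : n * (1 / ((n:ℝ) + 1)) < 1 := by
    rw [mul_one_div, div_lt_one hn1]; linarith
  obtain ⟨I, B, p, u, hB, hp, hown, hu, hR4, hcard⟩ := phase1 v hmono K S hS h16 V hV hV16
    (1 / ((n:ℝ) + 1)) hd1 hd2
  have hkV : V ≤ K.card / V := by
    rw [le_div_iff₀ hVpos]; nlinarith
  have hI : 2 * ((K.card : ℝ) / V) ≤ I.card := by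
    rw [← mul_div_assoc, div_le_iff₀ hVpos]; linarith
  apply itemEq_limit v hv0
  intro ε hε
  have hε' : 0 < min ε (1 / ((n:ℝ) + 1)) := lt_min hε hd1
  obtain ⟨X, A₀, p', g1, g2, g3, g4, g5, g6⟩ := phase2 v hv0 hmono V hV hVpos.le
    (1 / ((n:ℝ) + 1)) hd1 hd3.le hd2 I B p u hB hp hown hu hR4 (by linarith)
    (min ε (1 / ((n:ℝ) + 1))) hε' ((min_le_right _ _).trans hd2)
    ((mul_le_mul_of_nonneg_left (min_le_right _ _) (Nat.cast_nonneg n)).trans_lt hd3)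
  obtain ⟨A, q, hA, hρ⟩ := phase3 v hv0 _ hε' B hB _ X A₀ p' g1 g2 g3 g4 g5 g6
  refine ⟨A, q, ⟨hA.disj, hA.cov, hA.nn, fun i D => (hA.sat i D).trans ?_⟩, by linarith⟩
  have := min_le_left ε (1 / ((n:ℝ) + 1))
  linarith
end Ph3

theorem sum_le_harmonic {α : Type*} [DecidableEq α] (a : α → ℝ) (c : ℝ) :
    ∀ (N : ℕ) (s : Finset α), s.card = N →
      (∀ i ∈ s, a i * ((s.filter fun j => a i ≤ a j).card : ℝ) ≤ c) → (∀ i ∈ s, 0 ≤ a i) →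
      ∑ i ∈ s, a i ≤ c * (harmonic N : ℝ) := by
  intro N
  induction N with
  | zero =>
    intro s hs _ _
    rw [Finset.card_eq_zero.1 hs]; simp
  | succ N ih =>
    intro s hs h h0
    obtain ⟨i, hi, hmin⟩ := Finset.exists_min_image s a (Finset.card_pos.1 (by omega))
    have h1 := h i hi
    rw [Finset.filter_true_of_mem hmin, hs] at h1
    have h2 := ih (s.erase i) (by rw [Finset.card_erase_of_mem hi, hs]; simp) (fun j hj => by
      refine le_trans ?_ (h j (Finset.mem_of_mem_erase hj))
      apply mul_le_mul_of_nonneg_left _ (h0 j (Finset.mem_of_mem_erase hj))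
      exact_mod_cast Finset.card_le_card (Finset.filter_subset_filter _ (Finset.erase_subset _ _)))
      (fun j hj => h0 j (Finset.mem_of_mem_erase hj))
    rw [← Finset.add_sum_erase s a hi, harmonic_succ]
    have h3 : a i ≤ c * ((N + 1 : ℕ) : ℝ)⁻¹ := by
      rw [← div_eq_mul_inv, le_div_iff₀ (by positivity)]
      exact h1
    push_cast at h3 ⊢
    linarith

theorem grand {n m : ℕ} (Mk : Market n m) (i₀ : Fin n)
    (hmax : ∀ i, Mk.v i Finset.univ ≤ Mk.v i₀ Finset.univ) :
    ∃ E : CBE Mk, E.welfare = Mk.v i₀ Finset.univ := by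
  have hn : 1 ≤ n := by have := i₀.2; omega
  have hnn : ∀ i T, 0 ≤ Mk.v i T := fun i T => by
    rw [← Mk.v_empty i]; exact Mk.v_mono i _ _ (by simp)
  obtain ⟨E, hE⟩ := itemEq_cbe hn Mk (fun i => if i = i₀ then Finset.univ else ∅)
    (fun i => if i = i₀ then Mk.v i₀ Finset.univ else 0) (by
      refine ⟨?_, ?_, ?_, ?_⟩
      · intro i j hij
        by_cases h : i = i₀
        · subst h; simp [hij.symm]
        · simp [h]
      · apply Finset.eq_univ_of_forall
        intro x
        exact Finset.mem_biUnion.2 ⟨i₀, Finset.mem_univ _, by simp⟩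
      · intro i
        split_ifs
        · exact hnn _ _
        · exact le_rfl
      · intro i D
        have hR : 0 ≤ Mk.v i (if i = i₀ then Finset.univ else ∅)
            - (if i = i₀ then Mk.v i₀ Finset.univ else 0) := by
          by_cases h : i = i₀
          · subst h; simp
          · simp [h, Mk.v_empty]
        refine le_trans ?_ (by linarith : (0:ℝ) ≤ _)
        by_cases hD : i₀ ∈ D
        · rw [Finset.sum_ite_eq' D i₀, if_pos hD]
          have := (Mk.v_mono i _ _ (Finset.subset_univ
            (D.biUnion fun i => if i = i₀ then Finset.univ else ∅))).trans (hmax i)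
          linarith
        · have : (D.biUnion fun i => if i = i₀ then (Finset.univ : Finset (Fin m)) else ∅) = ∅ := by
            apply Finset.eq_empty_of_forall_notMem
            intro x hx
            obtain ⟨j, hj, hx⟩ := Finset.mem_biUnion.1 hx
            split_ifs at hx with h
            · subst h; exact hD hj
            · simp at hx
          rw [this, Mk.v_empty, Finset.sum_ite_eq' D i₀, if_neg hD]
          simp)
  refine ⟨E, hE.trans ?_⟩
  rw [Finset.sum_eq_single i₀]
  · simp
  · intro j _ hj; simp [hj, Mk.v_empty]
  · simp

theorem sqrt_bound {n m : ℕ} (Mk : Market n m) (i₀ : Fin n)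
    (hmax : ∀ i, Mk.v i Finset.univ ≤ Mk.v i₀ Finset.univ)
    (S : Fin n → Finset (Fin m)) (hS : IsAllocation S) (t : ℝ) (ht : 0 < t)
    (K : Finset (Fin n)) (hK : ∀ i ∈ K, t ≤ Mk.v i (S i)) (hKne : K.Nonempty) :
    ∃ E : CBE Mk, t / 16 * Real.sqrt K.card ≤ E.welfare := by
  have hn : 1 ≤ n := by have := i₀.2; omega
  obtain ⟨τ, hτ⟩ : ∃ τ, τ = t / 16 := ⟨_, rfl⟩
  have hτ0 : 0 < τ := by rw [hτ]; positivity
  rw [← hτ]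
  obtain ⟨V, hV⟩ : ∃ V, V = Mk.v i₀ Finset.univ / τ := ⟨_, rfl⟩
  have hVt : Mk.v i₀ Finset.univ = τ * V := by rw [hV]; field_simp
  have hV16 : 16 ≤ V := by
    obtain ⟨i, hi⟩ := hKne
    have h1 := (hK i hi).trans ((Mk.v_mono i _ _ (Finset.subset_univ _)).trans (hmax i))
    rw [hV, le_div_iff₀ hτ0, hτ]
    linarith
  by_cases hc : V ^ 2 ≤ K.card
  · obtain ⟨A, q, hAq, hsum⟩ := core (fun i T => Mk.v i T / τ) (fun i => by simp [Mk.v_empty])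
      (fun i S T h => div_le_div_of_nonneg_right (Mk.v_mono i S T h) hτ0.le) K S hS
      (fun i hi => by
        rw [le_div_iff₀ hτ0, hτ]
        have := hK i hi
        linarith) V
      (fun i => by rw [hV]; exact div_le_div_of_nonneg_right (hmax i) hτ0.le) hV16 hc
    have hAq' : ItemEq Mk.v 0 A (fun i => τ * q i) := by
      refine ⟨hAq.disj, hAq.cov, fun i => mul_nonneg hτ0.le (hAq.nn i), ?_⟩
      intro i D
      have h1 := mul_le_mul_of_nonneg_left (hAq.sat i D) hτ0.le
      rw [← Finset.mul_sum]
      have e1 : ∀ x : ℝ, τ * (x / τ) = x := fun x => by field_simp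
      rw [mul_sub, mul_add, mul_sub, e1, e1] at h1
      linarith
    obtain ⟨E, hE⟩ := itemEq_cbe hn Mk A _ hAq'
    refine ⟨E, ?_⟩
    rw [hE]
    have h1 : ∀ i, τ * q i ≤ Mk.v i (A i) := by
      intro i
      have := hAq'.sat i ∅
      simp only [Finset.biUnion_empty, Mk.v_empty, Finset.sum_empty] at this
      linarith
    have h2 := Finset.sum_le_sum fun i (_ : i ∈ Finset.univ) => h1 i
    rw [← Finset.mul_sum] at h2
    have h3 : Real.sqrt K.card ≤ K.card / V := by
      rw [le_div_iff₀ (by linarith)]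
      have h4 : V ≤ Real.sqrt K.card := Real.le_sqrt_of_sq_le hc
      have h5 := Real.mul_self_sqrt (Nat.cast_nonneg (α := ℝ) K.card)
      nlinarith [Real.sqrt_nonneg (K.card : ℝ)]
    exact (mul_le_mul_of_nonneg_left (h3.trans hsum) hτ0.le).trans h2
  · obtain ⟨E, hE⟩ := grand Mk i₀ hmax
    refine ⟨E, ?_⟩
    rw [hE, hVt]
    apply mul_le_mul_of_nonneg_left _ hτ0.le
    rw [Real.sqrt_le_left (by linarith)]
    exact (not_le.1 hc).le

theorem final_bound {n m : ℕ} (hn : 1 ≤ n) (hm : 1 ≤ m) (Mk : Market n m) :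
    ∃ E : CBE Mk,
      E.welfare ≥
        1 / 16 * OPT Mk / ((m : ℝ) ^ ((2 : ℝ) / 3) * (Real.logb 2 m + 2) ^ 2) := by
  classical
  have hnn : ∀ i T, 0 ≤ Mk.v i T := fun i T => by
    rw [← Mk.v_empty i]; exact Mk.v_mono i _ _ (by simp)
  have hm1 : (1:ℝ) ≤ m := by exact_mod_cast hm
  obtain ⟨i₀, -, hmax⟩ := Finset.exists_max_image (Finset.univ : Finset (Fin n))
    (fun i => Mk.v i Finset.univ) ⟨⟨0, hn⟩, Finset.mem_univ _⟩
  replace hmax : ∀ i, Mk.v i Finset.univ ≤ Mk.v i₀ Finset.univ :=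
    fun i => hmax i (Finset.mem_univ _)
  obtain ⟨L, hL⟩ : ∃ L, L = Real.logb 2 m + 2 := ⟨_, rfl⟩
  have hlogb : 0 ≤ Real.logb 2 m := Real.logb_nonneg (by norm_num) hm1
  have hL2 : 2 ≤ L := by linarith
  have hpow : 0 < (m:ℝ) ^ ((2:ℝ) / 3) := Real.rpow_pos_of_pos (by linarith) _
  rw [← hL]
  obtain ⟨S, hS, hSo⟩ : OPT Mk ∈
      {w : ℝ | ∃ S : Fin n → Finset (Fin m), IsAllocation S ∧ allocWelfare Mk S = w} := by
    apply Set.Nonempty.csSup_mem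
    · exact ⟨_, fun _ => ∅, fun i j _ => by simp, rfl⟩
    · apply (Set.finite_range (allocWelfare Mk)).subset
      rintro w ⟨S, -, rfl⟩
      exact ⟨S, rfl⟩
  by_cases hpos : OPT Mk ≤ 0
  · obtain ⟨E, hE⟩ := grand Mk i₀ hmax
    refine ⟨E, ?_⟩
    rw [hE]
    refine le_trans ?_ (hnn _ _)
    apply div_nonpos_of_nonpos_of_nonneg
    · linarith
    · positivity
  push Not at hpos
  obtain ⟨a, ha⟩ : ∃ a : Fin n → ℝ, a = fun i => Mk.v i (S i) := ⟨_, rfl⟩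
  obtain ⟨s, hs⟩ : ∃ s : Finset (Fin n), s = Finset.univ.filter fun i => 0 < a i := ⟨_, rfl⟩
  have hsum : ∑ i ∈ s, a i = OPT Mk := by
    rw [← hSo, allocWelfare, hs, ha, Finset.sum_filter_of_ne]
    intro i _ hi
    exact lt_of_le_of_ne (hnn _ _) (Ne.symm hi)
  have hspos : ∀ i ∈ s, 0 < a i := by
    intro i hi
    rw [hs, Finset.mem_filter] at hi
    exact hi.2
  have hscard : s.card ≤ m := by
    have h1 : ∑ i ∈ s, 1 ≤ ∑ i ∈ s, (S i).card := by
      apply Finset.sum_le_sum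
      intro i hi
      have h2 := hspos i hi
      apply Finset.card_pos.2
      rw [Finset.nonempty_iff_ne_empty]
      intro h3
      rw [ha] at h2
      simp only [h3, Mk.v_empty] at h2
      exact lt_irrefl _ h2
    rw [← Finset.card_biUnion (fun i _ j _ hij => hS i j hij)] at h1
    have h2 := Finset.card_le_univ (s.biUnion S)
    simp only [Finset.sum_const, smul_eq_mul, mul_one, Fintype.card_fin] at h1 h2
    omega
  obtain ⟨i, hi, hik⟩ : ∃ i ∈ s, OPT Mk / L < a i * ((s.filter fun j => a i ≤ a j).card : ℝ) := by
    by_contra hcon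
    push Not at hcon
    have h1 := sum_le_harmonic a (OPT Mk / L) s.card s rfl hcon (fun i hi => (hspos i hi).le)
    rw [hsum] at h1
    have hsne : 0 < s.card := by
      rw [Finset.card_pos, Finset.nonempty_iff_ne_empty]
      intro h; rw [h] at hsum; simp at hsum; linarith
    have h2 : (harmonic s.card : ℝ) ≤ 1 + Real.log s.card := harmonic_le_one_add_log _
    have h3 : Real.log s.card ≤ Real.log m :=
      Real.log_le_log (by exact_mod_cast hsne) (by exact_mod_cast hscard)
    have h4 : Real.log m ≤ Real.logb 2 m := by
      rw [Real.logb, le_div_iff₀ (Real.log_pos (by norm_num))]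
      have h5 : Real.log 2 ≤ 1 := by
        have := Real.log_two_lt_d9; linarith
      have h6 := Real.log_nonneg hm1
      nlinarith
    have h7 : (harmonic s.card : ℝ) < L := by linarith
    have h8 := mul_lt_mul_of_pos_left h7 (div_pos hpos (by linarith : 0 < L))
    have h9 : OPT Mk / L * L = OPT Mk := by
      have : L ≠ 0 := by linarith
      field_simp
    linarith
  obtain ⟨K, hK⟩ : ∃ K : Finset (Fin n), K = s.filter fun j => a i ≤ a j := ⟨_, rfl⟩
  rw [← hK] at hik
  have hiK : i ∈ K := by rw [hK, Finset.mem_filter]; exact ⟨hi, le_rfl⟩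
  obtain ⟨E, hE⟩ := sqrt_bound Mk i₀ hmax S hS (a i) (hspos i hi) K (by
    intro j hj
    rw [hK, Finset.mem_filter] at hj
    have := hj.2
    rw [ha] at this ⊢
    exact this) ⟨i, hiK⟩
  refine ⟨E, le_trans ?_ hE⟩
  have hKm : (K.card : ℝ) ≤ m := by
    have : K.card ≤ s.card := by rw [hK]; exact Finset.card_filter_le _ _
    exact_mod_cast this.trans hscard
  have hKs : Real.sqrt K.card ≤ (m:ℝ) ^ ((2:ℝ) / 3) := by
    calc Real.sqrt K.card ≤ Real.sqrt m := Real.sqrt_le_sqrt hKm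
      _ = (m:ℝ) ^ ((1:ℝ) / 2) := Real.sqrt_eq_rpow _
      _ ≤ _ := Real.rpow_le_rpow_of_exponent_le hm1 (by norm_num)
  have hsq := Real.mul_self_sqrt (Nat.cast_nonneg (α := ℝ) K.card)
  have hs0 := Real.sqrt_nonneg (K.card : ℝ)
  have hai := hspos i hi
  have hLpos : 0 < L := by linarith
  rw [div_lt_iff₀ hLpos] at hik
  rw [div_le_iff₀ (by positivity)]
  have k1 : a i * K.card ≤ a i * (Real.sqrt K.card * (m:ℝ) ^ ((2:ℝ) / 3)) := by
    apply mul_le_mul_of_nonneg_left _ hai.le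
    nlinarith
  have k2 : L ≤ L ^ 2 := by nlinarith
  have k3 : OPT Mk ≤ a i * (Real.sqrt K.card * (m:ℝ) ^ ((2:ℝ) / 3)) * L ^ 2 := by
    calc OPT Mk ≤ a i * K.card * L := hik.le
      _ ≤ a i * (Real.sqrt K.card * (m:ℝ) ^ ((2:ℝ) / 3)) * L := by gcongr
      _ ≤ _ := by gcongr
  linarith

/-- There is an absolute constant `c > 0` such that every market admits a
CBE with welfare at least `c * OPT / (m^(2/3) * (log₂ m + 2)²)`. -/
theorem general_m_two_thirds_approx :
    ∃ c : ℝ, 0 < c ∧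
      ∀ (n m : ℕ), 1 ≤ n → 1 ≤ m → ∀ (Mk : Market n m),
        ∃ E : CBE Mk,
          E.welfare ≥
            c * OPT Mk / ((m : ℝ) ^ ((2 : ℝ) / 3) * (Real.logb 2 m + 2) ^ 2) := by
  exact ⟨1 / 16, by norm_num, fun n m hn hm Mk => final_bound hn hm Mk⟩
end

section
/- There exists an absolute constant c > 0 such that every combinatorial market in which every consumer's valuation is budget-additive admits a competitive bundling equilibrium whose welfare is at least c · OPT / (log(m) + 2). -/
open Finset

/-- A valuation is budget-additive if it is the minimum of an additive valuation and a
budget `b ≥ 0`. -/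
def BudgetAdditive {m : ℕ} (v : Finset (Fin m) → ℝ) : Prop :=
  ∃ b : ℝ, 0 ≤ b ∧ ∀ S : Finset (Fin m), v S = min (∑ j ∈ S, v {j}) b

namespace BAL


/-- Capped additive valuations. -/
structure CapAdd {m : ℕ} (v : Finset (Fin m) → ℝ) : Prop where
  empty : v ∅ = 0
  mono : ∀ S T, S ⊆ T → v S ≤ v T
  union : ∀ S T, Disjoint S T → v (S ∪ T) = min (v S + v T) (v univ)

theorem CapAdd.nonneg {m : ℕ} {v : Finset (Fin m) → ℝ} (h : CapAdd v) (S) : 0 ≤ v S := by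
  have := h.mono ∅ S (empty_subset _)
  rwa [h.empty] at this

theorem CapAdd.le_univ {m : ℕ} {v : Finset (Fin m) → ℝ} (h : CapAdd v) (S) : v S ≤ v univ :=
  h.mono _ _ (subset_univ _)

theorem capAdd_of_budgetAdditive {m : ℕ} {v : Finset (Fin m) → ℝ}
    (h0 : v ∅ = 0) (hm : ∀ S T, S ⊆ T → v S ≤ v T) (hb : BudgetAdditive v) : CapAdd v := by
  obtain ⟨b, hb0, hb⟩ := hb
  refine ⟨h0, hm, ?_⟩
  intro S T hST
  have hpos : ∀ A : Finset (Fin m), 0 ≤ ∑ j ∈ A, v {j} := fun A =>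
    sum_nonneg fun j _ => by rw [← h0]; exact hm _ _ (empty_subset _)
  have hle : ∑ j ∈ S ∪ T, v {j} ≤ ∑ j ∈ univ, v {j} := by
    apply sum_le_sum_of_subset_of_nonneg (subset_univ _)
    intro j _ _; rw [← h0]; exact hm _ _ (empty_subset _)
  rw [hb (S ∪ T), hb S, hb T, hb univ]
  rw [sum_union hST] at *
  have := hpos S
  have := hpos T
  simp only [min_def]
  split_ifs <;> linarith

/-- pairwise disjoint family -/
def PD {m : ℕ} (T : Finset (Finset (Fin m))) : Prop :=
  ∀ b ∈ T, ∀ b' ∈ T, b ≠ b' → Disjoint b b'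

theorem PD.sub {m : ℕ} {T T' : Finset (Finset (Fin m))} (h : PD T) (hs : T' ⊆ T) : PD T' :=
  fun b hb b' hb' => h b (hs hb) b' (hs hb')

theorem CapAdd.biUnion {m : ℕ} {v : Finset (Fin m) → ℝ} (h : CapAdd v)
    (T : Finset (Finset (Fin m))) (hT : PD T) :
    v (T.biUnion id) = min (∑ b ∈ T, v b) (v univ) := by
  induction T using Finset.induction_on with
  | empty => simp [h.empty, h.nonneg]
  | insert a T ha ih =>
    have ih := ih (hT.sub (subset_insert _ _))
    rw [biUnion_insert, sum_insert ha]
    have hd : Disjoint (id a) (T.biUnion id) := by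
      rw [disjoint_biUnion_right]
      intro b hb
      exact hT a (mem_insert_self _ _) b (mem_insert_of_mem hb) (fun e => ha (e ▸ hb))
    rw [h.union _ _ hd, ih]
    have h1 := h.nonneg a
    simp only [id]
    simp only [min_def]
    split_ifs <;> linarith

theorem CapAdd.biUnion_le {m : ℕ} {v : Finset (Fin m) → ℝ} (h : CapAdd v)
    (T : Finset (Finset (Fin m))) (hT : PD T) :
    v (T.biUnion id) ≤ ∑ b ∈ T, v b := by
  rw [h.biUnion T hT]; exact min_le_left _ _

/-- maximum of the values of bidders in `Z`, at least 0 -/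
noncomputable def FZ {n m : ℕ} (v : Fin n → Finset (Fin m) → ℝ) (Z : Finset (Fin n))
    (B : Finset (Fin m)) : ℝ :=
  (insert 0 (Z.image fun z => v z B)).max' (insert_nonempty _ _)

section FZ
variable {n m : ℕ} {v : Fin n → Finset (Fin m) → ℝ} {Z : Finset (Fin n)}

theorem FZ_nonneg (B) : 0 ≤ FZ v Z B := le_max' _ _ (mem_insert_self _ _)

theorem le_FZ {z} (hz : z ∈ Z) (B) : v z B ≤ FZ v Z B :=
  le_max' _ _ (mem_insert_of_mem (mem_image_of_mem (fun z => v z B) hz))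

theorem FZ_le {B c} (h0 : 0 ≤ c) (h : ∀ z ∈ Z, v z B ≤ c) : FZ v Z B ≤ c := by
  apply max'_le
  intro y hy
  rw [mem_insert, mem_image] at hy
  rcases hy with rfl | ⟨z, hz, rfl⟩
  · exact h0
  · exact h z hz

theorem FZ_att {B} (h : 0 < FZ v Z B) : ∃ z ∈ Z, FZ v Z B = v z B := by
  have := max'_mem (insert 0 (Z.image fun z => v z B)) (insert_nonempty _ _)
  rw [mem_insert, mem_image] at this
  rcases this with h' | ⟨z, hz, h'⟩
  · exact absurd h' h.ne'
  · exact ⟨z, hz, h'.symm⟩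

theorem FZ_mono (hv : ∀ i, CapAdd (v i)) {B B'} (h : B ⊆ B') : FZ v Z B ≤ FZ v Z B' :=
  FZ_le (FZ_nonneg _) fun z hz => ((hv z).mono _ _ h).trans (le_FZ hz _)
end FZ

/-- Auction states. -/
structure St (n m : ℕ) where
  bundles : Finset (Finset (Fin m))
  price : Finset (Fin m) → ℝ
  hold : Finset (Fin m) → Option (Fin n)

structure Part {m : ℕ} (Bs : Finset (Finset (Fin m))) : Prop where
  ne : ∀ b ∈ Bs, b.Nonempty
  pd : PD Bs
  cover : ∀ x, ∃ b ∈ Bs, x ∈ b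

def optB {n m : ℕ} (v : Fin n → Finset (Fin m) → ℝ) (s : St n m) (i : Fin n) (c : ℝ) : Prop :=
  ∀ T ⊆ s.bundles, v i (T.biUnion id) - ∑ B ∈ T, s.price B ≤ c

def St.merge {n m : ℕ} (s : St n m) (T : Finset (Finset (Fin m))) (t : ℝ)
    (h : Option (Fin n)) : St n m where
  bundles := insert (T.biUnion id) (s.bundles \ T)
  price := Function.update s.price (T.biUnion id) t
  hold := Function.update s.hold (T.biUnion id) h

section merge
variable {n m : ℕ} {s : St n m} {T : Finset (Finset (Fin m))}

theorem un_notMem (hp : Part s.bundles) (hT : T ⊆ s.bundles) :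
    T.biUnion id ∉ s.bundles \ T := by
  intro h
  rw [mem_sdiff] at h
  obtain ⟨x, hx⟩ := hp.ne _ h.1
  obtain ⟨b, hb, hxb⟩ := mem_biUnion.1 hx
  have hne : T.biUnion id ≠ b := fun e => h.2 (e ▸ hb)
  exact disjoint_left.1 (hp.pd _ h.1 b (hT hb) hne) hx hxb

theorem old_ne (hp : Part s.bundles) (hT : T ⊆ s.bundles) {B} (hB : B ∈ s.bundles) (hBT : B ∉ T) :
    B ≠ T.biUnion id := fun e => un_notMem hp hT (e ▸ mem_sdiff.2 ⟨hB, hBT⟩)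

theorem merge_price_new (t : ℝ) (h : Option (Fin n)) :
    (s.merge T t h).price (T.biUnion id) = t := by simp [St.merge]
theorem merge_hold_new (t : ℝ) (h : Option (Fin n)) :
    (s.merge T t h).hold (T.biUnion id) = h := by simp [St.merge]
theorem merge_price_old {t : ℝ} {h : Option (Fin n)} {B} (hB : B ≠ T.biUnion id) :
    (s.merge T t h).price B = s.price B := by simp [St.merge, hB]
theorem merge_hold_old {t : ℝ} {h : Option (Fin n)} {B} (hB : B ≠ T.biUnion id) :
    (s.merge T t h).hold B = s.hold B := by simp [St.merge, hB]

theorem merge_part (hp : Part s.bundles) (hT : T ⊆ s.bundles) (hne : T.Nonempty) (t : ℝ)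
    (h : Option (Fin n)) : Part (s.merge T t h).bundles := by
  have hd : ∀ b ∈ s.bundles \ T, Disjoint (T.biUnion id) b := by
    intro b hb
    rw [mem_sdiff] at hb
    rw [disjoint_biUnion_left]
    intro b' hb'
    exact hp.pd b' (hT hb') b hb.1 (fun e => hb.2 (e ▸ hb'))
  refine ⟨?_, ?_, ?_⟩
  · intro b hb
    rcases mem_insert.1 hb with rfl | hb
    · obtain ⟨B, hB⟩ := hne
      obtain ⟨x, hx⟩ := hp.ne B (hT hB)
      exact ⟨x, mem_biUnion.2 ⟨B, hB, hx⟩⟩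
    · exact hp.ne b (mem_sdiff.1 hb).1
  · intro b hb b' hb' hbb
    rcases mem_insert.1 hb with rfl | hb <;> rcases mem_insert.1 hb' with rfl | hb'
    · exact absurd rfl hbb
    · exact hd b' hb'
    · exact (hd b hb).symm
    · exact hp.pd b (mem_sdiff.1 hb).1 b' (mem_sdiff.1 hb').1 hbb
  · intro x
    obtain ⟨b, hb, hx⟩ := hp.cover x
    by_cases hbT : b ∈ T
    · exact ⟨_, mem_insert_self _ _, mem_biUnion.2 ⟨b, hbT, hx⟩⟩
    · exact ⟨b, mem_insert_of_mem (mem_sdiff.2 ⟨hb, hbT⟩), hx⟩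

theorem merge_card (hT : T ⊆ s.bundles) (hne : T.Nonempty) (t : ℝ)
    (h : Option (Fin n)) : (s.merge T t h).bundles.card ≤ s.bundles.card := by
  have h1 := card_sdiff_add_card_eq_card hT
  have h2 := hne.card_pos
  have h3 := card_insert_le (T.biUnion id) (s.bundles \ T)
  show (insert (T.biUnion id) (s.bundles \ T)).card ≤ _
  omega

theorem merge_sum (hp : Part s.bundles) (hT : T ⊆ s.bundles) (t : ℝ) (h : Option (Fin n)) :
    ∑ B ∈ (s.merge T t h).bundles, (s.merge T t h).price B
      = t + ∑ B ∈ s.bundles, s.price B - ∑ B ∈ T, s.price B := by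
  show ∑ B ∈ insert (T.biUnion id) (s.bundles \ T), _ = _
  rw [sum_insert (un_notMem hp hT), merge_price_new, ← sum_sdiff hT]
  have : ∑ B ∈ s.bundles \ T, (s.merge T t h).price B = ∑ B ∈ s.bundles \ T, s.price B := by
    apply sum_congr rfl
    intro B hB
    exact merge_price_old (fun e => un_notMem hp hT (e ▸ hB))
  rw [this]; ring

theorem merge_sum_sub (hp : Part s.bundles) (hT : T ⊆ s.bundles) (t : ℝ) (h : Option (Fin n))
    {T' : Finset (Finset (Fin m))} (h' : T' ⊆ s.bundles \ T) :
    ∑ B ∈ T', (s.merge T t h).price B = ∑ B ∈ T', s.price B := by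
  apply sum_congr rfl
  intro B hB
  exact merge_price_old (fun e => un_notMem hp hT (e ▸ h' hB))

theorem merge_optB {v : Fin n → Finset (Fin m) → ℝ} (hp : Part s.bundles) (hT : T ⊆ s.bundles)
    {t : ℝ} {h : Option (Fin n)} (ht : ∑ B ∈ T, s.price B ≤ t) {j c} (ho : optB v s j c) :
    optB v (s.merge T t h) j c := by
  intro T' hT'
  by_cases hN : T.biUnion id ∈ T'
  · have hsub : T'.erase (T.biUnion id) ⊆ s.bundles \ T := by
      intro B hB
      rw [mem_erase] at hB
      exact (mem_insert.1 (hT' hB.2)).resolve_left hB.1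
    have h1 := ho (T'.erase (T.biUnion id) ∪ T)
      (union_subset (hsub.trans sdiff_subset) hT)
    have hd : Disjoint (T'.erase (T.biUnion id)) T :=
      disjoint_of_subset_left hsub sdiff_disjoint
    rw [sum_union hd, union_biUnion] at h1
    rw [← insert_erase hN, sum_insert (notMem_erase _ _), merge_price_new,
      merge_sum_sub hp hT t h hsub, biUnion_insert, union_comm]
    simp only [id] at h1 ⊢
    linarith
  · have hsub : T' ⊆ s.bundles \ T := by
      intro B hB
      exact (mem_insert.1 (hT' hB)).resolve_left (fun e => hN (e ▸ hB))
    rw [merge_sum_sub hp hT t h hsub]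
    exact ho T' (hsub.trans sdiff_subset)

theorem dump_optB {v : Fin n → Finset (Fin m) → ℝ} (hv : ∀ i, CapAdd (v i)) (hp : Part s.bundles)
    (hT : T ⊆ s.bundles) (hpr : ∀ B ∈ s.bundles, 0 ≤ s.price B)
    {t : ℝ} {h : Option (Fin n)} {top} (htop : top ∈ T) (ht : s.price top ≤ t) {j c}
    (hc : 0 ≤ c) (hj : v j top = v j univ ∨ v j univ ≤ s.price top) (ho : optB v s j c) :
    optB v (s.merge T t h) j c := by
  intro T' hT'
  by_cases hN : T.biUnion id ∈ T'
  · have hsub : T'.erase (T.biUnion id) ⊆ s.bundles \ T := by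
      intro B hB
      rw [mem_erase] at hB
      exact (mem_insert.1 (hT' hB.2)).resolve_left hB.1
    have hsum : ∑ B ∈ T', (s.merge T t h).price B
        = t + ∑ B ∈ T'.erase (T.biUnion id), s.price B := by
      conv_lhs => rw [← insert_erase hN]
      rw [sum_insert (notMem_erase _ _), merge_price_new, merge_sum_sub hp hT t h hsub]
    have hnn : 0 ≤ ∑ B ∈ T'.erase (T.biUnion id), s.price B :=
      sum_nonneg fun B hB => hpr B (mem_sdiff.1 (hsub hB)).1
    have hu := (hv j).le_univ (T'.biUnion id)
    rw [hsum]
    rcases hj with hj | hj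
    · have hnot : top ∉ T'.erase (T.biUnion id) := fun h => (mem_sdiff.1 (hsub h)).2 htop
      have h1 := ho (insert top (T'.erase (T.biUnion id)))
        (insert_subset (hT htop) (hsub.trans sdiff_subset))
      rw [sum_insert hnot] at h1
      have h2 : v j top ≤ v j ((insert top (T'.erase (T.biUnion id))).biUnion id) :=
        (hv j).mono _ _ (subset_biUnion_of_mem id (mem_insert_self _ _))
      linarith
    · linarith
  · have hsub : T' ⊆ s.bundles \ T := by
      intro B hB
      exact (mem_insert.1 (hT' hB)).resolve_left (fun e => hN (e ▸ hB))
    rw [merge_sum_sub hp hT t h hsub]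
    exact ho T' (hsub.trans sdiff_subset)

end merge

/-- The invariant of the bundling auction. -/
structure Inv {n m : ℕ} (v : Fin n → Finset (Fin m) → ℝ) (Z : Finset (Fin n)) (P ρ : ℝ)
    (X : Finset (Fin m)) (x0 : Fin m) (mk : Finset (Fin m) → Fin m) (N : ℕ) (ε : ℝ)
    (R D0 : Finset (Finset (Fin m))) (r : Finset (Fin m) → ℝ) (s : St n m) : Prop where
  part : Part s.bundles
  zval : ∀ B ∈ s.bundles, ∀ z ∈ Z, v z B ≤ s.price B
  wt : ∀ B ∈ s.bundles, ρ * ((R.filter fun l => mk l ∈ B).card : ℝ) ≤ s.price B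
  top : ∀ B ∈ s.bundles, x0 ∈ B → X ⊆ B ∧ P ≤ s.price B
  unheld : ∀ B ∈ s.bundles, s.hold B = none → B ∈ D0 ∧ s.price B = r B
  held : ∀ B ∈ s.bundles, ∀ i, s.hold B = some i →
    i ∉ Z ∧ s.price B ≤ v i B ∧ optB v s i (v i B - s.price B + ε)
  uniq : ∀ B ∈ s.bundles, ∀ B' ∈ s.bundles, ∀ i, s.hold B = some i → s.hold B' = some i → B = B'
  card : s.bundles.card ≤ N

def Term {n m : ℕ} (v : Fin n → Finset (Fin m) → ℝ) (Z : Finset (Fin n)) (ε : ℝ)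
    (s : St n m) : Prop :=
  ∀ i, i ∉ Z → (∀ B ∈ s.bundles, s.hold B ≠ some i) → optB v s i ε

section inv
variable {n m : ℕ} {v : Fin n → Finset (Fin m) → ℝ} {Z : Finset (Fin n)} {P ρ : ℝ}
    {X : Finset (Fin m)} {x0 : Fin m} {mk : Finset (Fin m) → Fin m} {N : ℕ} {ε : ℝ}
    {R D0 : Finset (Finset (Fin m))} {r : Finset (Fin m) → ℝ} {s : St n m}

theorem Inv.nn (h : Inv v Z P ρ X x0 mk N ε R D0 r s) (hρ : 0 ≤ ρ) :
    ∀ B ∈ s.bundles, 0 ≤ s.price B := fun B hB =>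
  le_trans (mul_nonneg hρ (Nat.cast_nonneg _)) (h.wt B hB)

theorem step (hv : ∀ i, CapAdd (v i)) (hρ : 0 ≤ ρ) (hε : 0 < ε)
    (h : Inv v Z P ρ X x0 mk N ε R D0 r s) (hnt : ¬ Term v Z ε s) :
    ∃ s', Inv v Z P ρ X x0 mk N ε R D0 r s' ∧
      ∑ B ∈ s'.bundles, s'.price B = ∑ B ∈ s.bundles, s.price B + ε := by
  unfold Term at hnt
  push Not at hnt
  obtain ⟨i, hiZ, hnh, hopt⟩ := hnt
  obtain ⟨T, hTm, hTmax⟩ := exists_max_image s.bundles.powerset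
    (fun T => v i (T.biUnion id) - ∑ B ∈ T, s.price B) ⟨∅, by simp⟩
  have hT : T ⊆ s.bundles := mem_powerset.1 hTm
  have hlt : ε < v i (T.biUnion id) - ∑ B ∈ T, s.price B := by
    unfold optB at hopt
    push Not at hopt
    obtain ⟨T', hT', hlt⟩ := hopt
    exact hlt.trans_le (hTmax T' (mem_powerset.2 hT'))
  have hne : T.Nonempty := by
    rw [nonempty_iff_ne_empty]
    rintro rfl
    simp [(hv i).empty] at hlt
    linarith
  have hoi : optB v s i (v i (T.biUnion id) - ∑ B ∈ T, s.price B) :=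
    fun T' hT' => hTmax T' (mem_powerset.2 hT')
  have hge : ∑ B ∈ T, s.price B ≤ ∑ B ∈ T, s.price B + ε := by linarith
  have hnn := h.nn hρ
  refine ⟨s.merge T (∑ B ∈ T, s.price B + ε) (some i), ?_, ?_⟩
  swap
  · rw [merge_sum h.part hT]; ring
  refine ⟨merge_part h.part hT hne _ _, ?_, ?_, ?_, ?_, ?_, ?_, ?_⟩
  · intro B hB z hz
    rcases mem_insert.1 hB with rfl | hB'
    · rw [merge_price_new]
      refine ((hv z).biUnion_le T (h.part.pd.sub hT)).trans (le_trans ?_ hge)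
      exact sum_le_sum fun B hB => h.zval B (hT hB) z hz
    · have := mem_sdiff.1 hB'
      rw [merge_price_old (old_ne h.part hT this.1 this.2)]
      exact h.zval B this.1 z hz
  · intro B hB
    rcases mem_insert.1 hB with rfl | hB'
    · rw [merge_price_new]
      refine le_trans ?_ hge
      have h1 : (R.filter fun l => mk l ∈ T.biUnion id)
          ⊆ T.biUnion fun B => R.filter fun l => mk l ∈ B := by
        intro l hl
        rw [mem_filter, mem_biUnion] at hl
        obtain ⟨hl, B, hB, hlB⟩ := hl
        exact mem_biUnion.2 ⟨B, hB, mem_filter.2 ⟨hl, hlB⟩⟩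
      have h2 : ((R.filter fun l => mk l ∈ T.biUnion id).card : ℝ)
          ≤ ∑ B ∈ T, ((R.filter fun l => mk l ∈ B).card : ℝ) := by
        exact_mod_cast (card_le_card h1).trans card_biUnion_le
      refine (mul_le_mul_of_nonneg_left h2 hρ).trans ?_
      rw [mul_sum]
      exact sum_le_sum fun B hB => h.wt B (hT hB)
    · have := mem_sdiff.1 hB'
      rw [merge_price_old (old_ne h.part hT this.1 this.2)]
      exact h.wt B this.1
  · intro B hB hx
    rcases mem_insert.1 hB with rfl | hB'
    · rw [merge_price_new]
      obtain ⟨B, hB, hxB⟩ := mem_biUnion.1 hx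
      obtain ⟨h1, h2⟩ := h.top B (hT hB) hxB
      refine ⟨h1.trans (subset_biUnion_of_mem id hB), h2.trans (le_trans ?_ hge)⟩
      exact single_le_sum (f := s.price) (fun B hB => hnn B (hT hB)) hB
    · have := mem_sdiff.1 hB'
      rw [merge_price_old (old_ne h.part hT this.1 this.2)]
      exact h.top B this.1 hx
  · intro B hB hh
    rcases mem_insert.1 hB with rfl | hB'
    · rw [merge_hold_new] at hh; exact absurd hh (by simp)
    · have := mem_sdiff.1 hB'
      rw [merge_price_old (old_ne h.part hT this.1 this.2)]
      rw [merge_hold_old (old_ne h.part hT this.1 this.2)] at hh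
      exact h.unheld B this.1 hh
  · intro B hB j hh
    rcases mem_insert.1 hB with rfl | hB'
    · rw [merge_hold_new] at hh
      obtain rfl : i = j := by simpa using hh
      rw [merge_price_new]
      refine ⟨hiZ, by linarith, ?_⟩
      have := merge_optB (h := some i) h.part hT hge hoi
      intro T' hT'
      have := this T' hT'
      linarith
    · have := mem_sdiff.1 hB'
      rw [merge_price_old (old_ne h.part hT this.1 this.2)]
      rw [merge_hold_old (old_ne h.part hT this.1 this.2)] at hh
      obtain ⟨h1, h2, h3⟩ := h.held B this.1 j hh
      exact ⟨h1, h2, merge_optB h.part hT hge h3⟩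
  · intro B hB B' hB' j hh hh'
    rcases mem_insert.1 hB with rfl | hB1 <;> rcases mem_insert.1 hB' with rfl | hB1'
    · rfl
    · have := mem_sdiff.1 hB1'
      rw [merge_hold_new] at hh
      obtain rfl : i = j := by simpa using hh
      rw [merge_hold_old (old_ne h.part hT this.1 this.2)] at hh'
      exact absurd hh' (hnh _ this.1)
    · have := mem_sdiff.1 hB1
      rw [merge_hold_new] at hh'
      obtain rfl : i = j := by simpa using hh'
      rw [merge_hold_old (old_ne h.part hT this.1 this.2)] at hh
      exact absurd hh (hnh _ this.1)
    · have h1 := mem_sdiff.1 hB1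
      have h2 := mem_sdiff.1 hB1'
      rw [merge_hold_old (old_ne h.part hT h1.1 h1.2)] at hh
      rw [merge_hold_old (old_ne h.part hT h2.1 h2.2)] at hh'
      exact h.uniq B h1.1 B' h2.1 j hh hh'
  · exact (merge_card hT hne _ _).trans h.card

theorem Inv.total_le (hv : ∀ i, CapAdd (v i)) (h : Inv v Z P ρ X x0 mk N ε R D0 r s) :
    ∑ B ∈ s.bundles, s.price B ≤ ∑ B : Finset (Fin m), (|r B| + ∑ i, v i univ) := by
  have h0 : 0 ≤ ∑ i, v i univ := sum_nonneg fun i _ => (hv i).nonneg _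
  refine (sum_le_sum (g := fun B => |r B| + ∑ i, v i univ) ?_).trans
    (sum_le_sum_of_subset_of_nonneg (subset_univ _) fun B _ _ => by positivity)
  intro B hB
  rcases hh : s.hold B with _ | i
  · rw [(h.unheld B hB hh).2]
    have := le_abs_self (r B)
    linarith
  · have h1 := (h.held B hB i hh).2.1
    have h2 := (hv i).le_univ B
    have h3 : v i univ ≤ ∑ i, v i univ :=
      single_le_sum (f := fun i => v i univ) (fun i _ => (hv i).nonneg _) (mem_univ i)
    have := abs_nonneg (r B)
    linarith

theorem run (hv : ∀ i, CapAdd (v i)) (hρ : 0 ≤ ρ) (hε : 0 < ε)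
    (h : Inv v Z P ρ X x0 mk N ε R D0 r s) :
    ∃ s', Inv v Z P ρ X x0 mk N ε R D0 r s' ∧ Term v Z ε s' := by
  have key : ∀ k : ℕ, ∀ s, Inv v Z P ρ X x0 mk N ε R D0 r s →
      ∑ B : Finset (Fin m), (|r B| + ∑ i, v i univ) - ∑ B ∈ s.bundles, s.price B ≤ k * ε →
      ∃ s', Inv v Z P ρ X x0 mk N ε R D0 r s' ∧ Term v Z ε s' := by
    intro k
    induction k with
    | zero =>
      intro s h hk
      by_contra hcon
      push Not at hcon
      obtain ⟨s', h', hs'⟩ := step hv hρ hε h (hcon s h)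
      have := h'.total_le hv
      simp at hk
      linarith
    | succ k ih =>
      intro s h hk
      by_cases ht : Term v Z ε s
      · exact ⟨s, h, ht⟩
      · obtain ⟨s', h', hs'⟩ := step hv hρ hε h ht
        apply ih s' h'
        push_cast at hk
        linarith
  obtain ⟨k, hk⟩ := exists_nat_ge
    ((∑ B : Finset (Fin m), (|r B| + ∑ i, v i univ) - ∑ B ∈ s.bundles, s.price B) / ε)
  exact key k s h ((div_le_iff₀ hε).1 hk)

/-- Merging unheld bundles into the top bundle. -/
theorem dump_inv (hv : ∀ i, CapAdd (v i)) (hρ : 0 ≤ ρ) (hε : 0 < ε)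
    (h : Inv v Z P ρ X x0 mk N ε R D0 r s) {T : Finset (Finset (Fin m))} {tp : Finset (Fin m)}
    {t : ℝ} {h' : Option (Fin n)} {R' D' : Finset (Finset (Fin m))} {r' : Finset (Fin m) → ℝ}
    (hcap : ∀ i, i ∉ Z → v i X = v i univ ∨ v i univ ≤ P)
    (hT : T ⊆ s.bundles) (htp : tp ∈ T) (hx : x0 ∈ tp) (ht : s.price tp ≤ t)
    (hF : FZ v Z (T.biUnion id) ≤ t) (hR : R' ⊆ R)
    (hR' : ∀ l ∈ R', ∀ B ∈ T, B ≠ tp → mk l ∉ B)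
    (hso : ∀ i, h' = some i → s.hold tp = some i ∧ t = s.price tp)
    (hno : h' = none → T.biUnion id ∈ D' ∧ t = r' (T.biUnion id))
    (hold : ∀ B ∈ s.bundles, B ∉ T → s.hold B = none → B ∈ D' ∧ s.price B = r' B) :
    Inv v Z P ρ X x0 mk N ε R' D' r' (s.merge T t h') := by
  have hnn := h.nn hρ
  have htop := h.top tp (hT htp) hx
  have hj : ∀ j, j ∉ Z → v j tp = v j univ ∨ v j univ ≤ s.price tp := by
    intro j hj
    rcases hcap j hj with h1 | h1
    · left
      exact le_antisymm ((hv j).le_univ _) (h1 ▸ (hv j).mono _ _ htop.1)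
    · right; exact h1.trans htop.2
  have hsubT : tp ⊆ T.biUnion id := subset_biUnion_of_mem id htp
  refine ⟨merge_part h.part hT ⟨_, htp⟩ _ _, ?_, ?_, ?_, ?_, ?_, ?_, ?_⟩
  · intro B hB z hz
    rcases mem_insert.1 hB with rfl | hB'
    · rw [merge_price_new]
      exact (le_FZ hz _).trans hF
    · have := mem_sdiff.1 hB'
      rw [merge_price_old (old_ne h.part hT this.1 this.2)]
      exact h.zval B this.1 z hz
  · have hsub : ∀ B : Finset (Fin m), ρ * ((R'.filter fun l => mk l ∈ B).card : ℝ)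
        ≤ ρ * ((R.filter fun l => mk l ∈ B).card : ℝ) := fun B =>
      mul_le_mul_of_nonneg_left
        (by exact_mod_cast card_le_card (filter_subset_filter _ hR)) hρ
    intro B hB
    rcases mem_insert.1 hB with rfl | hB'
    · rw [merge_price_new]
      have h1 : (R'.filter fun l => mk l ∈ T.biUnion id) ⊆ R'.filter fun l => mk l ∈ tp := by
        intro l hl
        rw [mem_filter, mem_biUnion] at hl
        obtain ⟨hl, B, hB, hlB⟩ := hl
        refine mem_filter.2 ⟨hl, ?_⟩
        by_cases hBt : B = tp
        · exact hBt ▸ hlB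
        · exact absurd hlB (hR' l hl B hB hBt)
      have h2 : ρ * ((R'.filter fun l => mk l ∈ T.biUnion id).card : ℝ)
        ≤ ρ * ((R'.filter fun l => mk l ∈ tp).card : ℝ) :=
        mul_le_mul_of_nonneg_left (by exact_mod_cast card_le_card h1) hρ
      exact h2.trans ((hsub _).trans ((h.wt tp (hT htp)).trans ht))
    · have := mem_sdiff.1 hB'
      rw [merge_price_old (old_ne h.part hT this.1 this.2)]
      exact (hsub _).trans (h.wt B this.1)
  · intro B hB hxB
    rcases mem_insert.1 hB with rfl | hB'
    · rw [merge_price_new]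
      exact ⟨htop.1.trans hsubT, htop.2.trans ht⟩
    · have := mem_sdiff.1 hB'
      rw [merge_price_old (old_ne h.part hT this.1 this.2)]
      exact h.top B this.1 hxB
  · intro B hB hh
    rcases mem_insert.1 hB with rfl | hB'
    · rw [merge_hold_new] at hh
      rw [merge_price_new]
      exact hno hh
    · have := mem_sdiff.1 hB'
      rw [merge_price_old (old_ne h.part hT this.1 this.2)]
      rw [merge_hold_old (old_ne h.part hT this.1 this.2)] at hh
      exact hold B this.1 this.2 hh
  · intro B hB j hh
    rcases mem_insert.1 hB with rfl | hB'
    · rw [merge_hold_new] at hh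
      obtain ⟨h1, h2⟩ := hso j hh
      rw [merge_price_new]
      obtain ⟨h3, h4, h5⟩ := h.held tp (hT htp) j h1
      have h6 := (hv j).mono _ _ hsubT
      refine ⟨h3, by linarith, ?_⟩
      have := dump_optB (h := h') hv h.part hT hnn htp ht (by linarith) (hj j h3) h5
      intro T' hT'
      have := this T' hT'
      linarith
    · have := mem_sdiff.1 hB'
      rw [merge_price_old (old_ne h.part hT this.1 this.2)]
      rw [merge_hold_old (old_ne h.part hT this.1 this.2)] at hh
      obtain ⟨h1, h2, h3⟩ := h.held B this.1 j hh
      exact ⟨h1, h2, dump_optB hv h.part hT hnn htp ht (by linarith) (hj j h1) h3⟩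
  · intro B hB B' hB' j hh hh'
    rcases mem_insert.1 hB with rfl | hB1 <;> rcases mem_insert.1 hB' with rfl | hB1'
    · rfl
    · have := mem_sdiff.1 hB1'
      rw [merge_hold_new] at hh
      rw [merge_hold_old (old_ne h.part hT this.1 this.2)] at hh'
      have := h.uniq tp (hT htp) B' this.1 j (hso j hh).1 hh'
      exact absurd (this ▸ htp) (mem_sdiff.1 hB1').2
    · have := mem_sdiff.1 hB1
      rw [merge_hold_new] at hh'
      rw [merge_hold_old (old_ne h.part hT this.1 this.2)] at hh
      have := h.uniq tp (hT htp) B this.1 j (hso j hh').1 hh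
      exact absurd (this ▸ htp) (mem_sdiff.1 hB1).2
    · have h1 := mem_sdiff.1 hB1
      have h2 := mem_sdiff.1 hB1'
      rw [merge_hold_old (old_ne h.part hT h1.1 h1.2)] at hh
      rw [merge_hold_old (old_ne h.part hT h2.1 h2.2)] at hh'
      exact h.uniq B h1.1 B' h2.1 j hh hh'
  · exact (merge_card hT ⟨_, htp⟩ _ _).trans h.card

theorem dump_term (hv : ∀ i, CapAdd (v i)) (hρ : 0 ≤ ρ) (hε : 0 < ε)
    (h : Inv v Z P ρ X x0 mk N ε R D0 r s) {T : Finset (Finset (Fin m))} {tp : Finset (Fin m)}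
    {t : ℝ} {h' : Option (Fin n)}
    (hcap : ∀ i, i ∉ Z → v i X = v i univ ∨ v i univ ≤ P)
    (hT : T ⊆ s.bundles) (htp : tp ∈ T) (hx : x0 ∈ tp) (ht : s.price tp ≤ t)
    (hs : s.hold tp = h') (hTn : ∀ B ∈ T, B ≠ tp → s.hold B = none) (hterm : Term v Z ε s) :
    Term v Z ε (s.merge T t h') := by
  intro i hi hnh
  have htop := h.top tp (hT htp) hx
  have hj : v i tp = v i univ ∨ v i univ ≤ s.price tp := by
    rcases hcap i hi with h1 | h1
    · left
      exact le_antisymm ((hv i).le_univ _) (h1 ▸ (hv i).mono _ _ htop.1)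
    · right; exact h1.trans htop.2
  refine dump_optB hv h.part hT (h.nn hρ) htp ht hε.le hj (hterm i hi ?_)
  intro B hB hBi
  by_cases hBT : B ∈ T
  · by_cases hBt : B = tp
    · have := hnh (T.biUnion id) (mem_insert_self _ _)
      rw [merge_hold_new] at this
      exact this (by rw [← hs, ← hBt, hBi])
    · rw [hTn B hBT hBt] at hBi; exact absurd hBi (by simp)
  · have := hnh B (mem_insert_of_mem (mem_sdiff.2 ⟨hB, hBT⟩))
    rw [merge_hold_old (old_ne h.part hT hB hBT)] at this
    exact this hBi
end inv

/-- Approximate bundling equilibria. -/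
def EpsCBE {n m : ℕ} (v : Fin n → Finset (Fin m) → ℝ) (ε W : ℝ) : Prop :=
  ∃ (bundles : Finset (Finset (Fin m))) (price : Finset (Fin m) → ℝ)
    (assign : Finset (Fin m) → Fin n), Part bundles ∧ (∀ b ∈ bundles, 0 ≤ price b) ∧
    (∀ i, ∀ T ⊆ bundles, v i (T.biUnion id) - ∑ b ∈ T, price b ≤
      v i ((bundles.filter fun b => assign b = i).biUnion id)
        - ∑ b ∈ bundles.filter fun b => assign b = i, price b + ε) ∧
    W ≤ ∑ i, v i ((bundles.filter fun b => assign b = i).biUnion id)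

section assemble
variable {n m : ℕ} {v : Fin n → Finset (Fin m) → ℝ} {Z : Finset (Fin n)} {P ρ : ℝ}
    {X : Finset (Fin m)} {x0 : Fin m} {mk : Finset (Fin m) → Fin m} {N : ℕ} {ε : ℝ}
    {R D0 : Finset (Finset (Fin m))} {r : Finset (Fin m) → ℝ} {s : St n m}

theorem Inv.total_ge (hρ : 0 ≤ ρ) (h : Inv v Z P ρ X x0 mk N ε R D0 r s) :
    ρ * (R.card : ℝ) ≤ ∑ B ∈ s.bundles, s.price B := by
  have h1 : R ⊆ s.bundles.biUnion fun B => R.filter fun l => mk l ∈ B := by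
    intro l hl
    obtain ⟨B, hB, hx⟩ := h.part.cover (mk l)
    exact mem_biUnion.2 ⟨B, hB, mem_filter.2 ⟨hl, hx⟩⟩
  have h2 : (R.card : ℝ) ≤ ∑ B ∈ s.bundles, ((R.filter fun l => mk l ∈ B).card : ℝ) := by
    exact_mod_cast (card_le_card h1).trans card_biUnion_le
  refine (mul_le_mul_of_nonneg_left h2 hρ).trans ?_
  rw [mul_sum]
  exact sum_le_sum fun B hB => h.wt B hB

theorem assemble (hv : ∀ i, CapAdd (v i)) (hρ : 0 ≤ ρ) (hε : 0 < ε)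
    (h : Inv v Z P ρ X x0 mk N ε R D0 r s) (ht : Term v Z ε s) (cl : Finset (Fin m) → Fin n)
    (ha : ∀ B ∈ s.bundles, s.hold B = none → cl B ∈ Z ∨ s.price B = 0)
    (hb : ∀ z ∈ Z, v z ((s.bundles.filter fun B => s.hold B = none ∧ cl B = z).biUnion id)
      = ∑ B ∈ s.bundles.filter fun B => s.hold B = none ∧ cl B = z, s.price B) :
    EpsCBE v ε (ρ * (R.card : ℝ)) := by
  set as : Finset (Fin m) → Fin n := fun B => (s.hold B).getD (cl B) with has
  have key : ∀ i, (∑ b ∈ s.bundles.filter fun b => as b = i, s.price b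
      ≤ v i ((s.bundles.filter fun b => as b = i).biUnion id)) ∧
      optB v s i (v i ((s.bundles.filter fun b => as b = i).biUnion id)
        - ∑ b ∈ s.bundles.filter fun b => as b = i, s.price b + ε) := by
    intro i
    by_cases hi : i ∈ Z
    · have he : (s.bundles.filter fun b => as b = i)
          = s.bundles.filter fun B => s.hold B = none ∧ cl B = i := by
        apply filter_congr
        intro B hB
        rcases hh : s.hold B with _ | j
        · simp [has, hh]
        · simp only [has, hh, Option.getD_some, reduceCtorEq, false_and, iff_false]
          rintro rfl
          exact (h.held B hB j hh).1 hi
      rw [he, hb i hi]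
      refine ⟨le_rfl, ?_⟩
      intro T hT
      have h1 := (hv i).biUnion_le T (h.part.pd.sub hT)
      have h2 : ∑ B ∈ T, v i B ≤ ∑ B ∈ T, s.price B :=
        sum_le_sum fun B hB => h.zval B (hT hB) i hi
      linarith
    · by_cases hh : ∃ B ∈ s.bundles, s.hold B = some i
      · obtain ⟨B0, hB0, hB0i⟩ := hh
        have hmem : B0 ∈ s.bundles.filter fun b => as b = i :=
          mem_filter.2 ⟨hB0, by simp [has, hB0i]⟩
        have hsum : ∑ b ∈ s.bundles.filter fun b => as b = i, s.price b = s.price B0 := by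
          apply sum_eq_single_of_mem _ hmem
          intro B hB hne
          rw [mem_filter] at hB
          rcases hhB : s.hold B with _ | j
          · rcases ha B hB.1 hhB with h1 | h1
            · have : cl B = i := by simpa [has, hhB] using hB.2
              exact absurd (this ▸ h1) hi
            · exact h1
          · have : j = i := by simpa [has, hhB] using hB.2
            subst this
            exact absurd (h.uniq B hB.1 B0 hB0 _ hhB hB0i) hne
        have hle : v i B0 ≤ v i ((s.bundles.filter fun b => as b = i).biUnion id) :=
          (hv i).mono _ _ (subset_biUnion_of_mem id hmem)
        obtain ⟨_, h2, h3⟩ := h.held B0 hB0 i hB0i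
        rw [hsum]
        refine ⟨h2.trans hle, ?_⟩
        intro T hT
        have := h3 T hT
        linarith
      · push Not at hh
        have hsum : ∑ b ∈ s.bundles.filter fun b => as b = i, s.price b = 0 := by
          apply sum_eq_zero
          intro B hB
          rw [mem_filter] at hB
          rcases hhB : s.hold B with _ | j
          · rcases ha B hB.1 hhB with h1 | h1
            · have : cl B = i := by simpa [has, hhB] using hB.2
              exact absurd (this ▸ h1) hi
            · exact h1
          · have : j = i := by simpa [has, hhB] using hB.2
            subst this
            exact absurd hhB (hh B hB.1)
        rw [hsum]
        have h0 := (hv i).nonneg ((s.bundles.filter fun b => as b = i).biUnion id)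
        refine ⟨h0, ?_⟩
        intro T hT
        have := ht i hi hh T hT
        linarith
  refine ⟨s.bundles, s.price, as, h.part, h.nn hρ, fun i T hT => (key i).2 T hT, ?_⟩
  refine (h.total_ge hρ).trans ?_
  rw [← sum_fiberwise s.bundles as s.price]
  exact sum_le_sum fun i _ => (key i).1
end assemble

theorem selection {n m : ℕ} {v : Fin n → Finset (Fin m) → ℝ} (hv : ∀ i, CapAdd (v i))
    {L : Finset (Finset (Fin m))} (hL : PD L) {q : ℕ} (hq : 2 * q ≤ L.card) :
    ∃ R ⊆ L, R.card = q ∧ ∃ (Z : Finset (Fin n)) (P : ℝ),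
      (∀ i, i ∉ Z → v i ((L \ R).biUnion id) = v i univ ∨ v i univ ≤ P) ∧
      (∀ z ∈ Z, ∑ l ∈ R, v z l ≤ v z univ) ∧ P ≤ FZ v Z ((L \ R).biUnion id) := by
  classical
  have hex : ∀ i, ∃ R ∈ L.powersetCard q, ∀ R' ∈ L.powersetCard q,
      ∑ l ∈ R, v i l ≤ ∑ l ∈ R', v i l := fun i =>
    exists_min_image (L.powersetCard q) (fun R => ∑ l ∈ R, v i l)
      (powersetCard_nonempty.2 (by omega))
  choose Rm hRm hmin using hex
  -- q-subset of the complement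
  have hcomp : ∀ R ∈ L.powersetCard q, ∃ R' ∈ L.powersetCard q, R' ⊆ L \ R := by
    intro R hR
    rw [mem_powersetCard] at hR
    have : q ≤ (L \ R).card := by
      have := card_sdiff_add_card_eq_card hR.1
      omega
    obtain ⟨R', h1, h2⟩ := exists_subset_card_eq this
    exact ⟨R', mem_powersetCard.2 ⟨h1.trans sdiff_subset, h2⟩, h1⟩
  have hnn : ∀ i (A B : Finset (Finset (Fin m))), A ⊆ B → ∑ l ∈ A, v i l ≤ ∑ l ∈ B, v i l :=
    fun i A B hAB => sum_le_sum_of_subset_of_nonneg hAB fun l _ _ => (hv i).nonneg l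
  set Nn : Finset (Fin n) := univ.filter fun i => ∑ l ∈ Rm i, v i l < v i univ with hN
  have hout : ∀ R ∈ L.powersetCard q, ∀ i, i ∉ Nn → v i ((L \ R).biUnion id) = v i univ := by
    intro R hR i hi
    have hi' : v i univ ≤ ∑ l ∈ Rm i, v i l := by
      simpa [hN] using hi
    obtain ⟨R', h1, h2⟩ := hcomp R hR
    rw [(hv i).biUnion _ (hL.sub sdiff_subset)]
    apply min_eq_right
    exact hi'.trans ((hmin i R' h1).trans (hnn i _ _ h2))
  rcases Nn.eq_empty_or_nonempty with hE | hne
  · obtain ⟨R, hR⟩ := powersetCard_nonempty.2 (show q ≤ L.card by omega)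
    have hR' := mem_powersetCard.1 hR
    refine ⟨R, hR'.1, hR'.2, ∅, 0, ?_, by simp, FZ_nonneg _⟩
    intro i _
    left
    exact hout R hR i (by simp [hE])
  · obtain ⟨e, heN, hemax⟩ := exists_max_image Nn
      (fun i => v i ((L \ Rm i).biUnion id)) hne
    have hRe := mem_powersetCard.1 (hRm e)
    set P := v e ((L \ Rm e).biUnion id) with hP
    refine ⟨Rm e, hRe.1, hRe.2, insert e (Nn.filter fun i => P < v i univ), P, ?_, ?_,
      le_FZ (mem_insert_self _ _) _⟩
    · intro i hi
      by_cases hiN : i ∈ Nn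
      · right
        by_contra hcon
        exact hi (mem_insert_of_mem (mem_filter.2 ⟨hiN, not_le.1 hcon⟩))
      · left
        exact hout _ (hRm e) i hiN
    · intro z hz
      rcases mem_insert.1 hz with rfl | hz
      · exact (mem_filter.1 heN).2.le
      · obtain ⟨hzN, hzP⟩ := mem_filter.1 hz
        have h1 := hemax z hzN
        have h2 : v z ((L \ Rm z).biUnion id) < v z univ := lt_of_le_of_lt h1 hzP
        rw [(hv z).biUnion _ (hL.sub sdiff_subset), min_lt_iff] at h2
        have h2 : ∑ l ∈ L \ Rm z, v z l < v z univ := h2.resolve_right (lt_irrefl _)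
        obtain ⟨R', h3, h4⟩ := hcomp _ (hRm e)
        have h5 := hmin z R' h3
        have h6 := sum_sdiff (f := v z) (mem_powersetCard.1 (hRm z)).1
        have h7 := sum_sdiff (f := v z) (mem_powersetCard.1 h3).1
        have h8 : Rm e ⊆ L \ R' := by
          intro l hl
          rw [mem_sdiff]
          exact ⟨hRe.1 hl, fun h => (mem_sdiff.1 (h4 h)).2 hl⟩
        have h9 := hnn z _ _ h8
        linarith

theorem yLemma {n m : ℕ} {v : Fin n → Finset (Fin m) → ℝ} (hv : ∀ i, CapAdd (v i))
    {Z : Finset (Fin n)} (hZ : Z.Nonempty) {Q : Finset (Finset (Fin m))} {A : Finset (Fin m)}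
    (hA : A ∉ Q) (hQ : PD (insert A Q)) (cl : Finset (Fin m) → Fin n) {ρ : ℝ} {n0 : ℕ}
    (hcl : ∀ l ∈ Q, ρ ≤ v (cl l) l)
    (hsum : ∀ z ∈ Z, ∑ l ∈ Q, v z l ≤ v z univ) (hn0 : ∀ z ∈ Z, v z univ < ρ * n0) :
    ∃ Y ⊆ Q, ∃ z ∈ Z, Y.card ≤ n0 ∧
      (∀ z' ∈ Z, v z' ((insert A Y).biUnion id) ≤ v z ((insert A Y).biUnion id)) ∧
      ∀ l ∈ Q, cl l = z → l ∈ Y := by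
  classical
  by_cases hc : Q.card ≤ n0
  · obtain ⟨z, hz, hmax⟩ := exists_max_image Z (fun z => v z ((insert A Q).biUnion id)) hZ
    exact ⟨Q, Subset.rfl, z, hz, hc, hmax, fun l hl _ => hl⟩
  push Not at hc
  let g : Finset (Finset (Fin m)) × Fin n → ℝ := fun p => v p.2 ((insert A p.1).biUnion id)
  have hne : (Q.powersetCard n0 ×ˢ Z).Nonempty :=
    (powersetCard_nonempty.2 hc.le).product hZ
  obtain ⟨p0, hp0, hmax0⟩ := exists_max_image (Q.powersetCard n0 ×ˢ Z) g hne
  obtain ⟨⟨Y, z⟩, hp1, hmax1⟩ := exists_max_image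
    ((Q.powersetCard n0 ×ˢ Z).filter fun p => g p0 ≤ g p)
    (fun p => (p.1.filter fun l => cl l = p.2).card) ⟨p0, mem_filter.2 ⟨hp0, le_rfl⟩⟩
  obtain ⟨hp1, hg1⟩ := mem_filter.1 hp1
  obtain ⟨hY, hz⟩ := mem_product.1 hp1
  simp only at hY hz
  obtain ⟨hYQ, hYc⟩ := mem_powersetCard.1 hY
  refine ⟨Y, hYQ, z, hz, hYc.le, ?_, ?_⟩
  · intro z' hz'
    exact (hmax0 (Y, z') (mem_product.2 ⟨hY, hz'⟩)).trans hg1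
  · intro l hl hlz
    by_contra hlY
    have hex : ∃ l' ∈ Y, cl l' ≠ z ∧ v z l' ≤ v z l := by
      by_contra hcon
      push Not at hcon
      have h1 : ∀ l' ∈ Y, ρ ≤ v z l' := by
        intro l' hl'
        by_cases hc' : cl l' = z
        · rw [← hc']; exact hcl l' (hYQ hl')
        · have := hcon l' hl' hc'
          have h2 := hcl l hl
          rw [hlz] at h2
          linarith
      have h2 := card_nsmul_le_sum Y (v z) ρ h1
      have h3 : ∑ l ∈ Y, v z l ≤ ∑ l ∈ Q, v z l :=
        sum_le_sum_of_subset_of_nonneg hYQ fun l _ _ => (hv z).nonneg l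
      have h4 := hsum z hz
      have h5 := hn0 z hz
      rw [hYc, nsmul_eq_mul] at h2
      linarith
    obtain ⟨l', hl', hcl', hvl⟩ := hex
    set Y' := insert l (Y.erase l') with hY'
    have hlE : l ∉ Y.erase l' := fun h => hlY (mem_of_mem_erase h)
    have hY'Q : Y' ⊆ Q := insert_subset hl ((erase_subset _ _).trans hYQ)
    have hY'c : Y'.card = n0 := by
      rw [hY', card_insert_of_notMem hlE, card_erase_of_mem hl', hYc]
      have := card_pos.2 ⟨l', hl'⟩
      omega
    have hval : g (Y, z) ≤ g (Y', z) := by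
      show v z ((insert A Y).biUnion id) ≤ v z ((insert A Y').biUnion id)
      rw [(hv z).biUnion _ (hQ.sub (insert_subset_insert _ hYQ)),
        (hv z).biUnion _ (hQ.sub (insert_subset_insert _ hY'Q)),
        sum_insert (fun h => hA (hYQ h)), sum_insert (fun h => hA (hY'Q h)),
        hY', sum_insert hlE, ← add_sum_erase Y (v z) hl']
      apply min_le_min _ le_rfl
      linarith
    have h1 := hmax1 (Y', z) (mem_filter.2 ⟨mem_product.2
      ⟨mem_powersetCard.2 ⟨hY'Q, hY'c⟩, hz⟩, hg1.trans hval⟩)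
    have h2 : (Y'.filter fun l => cl l = z) = insert l (Y.filter fun l => cl l = z) := by
      rw [hY', filter_insert, if_pos hlz]
      congr 1
      ext b
      simp only [mem_filter, mem_erase]
      constructor
      · rintro ⟨⟨_, h⟩, h'⟩; exact ⟨h, h'⟩
      · rintro ⟨h, h'⟩
        exact ⟨⟨fun e => hcl' (e ▸ h'), h⟩, h'⟩
    simp only [h2] at h1
    rw [card_insert_of_notMem (fun h => hlY (mem_filter.1 h).1)] at h1
    omega

theorem EpsCBE.mono {n m : ℕ} {v : Fin n → Finset (Fin m) → ℝ} {ε W W' : ℝ}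
    (h : EpsCBE v ε W) (hW : W' ≤ W) : EpsCBE v ε W' := by
  obtain ⟨b, p, a, h1, h2, h3, h4⟩ := h
  exact ⟨b, p, a, h1, h2, h3, hW.trans h4⟩

theorem exists_claim {n m : ℕ} (v : Fin n → Finset (Fin m) → ℝ) (Z : Finset (Fin n))
    (i0 : Fin n) : ∃ cl : Finset (Fin m) → Fin n,
      ∀ B, 0 < FZ v Z B → cl B ∈ Z ∧ FZ v Z B = v (cl B) B := by
  have : ∀ B, ∃ c : Fin n, 0 < FZ v Z B → c ∈ Z ∧ FZ v Z B = v c B := by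
    intro B
    by_cases h : 0 < FZ v Z B
    · obtain ⟨z, hz, he⟩ := FZ_att h
      exact ⟨z, fun _ => ⟨hz, he⟩⟩
    · exact ⟨i0, fun h' => absurd h' h⟩
  choose cl hcl using this
  exact ⟨cl, hcl⟩

section stage3
variable {n m : ℕ} {v : Fin n → Finset (Fin m) → ℝ} {Z : Finset (Fin n)} {P ρ : ℝ}
    {X : Finset (Fin m)} {x0 : Fin m} {mk : Finset (Fin m) → Fin m} {N : ℕ} {ε : ℝ}
    {R R' : Finset (Finset (Fin m))} {s : St n m}

theorem claims_sum (hv : ∀ i, CapAdd (v i)) (hPD : PD R) {z : Fin n}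
    (hsum : ∑ l ∈ R, v z l ≤ v z univ) {S : Finset (Finset (Fin m))} (hS : S ⊆ R)
    {price : Finset (Fin m) → ℝ} (hpr : ∀ B ∈ S, price B = v z B) :
    v z (S.biUnion id) = ∑ B ∈ S, price B := by
  rw [(hv z).biUnion S (hPD.sub hS), sum_congr rfl hpr]
  apply min_eq_left
  exact (sum_le_sum_of_subset_of_nonneg hS fun l _ _ => (hv z).nonneg l).trans hsum

theorem stage3 (hv : ∀ i, CapAdd (v i)) (hρ : 0 < ρ) (hε : 0 < ε) (i0 : Fin n)
    {top2 : Finset (Fin m)} (hx : x0 ∈ top2) (hR'R : R' ⊆ R) (hPD : PD R)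
    (hmk : ∀ l ∈ R, ∀ l' ∈ R, mk l ∈ l' → l = l')
    (hcap : ∀ i, i ∉ Z → v i X = v i univ ∨ v i univ ≤ P)
    (hsum : ∀ z ∈ Z, ∑ l ∈ R, v z l ≤ v z univ) {n0 : ℕ} (hn0 : ∀ z, v z univ < ρ * n0)
    (h : Inv v Z P ρ X x0 mk N ε R' (insert top2 (R.filter fun l => ρ ≤ FZ v Z l)) (FZ v Z) s)
    (ht : Term v Z ε s) :
    EpsCBE v ε (ρ * ((R'.card : ℝ) - n0)) := by
  classical
  obtain ⟨cl, hcl⟩ := exists_claim v Z i0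
  have hlump : ∀ B ∈ s.bundles, s.hold B = none → B ≠ top2 →
      B ∈ R ∧ ρ ≤ FZ v Z B ∧ s.price B = FZ v Z B := by
    intro B hB hh hne
    obtain ⟨h1, h2⟩ := h.unheld B hB hh
    have h3 := mem_filter.1 ((mem_insert.1 h1).resolve_left hne)
    exact ⟨h3.1, h3.2, h2⟩
  have hmono : ρ * ((R'.card : ℝ) - n0) ≤ ρ * (R'.card : ℝ) := by
    apply mul_le_mul_of_nonneg_left _ hρ.le
    have : (0 : ℝ) ≤ n0 := Nat.cast_nonneg _
    linarith
  by_cases htop : top2 ∈ s.bundles ∧ s.hold top2 = none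
  swap
  · refine (assemble hv hρ.le hε h ht cl ?_ ?_).mono hmono
    · intro B hB hh
      left
      have hne : B ≠ top2 := by rintro rfl; exact htop ⟨hB, hh⟩
      exact (hcl B (hρ.trans_le (hlump B hB hh hne).2.1)).1
    · intro z hz
      have hmem : ∀ B ∈ s.bundles.filter fun B => s.hold B = none ∧ cl B = z,
          B ∈ R ∧ s.price B = v z B := by
        intro B hB
        obtain ⟨hB, hh, hc⟩ := mem_filter.1 hB
        have hne : B ≠ top2 := by rintro rfl; exact htop ⟨hB, hh⟩
        have h1 := hlump B hB hh hne
        refine ⟨h1.1, ?_⟩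
        rw [h1.2.2, (hcl B (hρ.trans_le h1.2.1)).2, hc]
      exact claims_sum hv hPD (hsum z hz) (fun B hB => (hmem B hB).1) (fun B hB => (hmem B hB).2)
  obtain ⟨htb, hth⟩ := htop
  rcases Z.eq_empty_or_nonempty with hZ | hZ
  · refine (assemble hv hρ.le hε h ht cl ?_ ?_).mono hmono
    · intro B hB hh
      right
      rw [(h.unheld B hB hh).2]
      exact le_antisymm (FZ_le le_rfl (by simp [hZ])) (FZ_nonneg _)
    · intro z hz
      simp [hZ] at hz
  set Q := s.bundles.filter fun B => s.hold B = none ∧ B ≠ top2 with hQ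
  have hQl : ∀ B ∈ Q, B ∈ R ∧ ρ ≤ FZ v Z B ∧ s.price B = FZ v Z B := by
    intro B hB
    obtain ⟨h1, h2, h3⟩ := mem_filter.1 hB
    exact hlump B h1 h2 h3
  have hQb : Q ⊆ s.bundles := filter_subset _ _
  obtain ⟨Y, hYQ, z, hz, hYc, hmax, hall⟩ := yLemma (ρ := ρ) (n0 := n0) hv hZ (Q := Q) (A := top2)
    (by simp [hQ]) (h.part.pd.sub (insert_subset htb hQb)) cl
    (fun l hl => by
      have := (hQl l hl).2.1
      rw [(hcl l (hρ.trans_le this)).2] at this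
      exact this)
    (fun z hz => (sum_le_sum_of_subset_of_nonneg (fun B hB => (hQl B hB).1)
      fun l _ _ => (hv z).nonneg l).trans (hsum z hz)) (fun z _ => hn0 z)
  have hT : insert top2 Y ⊆ s.bundles := insert_subset htb (hYQ.trans hQb)
  set top3 := (insert top2 Y).biUnion id with htop3
  have hpt : s.price top2 ≤ FZ v Z top3 := by
    rw [(h.unheld top2 htb hth).2]
    exact FZ_mono hv (subset_biUnion_of_mem id (mem_insert_self top2 Y))
  have hYne : ∀ B ∈ insert top2 Y, B ≠ top2 → B ∈ Y := fun B hB hne =>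
    (mem_insert.1 hB).resolve_left hne
  have hinv : Inv v Z P ρ X x0 mk N ε (R' \ Y)
      (insert top3 (R.filter fun l => ρ ≤ FZ v Z l)) (FZ v Z)
      (s.merge (insert top2 Y) (FZ v Z top3) none) := by
    refine dump_inv hv hρ.le hε h hcap hT (mem_insert_self _ _) hx hpt le_rfl sdiff_subset
      ?_ (by simp) ?_ ?_
    · intro l hl B hB hne hm
      have hBY := hYne B hB hne
      have := hmk l (hR'R (mem_sdiff.1 hl).1) B (hQl B (hYQ hBY)).1 hm
      exact (mem_sdiff.1 hl).2 (this ▸ hBY)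
    · intro _
      exact ⟨mem_insert_self _ _, rfl⟩
    · intro B hB hBT hh
      have h1 := hlump B hB hh (fun e => hBT (e ▸ mem_insert_self _ _))
      exact ⟨mem_insert_of_mem (mem_filter.2 ⟨h1.1, h1.2.1⟩), h1.2.2⟩
  have hterm : Term v Z ε (s.merge (insert top2 Y) (FZ v Z top3) none) := by
    refine dump_term hv hρ.le hε h hcap hT (mem_insert_self _ _) hx hpt hth ?_ ht
    intro B hB hne
    exact (mem_filter.1 (hYQ (hYne B hB hne))).2.1
  have hvz : v z top3 = FZ v Z top3 :=
    le_antisymm (le_FZ hz _) (FZ_le ((hv z).nonneg _) hmax)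
  have hold : ∀ B ∈ (s.merge (insert top2 Y) (FZ v Z top3) none).bundles,
      (s.merge (insert top2 Y) (FZ v Z top3) none).hold B = none → B ≠ top3 →
      B ∈ Q ∧ B ∉ Y ∧ (s.merge (insert top2 Y) (FZ v Z top3) none).price B = FZ v Z B := by
    intro B hB hh hne
    have hB' := mem_sdiff.1 ((mem_insert.1 hB).resolve_left hne)
    have hne2 : B ≠ top2 := fun e => hB'.2 (e ▸ mem_insert_self _ _)
    rw [merge_hold_old hne] at hh
    rw [merge_price_old hne]
    have hBQ : B ∈ Q := mem_filter.2 ⟨hB'.1, hh, hne2⟩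
    exact ⟨hBQ, fun hY => hB'.2 (mem_insert_of_mem hY), (hQl B hBQ).2.2⟩
  refine (assemble hv hρ.le hε hinv hterm (Function.update cl top3 z) ?_ ?_).mono ?_
  · intro B hB hh
    left
    by_cases hne : B = top3
    · rw [hne]; simpa using hz
    · rw [Function.update_of_ne hne]
      exact (hcl B (hρ.trans_le (hQl B (hold B hB hh hne).1).2.1)).1
  · intro z' hz'
    by_cases hzz : z' = z
    · subst hzz
      have : ((s.merge (insert top2 Y) (FZ v Z top3) none).bundles.filter fun B =>
          (s.merge (insert top2 Y) (FZ v Z top3) none).hold B = none ∧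
            Function.update cl top3 z' B = z') = {top3} := by
        ext B
        rw [mem_filter, mem_singleton]
        constructor
        · rintro ⟨hB, hh, hc⟩
          by_contra hne
          rw [Function.update_of_ne hne] at hc
          have h1 := hold B hB hh hne
          exact h1.2.1 (hall B h1.1 hc)
        · rintro rfl
          exact ⟨mem_insert_self _ _, merge_hold_new _ _, by simp⟩
      rw [this, sum_singleton, singleton_biUnion, merge_price_new]
      exact hvz
    · have hmem : ∀ B ∈ (s.merge (insert top2 Y) (FZ v Z top3) none).bundles.filter fun B =>
          (s.merge (insert top2 Y) (FZ v Z top3) none).hold B = none ∧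
            Function.update cl top3 z B = z', B ∈ R ∧
            (s.merge (insert top2 Y) (FZ v Z top3) none).price B = v z' B := by
        intro B hB
        obtain ⟨hB, hh, hc⟩ := mem_filter.1 hB
        have hne : B ≠ top3 := by
          intro e
          rw [e, Function.update_self] at hc
          exact hzz hc.symm
        rw [Function.update_of_ne hne] at hc
        have h1 := hold B hB hh hne
        have h2 := hQl B h1.1
        refine ⟨h2.1, ?_⟩
        rw [h1.2.2, (hcl B (hρ.trans_le h2.2.1)).2, hc]
      exact claims_sum hv hPD (hsum z' hz') (fun B hB => (hmem B hB).1)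
        (fun B hB => (hmem B hB).2)
  · apply mul_le_mul_of_nonneg_left _ hρ.le
    have h1 := le_card_sdiff Y R'
    have h2 : R'.card ≤ (R' \ Y).card + n0 := by omega
    have h3 : (R'.card : ℝ) ≤ (R' \ Y).card + n0 := by exact_mod_cast h2
    linarith
end stage3

theorem stage12 {n m : ℕ} {v : Fin n → Finset (Fin m) → ℝ} (hv : ∀ i, CapAdd (v i))
    {L R : Finset (Finset (Fin m))} (hL : Part L) (hRL : R ⊆ L) (hLR : (L \ R).Nonempty)
    {o : Finset (Fin m) → Fin n} (ho : ∀ l ∈ L, ∀ l' ∈ L, o l = o l' → l = l')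
    {ρ ε : ℝ} (hρ : 0 < ρ) (hε : 0 < ε) (hερ : ε < ρ)
    (hval : ∀ l ∈ L, 2 * ρ ≤ v (o l) l) {Z : Finset (Fin n)} {P : ℝ} {X : Finset (Fin m)}
    (hX : X = (L \ R).biUnion id) {x0 : Fin m} (hx0 : x0 ∈ X) {mk : Finset (Fin m) → Fin m}
    (hmk : ∀ l ∈ L, mk l ∈ l)
    (hcap : ∀ i, i ∉ Z → v i X = v i univ ∨ v i univ ≤ P) (hP : P ≤ FZ v Z X) :
    ∃ R' ⊆ R, ∃ top2, x0 ∈ top2 ∧ 2 * R.card ≤ 2 * R'.card + R.card + 1 ∧ ∃ s,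
      Inv v Z P ρ X x0 mk (R.card + 1) ε R' (insert top2 (R.filter fun l => ρ ≤ FZ v Z l))
        (FZ v Z) s ∧ Term v Z ε s := by
  classical
  let s00 : St n m := ⟨L, fun B => max ρ (FZ v Z B), fun _ => none⟩
  let s0 := s00.merge (L \ R) (FZ v Z X) none
  have hp00 : Part s00.bundles := hL
  have hsub00 : L \ R ⊆ s00.bundles := sdiff_subset
  have hb0 : s0.bundles = insert X R := by
    show insert ((L \ R).biUnion id) (L \ (L \ R)) = _
    rw [Finset.sdiff_sdiff_eq_self hRL, hX]
  have hXR : X ∉ R := by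
    have := un_notMem hp00 hsub00
    show X ∉ R
    rw [hX]
    change (L \ R).biUnion id ∉ L \ (L \ R) at this
    rwa [Finset.sdiff_sdiff_eq_self hRL] at this
  have hpX : s0.price X = FZ v Z X := by
    show (s00.merge (L \ R) (FZ v Z X) none).price X = _
    rw [hX]; exact merge_price_new _ _
  have hpR : ∀ l, l ≠ X → s0.price l = max ρ (FZ v Z l) := by
    intro l hl
    exact merge_price_old (s := s00) (hX ▸ hl)
  have hh0 : ∀ B, s0.hold B = none := by
    intro B
    show Function.update s00.hold _ none B = none
    by_cases hB : B = (L \ R).biUnion id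
    · rw [hB]; simp
    · rw [Function.update_of_ne hB]
  have hdX : ∀ l ∈ R, ∀ x ∈ l, x ∉ X := by
    intro l hl x hx hxX
    rw [hX, mem_biUnion] at hxX
    obtain ⟨l', hl', hx'⟩ := hxX
    obtain ⟨h1, h2⟩ := mem_sdiff.1 hl'
    exact disjoint_left.1 (hL.pd l (hRL hl) l' h1 (fun e => h2 (e ▸ hl))) hx hx'
  have hmkl : ∀ l ∈ R, ∀ l' ∈ R, mk l ∈ l' → l = l' := by
    intro l hl l' hl' hm
    by_contra hne
    exact disjoint_left.1 (hL.pd l (hRL hl) l' (hRL hl') hne) (hmk l (hRL hl)) hm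
  have hinv0 : Inv v Z P ρ X x0 mk (R.card + 1) ε R (insert X R) s0.price s0 := by
    refine ⟨merge_part hp00 hsub00 hLR _ _, ?_, ?_, ?_, ?_, ?_, ?_, ?_⟩
    · intro B hB z hz
      by_cases hBX : B = X
      · rw [hBX, hpX]; exact le_FZ hz _
      · rw [hpR B hBX]; exact (le_FZ hz _).trans (le_max_right _ _)
    · intro B hB
      by_cases hBX : B = X
      · have : (R.filter fun l => mk l ∈ B) = ∅ := by
          apply filter_eq_empty_iff.2
          intro l hl
          rw [hBX]
          exact hdX l hl _ (hmk l (hRL hl))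
        rw [this, hBX, hpX]
        simpa using FZ_nonneg _
      · rw [hpR B hBX]
        rw [hb0] at hB
        have hBR := (mem_insert.1 hB).resolve_left hBX
        have : (R.filter fun l => mk l ∈ B) ⊆ {B} := by
          intro l hl
          obtain ⟨h1, h2⟩ := mem_filter.1 hl
          exact mem_singleton.2 (hmkl l h1 B hBR h2)
        have h1 : (((R.filter fun l => mk l ∈ B).card : ℕ) : ℝ) ≤ 1 := by
          exact_mod_cast (card_le_card this)
        refine le_trans ?_ (le_max_left _ _)
        nlinarith
    · intro B hB hxB
      by_cases hBX : B = X
      · rw [hBX, hpX]; exact ⟨Subset.rfl, hP⟩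
      · rw [hb0] at hB
        have hBR := (mem_insert.1 hB).resolve_left hBX
        exact absurd hx0 (hdX B hBR _ hxB)
    · intro B hB _
      rw [hb0] at hB
      exact ⟨hB, rfl⟩
    · intro B _ i hi
      rw [hh0 B] at hi; exact absurd hi (by simp)
    · intro B _ _ _ i hi
      rw [hh0 B] at hi; exact absurd hi (by simp)
    · rw [hb0]; exact card_insert_le _ _
  obtain ⟨s1, h1, ht1⟩ := run hv hρ.le hε hinv0
  obtain ⟨tp, htp, hxtp⟩ := h1.part.cover x0
  set U := R.filter fun l => l ∈ s1.bundles ∧ s1.hold l = none ∧ FZ v Z l < ρ with hU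
  have hUR : U ⊆ R := filter_subset _ _
  have hUb : U ⊆ s1.bundles := fun l hl => (mem_filter.1 hl).2.1
  have hneX : ∀ l ∈ R, l ≠ X := fun l hl e => hXR (e ▸ hl)
  -- counting
  have hcount : 2 * U.card ≤ R.card + 1 := by
    have hex : ∀ l ∈ U, ∃ B ∈ s1.bundles, s1.hold B = some (o l) := by
      intro l hl
      obtain ⟨hlR, hlb, hlh, hlF⟩ := mem_filter.1 hl
      by_contra hcon
      push Not at hcon
      have h2 := hval l (hRL hlR)
      have hoZ : o l ∉ Z := by
        intro hz
        have := le_FZ (v := v) hz l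
        linarith
      have h3 := ht1 (o l) hoZ hcon {l} (by simpa using hlb)
      have h4 := (h1.unheld l hlb hlh).2
      rw [hpR l (hneX l hlR), max_eq_left hlF.le] at h4
      simp only [singleton_biUnion, sum_singleton, id] at h3
      linarith
    choose! φ hφ1 hφ2 using hex
    have hle : U.card ≤ (s1.bundles.filter fun B => ¬ s1.hold B = none).card := by
      apply card_le_card_of_injOn φ
      · intro l hl
        have hl : l ∈ U := hl
        apply mem_coe.2
        rw [mem_filter]
        exact ⟨hφ1 l hl, by rw [hφ2 l hl]; simp⟩
      · intro l hl l' hl' he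
        have e1 := hφ2 l hl
        have e2 := hφ2 l' hl'
        have he : φ l = φ l' := he
        rw [he, e2] at e1
        have e3 : o l' = o l := by simpa using e1
        exact (ho l' (hRL (hUR hl')) l (hRL (hUR hl)) e3).symm
    have hle2 : U.card ≤ (s1.bundles.filter fun B => s1.hold B = none).card := by
      apply card_le_card
      intro l hl
      exact mem_filter.2 ⟨hUb hl, (mem_filter.1 hl).2.2.1⟩
    have h3 := card_filter_add_card_filter_not (s := s1.bundles) (fun B => s1.hold B = none)
    have h4 := h1.card
    omega
  have hcardR : (R \ U).card + U.card = R.card := card_sdiff_add_card_eq_card hUR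
  have hT : insert tp U ⊆ s1.bundles := insert_subset htp hUb
  set top2 := (insert tp U).biUnion id with htop2
  have hsub2 : tp ⊆ top2 := subset_biUnion_of_mem id (mem_insert_self tp U)
  refine ⟨R \ U, sdiff_subset, top2, hsub2 hxtp, by omega, ?_⟩
  have hR' : ∀ l ∈ R \ U, ∀ B ∈ insert tp U, B ≠ tp → mk l ∉ B := by
    intro l hl B hB hne hm
    obtain ⟨hl1, hl2⟩ := mem_sdiff.1 hl
    have hBU := (mem_insert.1 hB).resolve_left hne
    exact hl2 ((hmkl l hl1 B (hUR hBU) hm) ▸ hBU)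
  have huniq : X ∈ s1.bundles → X = tp := by
    intro hXb
    by_contra hne
    exact disjoint_left.1 (h1.part.pd X hXb tp htp hne) hx0 hxtp
  have hold : ∀ B ∈ s1.bundles, B ∉ insert tp U → s1.hold B = none →
      B ∈ insert top2 (R.filter fun l => ρ ≤ FZ v Z l) ∧ s1.price B = FZ v Z B := by
    intro B hB hBT hh
    obtain ⟨h2, h3⟩ := h1.unheld B hB hh
    have hBX : B ≠ X := by
      rintro rfl
      exact hBT (by rw [← huniq hB]; exact mem_insert_self _ _)
    have hBR := (mem_insert.1 h2).resolve_left hBX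
    have hge : ρ ≤ FZ v Z B := by
      by_contra hlt
      exact hBT (mem_insert_of_mem (mem_filter.2 ⟨hBR, hB, hh, not_le.1 hlt⟩))
    refine ⟨mem_insert_of_mem (mem_filter.2 ⟨hBR, hge⟩), ?_⟩
    rw [h3, hpR B hBX, max_eq_right hge]
  by_cases hcase : ∃ h, s1.hold tp = some h ∧ FZ v Z top2 ≤ s1.price tp
  · obtain ⟨h, hh, hle⟩ := hcase
    refine ⟨s1.merge (insert tp U) (s1.price tp) (some h), ?_, ?_⟩
    · refine dump_inv hv hρ.le hε h1 hcap hT (mem_insert_self _ _) hxtp le_rfl hle sdiff_subset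
        hR' ?_ (by simp) hold
      intro i hi
      exact ⟨hh.trans hi, rfl⟩
    · refine dump_term hv hρ.le hε h1 hcap hT (mem_insert_self _ _) hxtp le_rfl hh ?_ ht1
      intro B hB hne
      exact (mem_filter.1 ((mem_insert.1 hB).resolve_left hne)).2.2.1
  · have hle : s1.price tp ≤ FZ v Z top2 := by
      rcases hh : s1.hold tp with _ | h
      · obtain ⟨h2, h3⟩ := h1.unheld tp htp hh
        have htX : tp = X := by
          rcases mem_insert.1 h2 with h4 | h4
          · exact h4
          · exact absurd hx0 (hdX tp h4 _ hxtp)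
        rw [h3]
        conv_lhs => rw [htX, hpX]
        exact FZ_mono hv (htX ▸ hsub2)
      · by_contra hcon
        exact hcase ⟨h, hh, (not_le.1 hcon).le⟩
    have hinv2 : Inv v Z P ρ X x0 mk (R.card + 1) ε (R \ U)
        (insert top2 (R.filter fun l => ρ ≤ FZ v Z l)) (FZ v Z)
        (s1.merge (insert tp U) (FZ v Z top2) none) := by
      refine dump_inv hv hρ.le hε h1 hcap hT (mem_insert_self _ _) hxtp hle le_rfl sdiff_subset
        hR' (by simp) ?_ hold
      intro _
      exact ⟨mem_insert_self _ _, rfl⟩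
    exact run hv hρ.le hε hinv2

theorem core {n m : ℕ} {v : Fin n → Finset (Fin m) → ℝ} (hv : ∀ i, CapAdd (v i))
    {L : Finset (Finset (Fin m))} (hL : Part L)
    {o : Finset (Fin m) → Fin n} (ho : ∀ l ∈ L, ∀ l' ∈ L, o l = o l' → l = l')
    {p β ε : ℝ} (hp : 0 < p) (hε : 0 < ε) (hεp : ε < p / 2)
    (hval : ∀ l ∈ L, p ≤ v (o l) l) (hβ : ∀ i, v i univ ≤ β) (hβ0 : 0 ≤ β)
    (hk : β < L.card * p / 100) : EpsCBE v ε (L.card * p / 16) := by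
  classical
  have hkpos : 0 < L.card := by
    rcases Nat.eq_zero_or_pos L.card with h | h
    · rw [h] at hk; simp at hk; linarith
    · exact h
  obtain ⟨l0, hl0⟩ := card_pos.1 hkpos
  have hk100 : (100 : ℝ) < L.card := by
    have h1 := hval l0 hl0
    have h2 := (hv (o l0)).le_univ l0
    have h3 := hβ (o l0)
    have h4 : p * 100 < p * L.card := by linarith
    exact lt_of_mul_lt_mul_left h4 hp.le
  set q := L.card / 2 with hq
  obtain ⟨R, hRL, hRc, Z, P, hcap, hsum, hP⟩ := selection hv hL.pd (q := q) (by omega)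
  have hLR : (L \ R).Nonempty := by
    rw [← card_pos]
    have := card_sdiff_add_card_eq_card hRL
    omega
  obtain ⟨l1, hl1⟩ := hLR
  obtain ⟨x0, hx0⟩ := hL.ne l1 (mem_sdiff.1 hl1).1
  have hx0X : x0 ∈ (L \ R).biUnion id := mem_biUnion.2 ⟨l1, hl1, hx0⟩
  have hmk : ∀ l, ∃ x : Fin m, l ∈ L → x ∈ l := by
    intro l
    by_cases hl : l ∈ L
    · obtain ⟨x, hx⟩ := hL.ne l hl
      exact ⟨x, fun _ => hx⟩
    · exact ⟨x0, fun h => absurd h hl⟩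
  choose mk hmk using hmk
  obtain ⟨R', hR'R, top2, hxt, hcard, s, hinv, hterm⟩ := stage12 (ρ := p / 2) (mk := mk) hv hL hRL
    ⟨l1, hl1⟩ ho (by linarith) hε hεp (fun l hl => by have := hval l hl; linarith) rfl hx0X hmk
    hcap hP
  have hmkl : ∀ l ∈ R, ∀ l' ∈ R, mk l ∈ l' → l = l' := by
    intro l hl l' hl' hm
    by_contra hne
    exact disjoint_left.1 (hL.pd l (hRL hl) l' (hRL hl') hne) (hmk l (hRL hl)) hm
  have hn0 : ∀ z, v z univ < p / 2 * ((⌊β / (p / 2)⌋₊ + 1 : ℕ) : ℝ) := by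
    intro z
    have h1 := Nat.lt_floor_add_one (β / (p / 2))
    rw [div_lt_iff₀ (by linarith)] at h1
    push_cast
    have := hβ z
    linarith
  refine (stage3 hv (by linarith) hε (o l0) hxt hR'R (hL.pd.sub hRL) hmkl hcap hsum hn0 hinv
    hterm).mono ?_
  have hfl : (⌊β / (p / 2)⌋₊ : ℝ) ≤ L.card / 50 := by
    refine (Nat.floor_le (by positivity)).trans ?_
    rw [div_le_iff₀ (by linarith)]
    linarith
  have h1 : (R.card : ℝ) ≤ 2 * R'.card + 1 := by
    have : R.card ≤ 2 * R'.card + 1 := by omega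
    exact_mod_cast this
  have h2 : (L.card : ℝ) ≤ 2 * R.card + 1 := by
    have : L.card ≤ 2 * R.card + 1 := by omega
    exact_mod_cast this
  push_cast
  have h3 : (L.card : ℝ) / 8 ≤ R'.card - (⌊β / (p / 2)⌋₊ + 1) := by linarith
  nlinarith

theorem limitCBE {n m : ℕ} (Mk : Market n m) {W ε0 : ℝ} (hε0 : 0 < ε0)
    (h : ∀ ε, 0 < ε → ε < ε0 → EpsCBE Mk.v ε W) : ∃ E : CBE Mk, W ≤ E.welfare := by
  classical
  have hnn : ∀ i S, 0 ≤ Mk.v i S := fun i S => by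
    rw [← Mk.v_empty i]; exact Mk.v_mono i _ _ (empty_subset _)
  set K : ℝ := ∑ i, Mk.v i univ + ε0 with hK
  have hKi : ∀ i, Mk.v i univ + ε0 ≤ K := by
    intro i
    have := single_le_sum (f := fun i => Mk.v i univ) (fun i _ => hnn i _) (mem_univ i)
    linarith
  -- feasible price vectors
  let Kf : Finset (Finset (Fin m)) → (Finset (Fin m) → Fin n) → ℝ → Set (Finset (Fin m) → ℝ) :=
    fun bs as ε => {p | p ∈ Set.Icc (fun _ => (0 : ℝ)) (fun _ => K) ∧
      ∀ i, ∀ T, T ⊆ bs → Mk.v i (T.biUnion id) - ∑ b ∈ T, p b ≤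
        Mk.v i ((bs.filter fun b => as b = i).biUnion id)
          - ∑ b ∈ bs.filter fun b => as b = i, p b + ε}
  have hmono : ∀ bs as ε ε', ε ≤ ε' → Kf bs as ε ⊆ Kf bs as ε' := by
    intro bs as ε ε' he p hp
    refine ⟨hp.1, fun i T hT => ?_⟩
    have := hp.2 i T hT
    linarith
  have hclosed : ∀ bs as ε, IsClosed (Kf bs as ε) := by
    intro bs as ε
    apply IsClosed.and
    · exact isClosed_Icc
    · simp only [Set.ofPred_forall]
      refine isClosed_iInter fun i => isClosed_iInter fun T => isClosed_iInter fun _ => ?_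
      exact isClosed_le (by fun_prop) (by fun_prop)
  let e : ℕ → ℝ := fun j => ε0 / (j + 2)
  have he0 : ∀ j, 0 < e j := fun j => by positivity
  have he1 : ∀ j, e j < ε0 := fun j => by
    show ε0 / (j + 2) < ε0
    rw [div_lt_iff₀ (by positivity)]
    have : (0 : ℝ) ≤ j := Nat.cast_nonneg _
    nlinarith
  have hemono : ∀ j j', j ≤ j' → e j' ≤ e j := fun j j' hj => by
    show ε0 / (j' + 2) ≤ ε0 / (j + 2)
    have : (j : ℝ) ≤ j' := by exact_mod_cast hj
    gcongr
  have hex : ∃ (bs : Finset (Finset (Fin m))) (as : Finset (Fin m) → Fin n), Part bs ∧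
      W ≤ ∑ i, Mk.v i ((bs.filter fun b => as b = i).biUnion id) ∧
      ∀ j, (Kf bs as (e j)).Nonempty := by
    by_contra hcon
    push Not at hcon
    have : ∀ c : Finset (Finset (Fin m)) × (Finset (Fin m) → Fin n), ∃ j, Part c.1 →
        W ≤ ∑ i, Mk.v i ((c.1.filter fun b => c.2 b = i).biUnion id) →
        Kf c.1 c.2 (e j) = ∅ := by
      intro c
      by_cases hc : Part c.1 ∧ W ≤ ∑ i, Mk.v i ((c.1.filter fun b => c.2 b = i).biUnion id)
      · obtain ⟨j, hj⟩ := hcon c.1 c.2 hc.1 hc.2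
        exact ⟨j, fun _ _ => hj⟩
      · exact ⟨0, fun h1 h2 => absurd ⟨h1, h2⟩ hc⟩
    choose jf hjf using this
    obtain ⟨bs, pr, as, h1, h2, h3, h4⟩ := h (e (univ.sup jf)) (he0 _) (he1 _)
    have hem := hjf (bs, as) h1 h4
    have hle : jf (bs, as) ≤ univ.sup jf := le_sup (mem_univ _)
    have hin : (fun b => if b ∈ bs then pr b else 0) ∈ Kf bs as (e (univ.sup jf)) := by
      have hs : ∀ T ⊆ bs, ∑ b ∈ T, (if b ∈ bs then pr b else 0) = ∑ b ∈ T, pr b :=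
        fun T hT => sum_congr rfl fun b hb => if_pos (hT hb)
      refine ⟨⟨?_, ?_⟩, ?_⟩
      · intro b
        show (0 : ℝ) ≤ if b ∈ bs then pr b else 0
        split_ifs with hb
        · exact h2 b hb
        · exact le_rfl
      · intro b
        show (if b ∈ bs then pr b else 0) ≤ K
        split_ifs with hb
        · have h5 := h3 (as b) ∅ (empty_subset _)
          have h6 : pr b ≤ ∑ b' ∈ bs.filter fun b' => as b' = as b, pr b' :=
            single_le_sum (f := pr) (fun b' hb' => h2 b' (mem_filter.1 hb').1)
              (mem_filter.2 ⟨hb, rfl⟩)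
          have h7 := Mk.v_mono (as b) _ _
            (subset_univ ((bs.filter fun b' => as b' = as b).biUnion id))
          have h8 := hKi (as b)
          have h9 := he1 (univ.sup jf)
          simp [Mk.v_empty] at h5
          linarith
        · have := sum_nonneg (s := univ) fun i _ => hnn i univ
          linarith
      · intro i T hT
        simp only
        rw [hs T hT, hs _ (filter_subset _ _)]
        exact h3 i T hT
    have := hmono bs as _ _ (hemono _ _ hle) hin
    rw [hem] at this
    exact this
  obtain ⟨bs, as, hpart, hW, hne⟩ := hex
  obtain ⟨p, hp⟩ := IsCompact.nonempty_iInter_of_sequence_nonempty_isCompact_isClosed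
    (fun j => Kf bs as (e j)) (fun j => hmono _ _ _ _ (hemono _ _ (Nat.le_succ j))) hne
    (isCompact_Icc.of_isClosed_subset (hclosed _ _ _) (fun p hp => hp.1)) (fun j => hclosed _ _ _)
  rw [Set.mem_iInter] at hp
  refine ⟨⟨bs, p, as, hpart.ne, hpart.pd, ?_, fun b _ => (hp 0).1.1 b, ?_⟩, hW⟩
  · ext x
    obtain ⟨b, hb, hx⟩ := hpart.cover x
    simp only [mem_biUnion, mem_univ, iff_true]
    exact ⟨b, hb, hx⟩
  · intro i T hT
    apply le_of_forall_pos_le_add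
    intro δ hδ
    obtain ⟨j, hj⟩ := exists_nat_gt (ε0 / δ)
    have h1 := (hp j).2 i T hT
    have h2 : e j ≤ δ := by
      show ε0 / (j + 2) ≤ δ
      rw [div_le_iff₀ (by positivity)]
      rw [div_lt_iff₀ hδ] at hj
      nlinarith
    linarith

theorem grand {n m : ℕ} (Mk : Market n m) (hm : 1 ≤ m) (i0 : Fin n)
    (hmax : ∀ i, Mk.v i univ ≤ Mk.v i0 univ) : ∃ E : CBE Mk, Mk.v i0 univ ≤ E.welfare := by
  have hnn : ∀ i S, 0 ≤ Mk.v i S := fun i S => by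
    rw [← Mk.v_empty i]; exact Mk.v_mono i _ _ (empty_subset _)
  have hfe : ∀ i, (({univ} : Finset (Finset (Fin m))).filter fun _ => i0 = i)
      = if i0 = i then {univ} else ∅ := by
    intro i
    split_ifs with h <;> simp [h]
  refine ⟨⟨{univ}, fun _ => Mk.v i0 univ, fun _ => i0, ?_, ?_, ?_, ?_, ?_⟩, ?_⟩
  · intro b hb
    rw [mem_singleton] at hb
    rw [hb]
    exact ⟨⟨0, hm⟩, mem_univ _⟩
  · intro b hb b' hb' hne
    rw [mem_singleton] at hb hb'
    exact absurd (hb.trans hb'.symm) hne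
  · simp
  · intro b _; exact hnn _ _
  · intro i T hT
    have h1 : Mk.v i (T.biUnion id) - ∑ b ∈ T, Mk.v i0 univ ≤ 0 := by
      rcases subset_singleton_iff.1 hT with rfl | rfl
      · simp [Mk.v_empty]
      · simpa using hmax i
    rw [hfe i]
    split_ifs with h
    · subst h
      simpa using h1
    · simpa [Mk.v_empty] using h1
  · unfold CBE.welfare
    have h2 : Mk.v i0 univ = Mk.v i0
        ((({univ} : Finset (Finset (Fin m))).filter fun _ => i0 = i0).biUnion id) := by simp
    refine h2.le.trans ?_
    exact single_le_sum (f := fun i => Mk.v i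
      ((({univ} : Finset (Finset (Fin m))).filter fun _ => i0 = i).biUnion id))
      (fun i _ => hnn i _) (mem_univ i0)

theorem lumps {n m : ℕ} {v : Fin n → Finset (Fin m) → ℝ} (hv : ∀ i, CapAdd (v i))
    {S : Fin n → Finset (Fin m)} (hS : IsAllocation S) {p : ℝ} (hp : 0 < p)
    {J : Finset (Fin n)} (hJ : ∀ j ∈ J, p ≤ v j (S j)) (hne : J.Nonempty) :
    ∃ (L : Finset (Finset (Fin m))) (o : Finset (Fin m) → Fin n), Part L ∧ L.card = J.card ∧
      (∀ l ∈ L, ∀ l' ∈ L, o l = o l' → l = l') ∧ ∀ l ∈ L, p ≤ v (o l) l := by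
  classical
  obtain ⟨j0, hj0⟩ := hne
  set C := univ \ J.biUnion S with hC
  let lump : Fin n → Finset (Fin m) := fun j => if j = j0 then S j ∪ C else S j
  have hsub : ∀ j, S j ⊆ lump j := by
    intro j
    show S j ⊆ if j = j0 then S j ∪ C else S j
    split_ifs
    · exact subset_union_left
    · exact Subset.rfl
  have hSne : ∀ j ∈ J, (S j).Nonempty := by
    intro j hj
    rw [nonempty_iff_ne_empty]
    intro he
    have := hJ j hj
    rw [he, (hv j).empty] at this
    linarith
  have hdC : ∀ j ∈ J, Disjoint (S j) C := by
    intro j hj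
    rw [disjoint_left]
    intro x hx hxC
    exact (mem_sdiff.1 hxC).2 (mem_biUnion.2 ⟨j, hj, hx⟩)
  have hdis : ∀ i ∈ J, ∀ j ∈ J, i ≠ j → Disjoint (lump i) (lump j) := by
    intro i hi j hj hij
    show Disjoint (if i = j0 then S i ∪ C else S i) (if j = j0 then S j ∪ C else S j)
    have h1 := hS i j hij
    split_ifs with h2 h3 h3
    · exact absurd (h2.trans h3.symm) hij
    · exact disjoint_union_left.2 ⟨h1, (hdC j hj).symm⟩
    · exact disjoint_union_right.2 ⟨h1, hdC i hi⟩
    · exact h1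
  have hinj : ∀ i ∈ J, ∀ j ∈ J, lump i = lump j → i = j := by
    intro i hi j hj he
    by_contra hij
    have h1 := hdis i hi j hj hij
    rw [← he, disjoint_self_iff_empty] at h1
    obtain ⟨x, hx⟩ := hSne i hi
    have := hsub i hx
    rw [h1] at this
    exact absurd this (notMem_empty _)
  have hox : ∀ l, ∃ j, l ∈ J.image lump → j ∈ J ∧ lump j = l := by
    intro l
    by_cases hl : l ∈ J.image lump
    · obtain ⟨j, hj, he⟩ := mem_image.1 hl
      exact ⟨j, fun _ => ⟨hj, he⟩⟩
    · exact ⟨j0, fun h => absurd h hl⟩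
  choose o ho using hox
  refine ⟨J.image lump, o, ⟨?_, ?_, ?_⟩, ?_, ?_, ?_⟩
  · intro b hb
    obtain ⟨j, hj, rfl⟩ := mem_image.1 hb
    exact (hSne j hj).mono (hsub j)
  · intro b hb b' hb' hbb
    obtain ⟨i, hi, rfl⟩ := mem_image.1 hb
    obtain ⟨j, hj, rfl⟩ := mem_image.1 hb'
    exact hdis i hi j hj (fun e => hbb (by rw [e]))
  · intro x
    by_cases hx : x ∈ J.biUnion S
    · obtain ⟨j, hj, hxj⟩ := mem_biUnion.1 hx
      exact ⟨lump j, mem_image_of_mem _ hj, hsub j hxj⟩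
    · refine ⟨lump j0, mem_image_of_mem _ hj0, ?_⟩
      show x ∈ if j0 = j0 then S j0 ∪ C else S j0
      rw [if_pos rfl]
      exact mem_union_right _ (mem_sdiff.2 ⟨mem_univ _, hx⟩)
  · exact card_image_of_injOn fun i hi j hj he => hinj i hi j hj he
  · intro l hl l' hl' he
    rw [← (ho l hl).2, ← (ho l' hl').2, he]
  · intro l hl
    obtain ⟨h1, h2⟩ := ho l hl
    have h3 := hJ _ h1
    have h4 := (hv (o l)).mono _ _ (hsub (o l))
    rw [h2] at h4
    exact h3.trans h4

theorem bucket_pt {w β : ℝ} (hw : w ≤ β) (hβ : 0 ≤ β) (t : ℕ) :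
    w ≤ β / 2 ^ t + ∑ s ∈ range t, if β / 2 ^ (s + 1) ≤ w then β / 2 ^ (s + 1) else 0 := by
  induction t with
  | zero => simpa using hw
  | succ t ih =>
    rw [sum_range_succ]
    have h1 : β / 2 ^ t = β / 2 ^ (t + 1) + β / 2 ^ (t + 1) := by
      rw [pow_succ]; field_simp; ring
    have h2 : 0 ≤ ∑ s ∈ range t, if β / 2 ^ (s + 1) ≤ w then β / 2 ^ (s + 1) else 0 :=
      sum_nonneg fun s _ => by split_ifs <;> positivity
    split_ifs with h
    · linarith
    · linarith

theorem bucket {n m : ℕ} {w : Fin n → ℝ} {β Ω : ℝ} {t : ℕ} (hβ : 0 < β) (_hw0 : ∀ j, 0 ≤ w j)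
    (hw : ∀ j, w j ≤ β) (hΩ : ∑ j, w j = Ω) (hβΩ : β ≤ Ω)
    (hm : (univ.filter fun j => w j ≠ 0).card ≤ m) (ht : 2 * m < 2 ^ t) (ht0 : 0 < t) :
    ∃ s, Ω ≤ 2 * t * (β / 2 ^ (s + 1) * ((univ.filter fun j => β / 2 ^ (s + 1) ≤ w j).card : ℝ)) := by
  by_contra hcon
  push Not at hcon
  set NZ := univ.filter fun j => w j ≠ 0 with hNZ
  have h1 : Ω = ∑ j ∈ NZ, w j := by
    rw [← hΩ, hNZ]
    exact (sum_filter_ne_zero _).symm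
  have h2 : ∑ j ∈ NZ, w j ≤ ∑ j ∈ NZ, (β / 2 ^ t +
      ∑ s ∈ range t, if β / 2 ^ (s + 1) ≤ w j then β / 2 ^ (s + 1) else 0) :=
    sum_le_sum fun j _ => bucket_pt (hw j) hβ.le t
  rw [sum_add_distrib, sum_comm, sum_const, nsmul_eq_mul] at h2
  have h3 : ∀ s ∈ range t, (∑ j ∈ NZ, if β / 2 ^ (s + 1) ≤ w j then β / 2 ^ (s + 1) else 0)
      ≤ Ω / (2 * t) := by
    intro s _
    have h4 := hcon s
    have h5 : (∑ j ∈ NZ, if β / 2 ^ (s + 1) ≤ w j then β / 2 ^ (s + 1) else 0)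
        ≤ ∑ j, if β / 2 ^ (s + 1) ≤ w j then β / 2 ^ (s + 1) else 0 :=
      sum_le_sum_of_subset_of_nonneg (subset_univ _) fun j _ _ => by split_ifs <;> positivity
    refine h5.trans ?_
    rw [← sum_filter, sum_const, nsmul_eq_mul]
    rw [le_div_iff₀ (by positivity)]
    linarith
  have h6 := sum_le_sum h3
  rw [sum_const, card_range, nsmul_eq_mul] at h6
  have htr : (0 : ℝ) < t := by exact_mod_cast ht0
  have h7 : (t : ℝ) * (Ω / (2 * t)) = Ω / 2 := by field_simp
  have h8 : (NZ.card : ℝ) * (β / 2 ^ t) < β / 2 := by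
    have h9 : (NZ.card : ℝ) ≤ m := by exact_mod_cast hm
    have h10 : (2 * m : ℝ) < 2 ^ t := by exact_mod_cast ht
    rw [← mul_div_assoc, div_lt_div_iff₀ (by positivity) (by norm_num)]
    nlinarith
  linarith

theorem main {n m : ℕ} (hn : 1 ≤ n) (hm : 1 ≤ m) (Mk : Market n m)
    (hb : ∀ i, BudgetAdditive (Mk.v i)) :
    ∃ E : CBE Mk, E.welfare ≥ 1 / 200 * OPT Mk / (Real.logb 2 m + 2) := by
  classical
  have hv : ∀ i, CapAdd (Mk.v i) := fun i =>
    capAdd_of_budgetAdditive (Mk.v_empty i) (Mk.v_mono i) (hb i)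
  -- optimal allocation
  have hopt : ∃ S : Fin n → Finset (Fin m), IsAllocation S ∧ allocWelfare Mk S = OPT Mk := by
    have hfin : {w : ℝ | ∃ S : Fin n → Finset (Fin m),
        IsAllocation S ∧ allocWelfare Mk S = w}.Finite := by
      apply (Set.finite_range (allocWelfare Mk)).subset
      rintro w ⟨S, _, rfl⟩
      exact ⟨S, rfl⟩
    have hne : {w : ℝ | ∃ S : Fin n → Finset (Fin m),
        IsAllocation S ∧ allocWelfare Mk S = w}.Nonempty :=
      ⟨allocWelfare Mk (fun _ => ∅), fun _ => ∅, fun i j _ => disjoint_empty_left _, rfl⟩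
    exact hne.csSup_mem hfin
  have hub : ∀ S : Fin n → Finset (Fin m), IsAllocation S → allocWelfare Mk S ≤ OPT Mk := by
    intro S hS
    refine le_csSup ?_ ⟨S, hS, rfl⟩
    apply Set.Finite.bddAbove
    apply (Set.finite_range (allocWelfare Mk)).subset
    rintro w ⟨S, _, rfl⟩
    exact ⟨S, rfl⟩
  obtain ⟨S, hS, hSopt⟩ := hopt
  obtain ⟨i0, _, hi0⟩ := exists_max_image (univ : Finset (Fin n)) (fun i => Mk.v i univ)
    ⟨⟨0, hn⟩, mem_univ _⟩
  set β := Mk.v i0 univ with hβ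
  set Ω := OPT Mk with hΩ
  have hβ0 : 0 ≤ β := (hv i0).nonneg _
  have hβi : ∀ i, Mk.v i univ ≤ β := fun i => hi0 i (mem_univ i)
  obtain ⟨E0, hE0⟩ := grand Mk hm i0 hβi
  have hlog0 : 0 ≤ Real.logb 2 m := Real.logb_nonneg (by norm_num) (by exact_mod_cast hm)
  have hβΩ : β ≤ Ω := by
    have h1 := hub (fun i => if i = i0 then univ else ∅) (by
      intro i j hij
      by_cases h1 : i = i0
      · have : j ≠ i0 := fun h => hij (h1.trans h.symm)
        simp [this]
      · simp [h1])
    refine le_trans ?_ h1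
    unfold allocWelfare
    have h2 := single_le_sum (f := fun i => Mk.v i (if i = i0 then univ else ∅))
      (fun i _ => (hv i).nonneg _) (mem_univ i0)
    simpa using h2
  rcases hβ0.eq_or_lt with hz | hβpos
  · refine ⟨E0, ?_⟩
    have hΩ0 : Ω ≤ 0 := by
      rw [← hSopt]
      apply sum_nonpos
      intro i _
      exact ((hv i).le_univ _).trans (hz ▸ hβi i)
    have h1 : 1 / 200 * Ω / (Real.logb 2 m + 2) ≤ 0 :=
      div_nonpos_of_nonpos_of_nonneg (by linarith) (by linarith)
    linarith
  set t := Nat.log 2 m + 2 with ht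
  have htlog : (t : ℝ) ≤ Real.logb 2 m + 2 := by
    have := Real.natLog_le_logb m 2
    rw [ht]; push_cast
    simpa using this
  have htpow : 2 * m < 2 ^ t := by
    have := Nat.lt_pow_succ_log_self (b := 2) (by norm_num) m
    rw [ht, pow_succ]
    rw [Nat.succ_eq_add_one] at this
    omega
  have hNZ : (univ.filter fun j => Mk.v j (S j) ≠ 0).card ≤ m := by
    have h1 : (univ.filter fun j => Mk.v j (S j) ≠ 0).card
        ≤ ∑ j ∈ univ.filter fun j => Mk.v j (S j) ≠ 0, (S j).card := by
      rw [card_eq_sum_ones]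
      apply sum_le_sum
      intro j hj
      apply card_pos.2
      rw [nonempty_iff_ne_empty]
      intro he
      exact (mem_filter.1 hj).2 (by rw [he, (hv j).empty])
    rw [← card_biUnion (fun i _ j _ hij => hS i j hij)] at h1
    refine h1.trans ((card_le_univ _).trans ?_)
    simp
  obtain ⟨s, hs⟩ := bucket (w := fun j => Mk.v j (S j)) (m := m) (t := t) hβpos
    (fun j => (hv j).nonneg _) (fun j => ((hv j).le_univ _).trans (hβi j)) hSopt hβΩ hNZ htpow
    (by omega)
  set p := β / 2 ^ (s + 1) with hp
  have hppos : 0 < p := by positivity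
  set J := univ.filter fun j => p ≤ Mk.v j (S j) with hJ
  have htpos : (0 : ℝ) < t := by rw [ht]; positivity
  -- reduction of the target
  have hred : 1 / 200 * Ω / (Real.logb 2 m + 2) ≤ J.card * p / 100 := by
    have hk0 : (0 : ℝ) ≤ J.card * p := by positivity
    rw [div_le_iff₀ (by linarith)]
    have h1 : (J.card : ℝ) * p * t ≤ J.card * p * (Real.logb 2 m + 2) :=
      mul_le_mul_of_nonneg_left htlog hk0
    have h2 : 2 * t * (p * (J.card : ℝ)) = 2 * (J.card * p * t) := by ring
    rw [h2] at hs
    linarith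
  by_cases hcase : J.card * p / 100 ≤ β
  · exact ⟨E0, by linarith⟩
  push Not at hcase
  have hJne : J.Nonempty := by
    rw [← card_pos]
    rcases Nat.eq_zero_or_pos J.card with h | h
    · rw [h] at hcase; simp at hcase; linarith
    · exact h
  obtain ⟨L, o, hL, hLc, ho, hval⟩ := lumps hv hS hppos
    (fun j hj => (mem_filter.1 hj).2) hJne
  obtain ⟨E, hE⟩ := limitCBE Mk (W := L.card * p / 16) (ε0 := p / 2) (by linarith)
    (fun ε h1 h2 => core hv hL ho hppos h1 h2 hval hβi hβ0 (by rw [hLc]; exact hcase))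
  refine ⟨E, ?_⟩
  rw [hLc] at hE
  have hk0 : (0 : ℝ) ≤ J.card * p := by positivity
  linarith

end BAL

/-- There is an absolute constant `c > 0` such that every market with
budget-additive valuations admits a CBE with welfare at least `c * OPT / (log₂ m + 2)`. -/
theorem budget_additive_log_approx :
    ∃ c : ℝ, 0 < c ∧
      ∀ (n m : ℕ), 1 ≤ n → 1 ≤ m → ∀ (Mk : Market n m),
        (∀ i, BudgetAdditive (Mk.v i)) →
        ∃ E : CBE Mk, E.welfare ≥ c * OPT Mk / (Real.logb 2 m + 2) := by
  exact ⟨1 / 200, by norm_num, fun n m hn hm Mk hb => BAL.main hn hm Mk hb⟩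
end

section
/- For every ε > 0 there exists a combinatorial market with n = 3 consumers and m = 3 items, all of whose valuations are budget-additive, such that every competitive bundling equilibrium has welfare at most (4/5 + ε) · OPT. -/
open Finset

/-- Item weights of the hard instance. -/
def hardW (d : ℝ) : Fin 3 → Fin 3 → ℝ :=
  ![![1 + d, 1 + d, 2 + 2 * d], ![0, 0, 2], ![2, 2, 0]]

/-- Budgets of the hard instance. -/
def hardB (d : ℝ) : Fin 3 → ℝ := ![2 + 2 * d, 2, 2]

lemma hardW_nonneg (d : ℝ) (hd : 0 < d) (i j : Fin 3) : 0 ≤ hardW d i j := by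
  fin_cases i <;> fin_cases j <;> simp [hardW] <;> linarith

lemma hardB_nonneg (d : ℝ) (hd : 0 < d) (i : Fin 3) : 0 ≤ hardB d i := by
  fin_cases i <;> simp [hardB]; linarith

lemma hardW_le (d : ℝ) (hd : 0 < d) (i j : Fin 3) : hardW d i j ≤ hardB d i := by
  fin_cases i <;> fin_cases j <;> simp [hardW, hardB] <;> linarith

/-- The hard instance. -/
noncomputable def hardMk (d : ℝ) (hd : 0 < d) : Market 3 3 where
  v i S := min (∑ j ∈ S, hardW d i j) (hardB d i)
  v_empty i := by simpa using hardB_nonneg d hd i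
  v_mono i S T h := min_le_min_right _
    (Finset.sum_le_sum_of_subset_of_nonneg h fun j _ _ => hardW_nonneg d hd i j)

lemma hard_ba (d : ℝ) (hd : 0 < d) (i : Fin 3) : BudgetAdditive ((hardMk d hd).v i) := by
  refine ⟨hardB d i, hardB_nonneg d hd i, fun S => ?_⟩
  simp only [hardMk, Finset.sum_singleton]
  congr 1
  exact Finset.sum_congr rfl fun j _ => (min_eq_left (hardW_le d hd i j)).symm

lemma hard_opt (d : ℝ) (hd : 0 < d) : 5 + d ≤ OPT (hardMk d hd) := by
  apply le_csSup
  · apply Set.Finite.bddAbove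
    apply Set.Finite.subset (Set.finite_range (allocWelfare (hardMk d hd)))
    rintro w ⟨S, _, rfl⟩
    exact ⟨S, rfl⟩
  · refine ⟨![{0}, {2}, {1}], ?_, ?_⟩
    · unfold IsAllocation; decide
    · simp [allocWelfare, Fin.sum_univ_three, hardMk, hardW, hardB]
      rw [min_eq_left (by linarith)]
      ring

lemma hard_welfare (d : ℝ) (hd : 0 < d) (E : CBE (hardMk d hd)) :
    E.welfare ≤ 4 + 2 * d := by
  set A : Fin 3 → Finset (Fin 3) :=
    fun i => (E.bundles.filter fun b => E.assign b = i).biUnion id with hA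
  have hW : E.welfare = (hardMk d hd).v 0 (A 0) + (hardMk d hd).v 1 (A 1)
      + (hardMk d hd).v 2 (A 2) := by
    simp only [CBE.welfare, Fin.sum_univ_three, hA]
  have u0 : ∀ S, (hardMk d hd).v 0 S ≤ 2 + 2 * d := fun S => min_le_right _ _
  have u1 : ∀ S, (hardMk d hd).v 1 S ≤ 2 := fun S => min_le_right _ _
  have u2 : ∀ S, (hardMk d hd).v 2 S ≤ 2 := fun S => min_le_right _ _
  by_cases hne : ∃ i, A i = ∅
  · obtain ⟨i, hi⟩ := hne
    have h0 := (hardMk d hd).v_empty i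
    rw [← hi] at h0
    have := u0 (A 0)
    have := u1 (A 1)
    have := u2 (A 2)
    fin_cases i <;> simp at h0 <;> linarith
  push Not at hne
  have hdisj : ∀ i j, i ≠ j → Disjoint (A i) (A j) := by
    intro i j hij
    simp only [hA, Finset.disjoint_biUnion_left, Finset.disjoint_biUnion_right,
      Finset.mem_filter, id]
    rintro b ⟨hb, rfl⟩ b' ⟨hb', rfl⟩
    exact E.bundles_disjoint _ (by assumption) _ (by assumption) (by rintro rfl; exact hij rfl)
  have hcard : (A 0).card + (A 1).card + (A 2).card ≤ 3 := by
    rw [← Finset.card_union_of_disjoint (hdisj 0 1 (by decide)),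
      ← Finset.card_union_of_disjoint (Finset.disjoint_union_left.2
        ⟨hdisj 0 2 (by decide), hdisj 1 2 (by decide)⟩)]
    exact Finset.card_le_univ _
  have c0 := Finset.card_pos.2 (hne 0)
  have c1 := Finset.card_pos.2 (hne 1)
  have c2 := Finset.card_pos.2 (hne 2)
  have hone : ∀ i, (A i).card = 1 := by
    intro i; fin_cases i <;> simp <;> omega
  by_cases h2 : (2 : Fin 3) ∈ A 1
  swap
  · have : (hardMk d hd).v 1 (A 1) ≤ 0 := by
      refine (min_le_left _ _).trans (le_of_eq (Finset.sum_eq_zero fun j hj => ?_))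
      fin_cases j
      · simp [hardW]
      · simp [hardW]
      · exact absurd hj h2
    have := u0 (A 0)
    have := u2 (A 2)
    linarith
  exfalso
  have hup : (hardMk d hd).v 0 (A 0) ≤ 1 + d := by
    obtain ⟨x, hx⟩ := Finset.card_eq_one.1 (hone 0)
    have hx2 : x ≠ 2 := by
      rintro rfl
      exact Finset.disjoint_left.1 (hdisj 0 1 (by decide)) (by simp [hx]) h2
    rw [hx]
    refine (min_le_left _ _).trans ?_
    fin_cases x
    · simp [hardW]
    · simp [hardW]
    · exact absurd rfl hx2
  have hsub : ∀ b ∈ E.bundles, b ⊆ A (E.assign b) := by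
    intro b hb
    exact Finset.subset_biUnion_of_mem id (Finset.mem_filter.2 ⟨hb, rfl⟩)
  have hb1 : ∀ b ∈ E.bundles, b.card = 1 := by
    intro b hb
    have h1 := Finset.card_le_card (hsub b hb)
    have h2 := Finset.card_pos.2 (E.bundles_nonempty b hb)
    rw [hone] at h1
    omega
  have hmem : ∀ x : Fin 3, {x} ∈ E.bundles := by
    intro x
    have hx : x ∈ E.bundles.biUnion id := by rw [E.bundles_cover]; simp
    obtain ⟨b, hb, hxb⟩ := Finset.mem_biUnion.1 hx
    obtain ⟨y, rfl⟩ := Finset.card_eq_one.1 (hb1 b hb)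
    simp only [id, Finset.mem_singleton] at hxb
    subst hxb
    exact hb
  have hbund : E.bundles = {{0}, {1}, {2}} := by
    ext b
    constructor
    · intro hb
      obtain ⟨y, rfl⟩ := Finset.card_eq_one.1 (hb1 b hb)
      fin_cases y <;> simp
    · intro hb
      simp only [Finset.mem_insert, Finset.mem_singleton] at hb
      rcases hb with rfl | rfl | rfl <;> exact hmem _
  have hp : ∑ i, ∑ b ∈ E.bundles.filter (fun b => E.assign b = i), E.price b
      = E.price {0} + E.price {1} + E.price {2} := by
    rw [Finset.sum_fiberwise, hbund, Finset.sum_insert (by decide),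
      Finset.sum_insert (by decide), Finset.sum_singleton]
    ring
  rw [Fin.sum_univ_three] at hp
  have p1 := E.profit_max 0 {{0}, {1}} (by rw [hbund]; decide)
  have p2 := E.profit_max 0 {{2}} (by rw [hbund]; decide)
  have p3 := E.profit_max 1 {{2}} (by rw [hbund]; decide)
  have p4 := E.profit_max 1 ∅ (by simp)
  have p5 := E.profit_max 2 {{0}} (by rw [hbund]; decide)
  have p6 := E.profit_max 2 {{1}} (by rw [hbund]; decide)
  change (hardMk d hd).v 0 (A 0) - _ ≥ _ at p1 p2
  change (hardMk d hd).v 1 (A 1) - _ ≥ _ at p3 p4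
  change (hardMk d hd).v 2 (A 2) - _ ≥ _ at p5 p6
  have e1 : (hardMk d hd).v 0 (({{0}, {1}} : Finset (Finset (Fin 3))).biUnion id)
      = 2 + 2 * d := by
    have : ({{0}, {1}} : Finset (Finset (Fin 3))).biUnion id = {0, 1} := by decide
    rw [this]
    simp [hardMk, hardW, hardB]
    linarith
  have e2 : (hardMk d hd).v 0 (({{2}} : Finset (Finset (Fin 3))).biUnion id)
      = 2 + 2 * d := by
    simp [hardMk, hardW, hardB]
  have e3 : (hardMk d hd).v 1 (({{2}} : Finset (Finset (Fin 3))).biUnion id) = 2 := by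
    simp [hardMk, hardW, hardB]
  have e4 : (hardMk d hd).v 1 ((∅ : Finset (Finset (Fin 3))).biUnion id) = 0 := by
    simp [hardMk, hardB]
  have e5 : (hardMk d hd).v 2 (({{0}} : Finset (Finset (Fin 3))).biUnion id) = 2 := by
    simp [hardMk, hardW, hardB]
  have e6 : (hardMk d hd).v 2 (({{1}} : Finset (Finset (Fin 3))).biUnion id) = 2 := by
    simp [hardMk, hardW, hardB]
  rw [e1, Finset.sum_pair (by decide)] at p1
  rw [e2, Finset.sum_singleton] at p2
  rw [e3, Finset.sum_singleton] at p3
  rw [e4, Finset.sum_empty] at p4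
  rw [e5, Finset.sum_singleton] at p5
  rw [e6, Finset.sum_singleton] at p6
  have := u1 (A 1)
  have := u2 (A 2)
  linarith

/-- For every `ε > 0` there is a market with 3 budget-additive consumers
and 3 items in which every CBE has welfare at most `(4/5 + ε) * OPT`. -/
theorem budget_additive_lower_bound (ε : ℝ) (hε : 0 < ε) :
    ∃ Mk : Market 3 3, (∀ i, BudgetAdditive (Mk.v i)) ∧
      ∀ E : CBE Mk, E.welfare ≤ (4 / 5 + ε) * OPT Mk := by
  refine ⟨hardMk ε hε, hard_ba ε hε, fun E => ?_⟩
  have h1 := hard_welfare ε hε E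
  have h2 := hard_opt ε hε
  nlinarith [mul_le_mul_of_nonneg_left h2 (by linarith : (0 : ℝ) ≤ 4 / 5 + ε), sq_nonneg ε]
end
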